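/- Let m, n ≥ 2. For every real ω̂ with m/n ≤ ω̂ ≤ m²/(m+1) there exists a totally irrational matrix ξ ∈ ℝ^{n×m} that satisfies both Property (B) and Property (C), is not badly approximable (not Property (A)), and has uniform exponent ω̂(ξ) = ω̂. -/

import Mathlib

open Filter

/-- The sup-norm of the `i`-th integer vector `x i`, viewed in `ℝ^m`. -/
noncomputable def Xval {m : ℕ} (x : ℕ → Fin m → ℤ) (i : ℕ) : ℝ :=
  ‖(fun j => (x i j : ℝ))‖

/-- The sup-norm of the remainder `ξ 𝒙ᵢ − 𝒚ᵢ`. -/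
noncomputable def Lval {m n : ℕ} (ξ : Matrix (Fin n) (Fin m) ℝ)
    (x : ℕ → Fin m → ℤ) (y : ℕ → Fin n → ℤ) (i : ℕ) : ℝ :=
  ‖(ξ.mulVec (fun j => (x i j : ℝ)) - (fun k => (y i k : ℝ)))‖

/-- `ξ` is totally irrational: `‖ξ𝒙 − 𝒚‖ > 0` for every nonzero integer pair `(𝒙,𝒚)`. -/
def TotallyIrrational {m n : ℕ} (ξ : Matrix (Fin n) (Fin m) ℝ) : Prop :=
  ∀ (u : Fin m → ℤ) (v : Fin n → ℤ), (u, v) ≠ 0 →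
    0 < ‖(ξ.mulVec (fun j => (u j : ℝ)) - (fun k => (v k : ℝ)))‖

/-- `(𝒙ᵢ, 𝒚ᵢ)_{i}` is a sequence of best approximation vectors for `ξ`
(with respect to the sup norms). -/
structure IsBestApproxSeq {m n : ℕ} (ξ : Matrix (Fin n) (Fin m) ℝ)
    (x : ℕ → Fin m → ℤ) (y : ℕ → Fin n → ℤ) : Prop where
  nonzero : ∀ i, x i ≠ 0
  first : Xval x 0 = 1
  xStrictMono : StrictMono (Xval x)
  lStrictAnti : StrictAnti (Lval ξ x y)
  best : ∀ (i : ℕ) (u : Fin m → ℤ) (v : Fin n → ℤ), u ≠ 0 →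
    ‖(fun j => (u j : ℝ))‖ < Xval x (i + 1) →
    Lval ξ x y i ≤ ‖(ξ.mulVec (fun j => (u j : ℝ)) - (fun k => (v k : ℝ)))‖

/-- Property (A): `ξ` is badly approximable. -/
def PropA {m n : ℕ} (ξ : Matrix (Fin n) (Fin m) ℝ) : Prop :=
  ∃ c : ℝ, 0 < c ∧ ∀ (u : Fin m → ℤ) (v : Fin n → ℤ), u ≠ 0 →
    c ≤ ‖(fun j => (u j : ℝ))‖ ^ m *
        ‖(ξ.mulVec (fun j => (u j : ℝ)) - (fun k => (v k : ℝ)))‖ ^ n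

/-- Property (B): the ratios `X_{i+1}/X_i` are bounded. -/
def PropB {m : ℕ} (x : ℕ → Fin m → ℤ) : Prop :=
  ∃ M : ℝ, ∀ i : ℕ, Xval x (i + 1) / Xval x i ≤ M

/-- Property (C): the ratios `L_i/L_{i+1}` are bounded. -/
def PropC {m n : ℕ} (ξ : Matrix (Fin n) (Fin m) ℝ)
    (x : ℕ → Fin m → ℤ) (y : ℕ → Fin n → ℤ) : Prop :=
  ∃ M : ℝ, ∀ i : ℕ, Lval ξ x y i / Lval ξ x y (i + 1) ≤ M

/-- The ordinary exponent `ω(ξ) = limsup (−log Lᵢ)/(log Xᵢ)`, as a value in `[0,+∞]`. -/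
noncomputable def ordExp {m n : ℕ} (ξ : Matrix (Fin n) (Fin m) ℝ)
    (x : ℕ → Fin m → ℤ) (y : ℕ → Fin n → ℤ) : EReal :=
  limsup (fun i => ((-Real.log (Lval ξ x y i) / Real.log (Xval x i) : ℝ) : EReal)) atTop

/-- The uniform exponent `ω̂(ξ) = liminf (−log Lᵢ)/(log X_{i+1})`, as a value in `[0,+∞]`. -/
noncomputable def unifExp {m n : ℕ} (ξ : Matrix (Fin n) (Fin m) ℝ)
    (x : ℕ → Fin m → ℤ) (y : ℕ → Fin n → ℤ) : EReal :=
  liminf (fun i => ((-Real.log (Lval ξ x y i) / Real.log (Xval x (i + 1)) : ℝ) : EReal)) atTop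

/-- The real vector underlying an integer vector. -/
def iv {ι : Type*} (a : ι → ℤ) : ι → ℝ := fun j => (a j : ℝ)

lemma iv_ne_zero {ι : Type*} {a : ι → ℤ} (ha : a ≠ 0) : iv a ≠ 0 := by
  contrapose! ha
  ext j
  have := congrFun ha j
  simpa [iv] using this

lemma iv_sub {ι : Type*} (a b : ι → ℤ) : iv (a - b) = iv a - iv b := by
  ext j; simp [iv]

lemma iv_add {ι : Type*} (a b : ι → ℤ) : iv (a + b) = iv a + iv b := by
  ext j; simp [iv]

lemma iv_mulVec {ι κ : Type*} [Fintype κ] (B : Matrix ι κ ℤ) (a : κ → ℤ) :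
    iv (B.mulVec a) = (B.map (fun z : ℤ => (z : ℝ))).mulVec (iv a) := by
  ext j; simp [iv, Matrix.mulVec, dotProduct]

/-- The standard integer lattice as the span of the standard basis. -/
lemma exists_iv_of_mem_span {ι : Type*} [Fintype ι] [DecidableEq ι] {v : ι → ℝ}
    (hv : v ∈ Submodule.span ℤ (Set.range (Pi.basisFun ℝ ι))) : ∃ a : ι → ℤ, v = iv a := by
  rw [(Pi.basisFun ℝ ι).mem_span_iff_repr_mem ℤ] at hv
  choose a ha using hv
  exact ⟨a, by ext i; simpa [iv] using (ha i).symm⟩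

/-- **Minkowski's theorem on linear forms.** -/
lemma exists_int_mulVec_lt {ι : Type*} [Fintype ι] [DecidableEq ι] (g : Matrix ι ι ℝ)
    (hg : g.det ≠ 0) (w : ι → ℝ) (hw : ∀ j, 0 < w j) (hlt : |g.det| < ∏ j, w j) :
    ∃ a : ι → ℤ, a ≠ 0 ∧ ∀ j, |g.mulVec (iv a) j| < w j := by
  classical
  set s : Set (ι → ℝ) := (Matrix.toLin' g) ⁻¹' (Set.univ.pi fun j => Set.Ioo (-w j) (w j)) with hs
  have hsym : ∀ x ∈ s, -x ∈ s := by
    intro x hx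
    simp only [hs, Set.mem_preimage, Set.mem_pi, Set.mem_univ, true_implies, Set.mem_Ioo] at hx ⊢
    intro i
    have := hx i
    simp only [map_neg, Pi.neg_apply]
    constructor <;> linarith [this.1, this.2]
  have hconv : Convex ℝ s :=
    (convex_pi fun i _ => convex_Ioo _ _).linear_preimage _
  have hvol : MeasureTheory.volume s = ENNReal.ofReal (|g.det|⁻¹ * ∏ j, (2 * w j)) := by
    rw [hs, MeasureTheory.Measure.addHaar_preimage_linearMap _ (by simpa using hg),
      Real.volume_pi_Ioo, ← ENNReal.ofReal_prod_of_nonneg (fun i _ => by linarith [hw i]),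
      ← ENNReal.ofReal_mul (abs_nonneg _)]
    congr 1
    rw [LinearMap.det_toLin', abs_inv]
    congr 1
    exact Finset.prod_congr rfl fun i _ => by ring
  have hF := ZSpan.isAddFundamentalDomain' (Pi.basisFun ℝ ι) MeasureTheory.volume
  have hFv : MeasureTheory.volume (ZSpan.fundamentalDomain (Pi.basisFun ℝ ι)) = 1 := by
    rw [ZSpan.fundamentalDomain_pi_basisFun, Real.volume_pi_Ico]; simp
  have key : MeasureTheory.volume (ZSpan.fundamentalDomain (Pi.basisFun ℝ ι))
      * 2 ^ Module.finrank ℝ (ι → ℝ) < MeasureTheory.volume s := by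
    rw [hFv, hvol, one_mul, Module.finrank_fintype_fun_eq_card, Finset.prod_mul_distrib,
      Finset.prod_const, Finset.card_univ]
    have h2 : (2 : ENNReal) ^ Fintype.card ι = ENNReal.ofReal (2 ^ Fintype.card ι) := by
      rw [ENNReal.ofReal_pow (by norm_num)]; norm_num
    rw [h2]
    have hd : 0 < |g.det| := abs_pos.mpr hg
    have : (2:ℝ) ^ Fintype.card ι < |g.det|⁻¹ * (2 ^ Fintype.card ι * ∏ j, w j) := by
      rw [← mul_assoc, mul_comm (|g.det|⁻¹), mul_assoc]
      refine lt_mul_of_one_lt_right (by positivity) ?_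
      rw [inv_mul_eq_div]
      exact (one_lt_div hd).mpr hlt
    exact (ENNReal.ofReal_lt_ofReal_iff (lt_trans (by positivity) this)).mpr this
  have : Countable (Submodule.span ℤ (Set.range (Pi.basisFun ℝ ι))).toAddSubgroup :=
    inferInstanceAs (Countable (Submodule.span ℤ (Set.range (Pi.basisFun ℝ ι))))
  obtain ⟨v, hv0, hvs⟩ := MeasureTheory.exists_ne_zero_mem_lattice_of_measure_mul_two_pow_lt_measure
    hF hsym hconv key
  obtain ⟨a, ha⟩ := exists_iv_of_mem_span v.2
  refine ⟨a, ?_, ?_⟩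
  · rintro rfl
    apply hv0
    ext i
    simp [ha, iv]
  · intro j
    rw [ha] at hvs
    simp only [hs, Set.mem_preimage, Set.mem_pi, Set.mem_univ, true_implies, Set.mem_Ioo,
      Matrix.toLin'_apply] at hvs
    exact abs_lt.mpr (hvs j)

/-- A bounded integer matrix can be refined to a bounded unimodular one. -/
lemma exists_unimodular_of_bounded {ι : Type*} [Fintype ι] [DecidableEq ι] (g : Matrix ι ι ℝ)
    (N : ℕ) : ∀ (K : ℝ), 0 ≤ K → ∀ A : Matrix ι ι ℤ, A.det.natAbs ≤ N → A.det ≠ 0 →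
      (∀ i j, |(g * A.map (fun z : ℤ => (z : ℝ))) i j| ≤ K) →
      ∃ U : Matrix ι ι ℤ, |U.det| = 1 ∧
        ∀ i j, |(g * U.map (fun z : ℤ => (z : ℝ))) i j| ≤ (Fintype.card ι + 1) ^ N * K := by
  induction N with
  | zero =>
    intro K _ A hA hA0
    exact absurd (by simpa using hA) hA0
  | succ N ih =>
    intro K hK A hA hA0 hb
    have hp1 : (1:ℝ) ≤ Fintype.card ι + 1 := by linarith [Nat.cast_nonneg (α := ℝ) (Fintype.card ι)]
    by_cases h1 : |A.det| = 1
    · refine ⟨A, h1, fun i j => (hb i j).trans ?_⟩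
      exact le_mul_of_one_le_left hK (one_le_pow₀ hp1)
    set Ar : Matrix ι ι ℝ := A.map (fun z : ℤ => (z : ℝ)) with hAr
    have hdet : Ar.det = (A.det : ℝ) := (Int.cast_det A).symm
    have hArdet : Ar.det ≠ 0 := by rw [hdet]; exact_mod_cast hA0
    have hunit : IsUnit Ar.det := isUnit_iff_ne_zero.mpr hArdet
    -- some column of the inverse is not integral
    have hex : ∃ k i, ∀ z : ℤ, Ar⁻¹ i k ≠ z := by
      by_contra! hcon
      choose B hB using hcon
      have hBm : Ar⁻¹ = (Matrix.of fun i k => B k i).map (fun z : ℤ => (z : ℝ)) := by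
        ext i k; simpa using hB k i
      have h2 : Ar * Ar⁻¹ = 1 := Matrix.mul_nonsing_inv _ hunit
      have h3 := congrArg Matrix.det h2
      rw [Matrix.det_mul, hdet, hBm, ← Int.cast_det, Matrix.det_one] at h3
      have h4 : A.det * (Matrix.of fun i k => B k i).det = 1 := by exact_mod_cast h3
      exact h1 (Int.isUnit_iff_abs_eq.mp (IsUnit.of_mul_eq_one _ h4))
    obtain ⟨k, i, hki⟩ := hex
    set wv : ι → ℝ := fun j => Ar⁻¹ j k with hwv
    set f : ι → ℝ := fun j => wv j - round (wv j) with hf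
    set b : ι → ℤ := fun l => (if l = k then 1 else 0) - A.mulVec (fun j => round (wv j)) l with hbdef
    have hAw : Ar.mulVec wv = Pi.single k 1 := by
      have h2 : Ar * Ar⁻¹ = 1 := Matrix.mul_nonsing_inv _ hunit
      ext l
      have := congrFun (congrFun h2 l) k
      rw [Matrix.mul_apply] at this
      simp only [Matrix.mulVec, dotProduct, hwv, this, Matrix.one_apply, Pi.single_apply]
    have hAf : Ar.mulVec f = iv b := by
      have : f = wv - iv (fun j => round (wv j)) := by ext j; simp [hf, iv]
      rw [this, Matrix.mulVec_sub, hAw, hAr, ← iv_mulVec]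
      ext l
      simp [iv, hbdef, Pi.single_apply]
    have hfi : f i ≠ 0 := by
      intro h0
      exact hki (round (wv i)) (by simp only [hf] at h0; linarith)
    have hfb : ∀ j, |f j| ≤ 1 / 2 := fun j => abs_sub_round _
    set A' := A.updateCol i b with hA'
    have hA'map : A'.map (fun z : ℤ => (z : ℝ)) = Ar.updateCol i (iv b) := by
      rw [hA', Matrix.map_updateCol]; rfl
    have hdet' : (A'.det : ℝ) = f i * A.det := by
      rw [Int.cast_det, hA'map, ← Matrix.cramer_apply, ← hAf, Matrix.cramer_eq_adjugate_mulVec,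
        Matrix.mulVec_mulVec, Matrix.adjugate_mul, Matrix.smul_mulVec, Matrix.one_mulVec, hdet]
      simp [mul_comm]
    have hA'0 : A'.det ≠ 0 := by
      intro h0
      rw [h0] at hdet'
      have : f i * (A.det : ℝ) ≠ 0 := mul_ne_zero hfi (by exact_mod_cast hA0)
      exact this (by simpa using hdet'.symm)
    have hA'N : A'.det.natAbs ≤ N := by
      have h5 : |(A'.det : ℝ)| ≤ 1 / 2 * |(A.det : ℝ)| := by
        rw [hdet', abs_mul]; exact mul_le_mul_of_nonneg_right (hfb i) (abs_nonneg _)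
      have h6 : 2 * |A'.det| ≤ |A.det| := by
        have : (2:ℝ) * |(A'.det : ℝ)| ≤ |(A.det:ℝ)| := by linarith
        exact_mod_cast this
      rw [← Int.natCast_natAbs, ← Int.natCast_natAbs] at h6
      omega
    have hb' : ∀ l j, |(g * A'.map (fun z : ℤ => (z : ℝ))) l j| ≤ (Fintype.card ι + 1) * K := by
      intro l j
      by_cases hji : j = i
      · subst hji
        have : (g * A'.map (fun z : ℤ => (z : ℝ))) l j = (g * Ar).mulVec f l := by
          rw [← Matrix.mulVec_mulVec, hAf, hA'map, Matrix.mul_apply]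
          simp [Matrix.mulVec, dotProduct]
        rw [this]
        calc |(g * Ar).mulVec f l| ≤ ∑ t, |(g * Ar) l t * f t| := by
              simp only [Matrix.mulVec, dotProduct]; exact Finset.abs_sum_le_sum_abs _ _
          _ ≤ ∑ t : ι, K := by
              refine Finset.sum_le_sum fun t _ => ?_
              rw [abs_mul]
              calc _ ≤ K * (1/2) := mul_le_mul (hb l t) (hfb t) (abs_nonneg _) hK
                _ ≤ K := by linarith
          _ = Fintype.card ι * K := by simp
          _ ≤ _ := by nlinarith
      · have : (g * A'.map (fun z : ℤ => (z : ℝ))) l j = (g * Ar) l j := by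
          rw [hA'map, Matrix.mul_apply, Matrix.mul_apply]
          refine Finset.sum_congr rfl fun t _ => ?_
          rw [Matrix.updateCol_ne hji]
        rw [this]
        exact (hb l j).trans (le_mul_of_one_le_left hK hp1)
    obtain ⟨U, hU, hUb⟩ := ih _ (by positivity) A' hA'N hA'0 hb'
    refine ⟨U, hU, fun l j => (hUb l j).trans (le_of_eq ?_)⟩
    rw [pow_succ]; ring

/-- **Reduction of unimodular lattices** with a lower bound on the first minimum. -/
lemma exists_reduced (ι : Type*) [Fintype ι] [DecidableEq ι] {ρ : ℝ} (hρ : 0 < ρ) :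
    ∃ K : ℝ, 1 ≤ K ∧ ∀ g : Matrix ι ι ℝ, |g.det| = 1 →
      (∀ a : ι → ℤ, a ≠ 0 → ρ ≤ ‖g.mulVec (iv a)‖) →
      ∃ U : Matrix ι ι ℤ, |U.det| = 1 ∧
        ∀ i j, |(g * U.map (fun z : ℤ => (z : ℝ))) i j| ≤ K := by
  set p := Fintype.card ι with hp
  set δ : ℝ := min ρ 1 / (p + 2) with hδ
  have hδ0 : 0 < δ := by positivity
  set K₁ : ℝ := max 1 (2 * (δ ^ (p - 1))⁻¹) with hK₁
  set M : ℝ := (p.factorial : ℝ) * K₁ ^ p with hM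
  have hK1 : 1 ≤ K₁ := le_max_left _ _
  refine ⟨((p:ℝ) + 1) ^ ⌊M⌋₊ * K₁, ?_, ?_⟩
  · exact one_le_mul_of_one_le_of_one_le (one_le_pow₀ (by linarith [Nat.cast_nonneg (α := ℝ) p])) hK1
  intro g hg hlow
  have hgdet : g.det ≠ 0 := by intro h; simp [h] at hg
  have hδm : δ < min ρ 1 := by
    have : 0 < min ρ 1 := by positivity
    rw [hδ, div_lt_iff₀ (by positivity)]
    nlinarith [Nat.cast_nonneg (α := ℝ) p]
  have hδρ : δ < ρ := hδm.trans_le (min_le_left _ _)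
  have hδ1 : δ ≤ 1 := hδm.le.trans (min_le_right _ _)
  have hcol : ∀ j : ι, ∃ a : ι → ℤ, ρ ≤ |g.mulVec (iv a) j| ∧ (∀ i, |g.mulVec (iv a) i| ≤ K₁) ∧
      ∀ i, i ≠ j → |g.mulVec (iv a) i| < δ := by
    intro j
    set w : ι → ℝ := Function.update (fun _ => δ) j (2 * (δ ^ (p - 1))⁻¹) with hw
    have hprod : ∏ i, w i = 2 := by
      rw [hw, Finset.prod_update_of_mem (Finset.mem_univ j), Finset.prod_const]
      rw [Finset.card_sdiff_of_subset (by simp)]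
      simp only [Finset.card_univ, Finset.card_singleton, ← hp]
      field_simp
    obtain ⟨a, ha0, ha⟩ := exists_int_mulVec_lt g hgdet w (by
      intro i
      by_cases h : i = j
      · subst h; simp [hw]; positivity
      · simp [hw, h, hδ0]) (by rw [hprod, hg]; norm_num)
    have hne : ∀ i, i ≠ j → |g.mulVec (iv a) i| < δ := fun i hi => by
      simpa [hw, hi] using ha i
    refine ⟨a, ?_, ?_, hne⟩
    · by_contra! hlt
      have := hlow a ha0
      have h2 : ‖g.mulVec (iv a)‖ < ρ := by
        rw [pi_norm_lt_iff hρ]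
        intro i
        rw [Real.norm_eq_abs]
        by_cases h : i = j
        · rwa [h]
        · exact (hne i h).trans hδρ
      linarith
    · intro i
      by_cases h : i = j
      · have := ha i
        rw [h, hw, Function.update_self] at this
        rw [h]
        exact this.le.trans (le_max_right _ _)
      · exact ((hne i h).le.trans hδ1).trans hK1
  choose a ha1 ha2 ha3 using hcol
  set A : Matrix ι ι ℤ := Matrix.of fun i j => a j i with hA
  have hgA : ∀ i j, (g * A.map (fun z : ℤ => (z : ℝ))) i j = g.mulVec (iv (a j)) i := by
    intro i j
    simp [Matrix.mul_apply, Matrix.mulVec, dotProduct, hA, iv]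
  have hdet0 : (g * A.map (fun z : ℤ => (z : ℝ))).det ≠ 0 := by
    apply det_ne_zero_of_sum_col_lt_diag
    intro k
    calc ∑ i ∈ Finset.univ.erase k, ‖(g * A.map (fun z : ℤ => (z : ℝ))) i k‖
        ≤ ∑ i ∈ Finset.univ.erase k, δ := by
          refine Finset.sum_le_sum fun i hi => ?_
          rw [hgA, Real.norm_eq_abs]
          exact (ha3 k i (Finset.ne_of_mem_erase hi)).le
      _ = (p - 1 : ℕ) * δ := by
          rw [Finset.sum_const, Finset.card_erase_of_mem (Finset.mem_univ k), nsmul_eq_mul,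
            Finset.card_univ]
      _ ≤ p * δ := by gcongr; simp
      _ < (p + 2) * δ := by nlinarith
      _ = min ρ 1 := by rw [hδ]; field_simp
      _ ≤ ρ := min_le_left _ _
      _ ≤ _ := by rw [hgA, Real.norm_eq_abs]; exact ha1 k
  have hAdet : (A.det : ℝ) = (A.map (fun z : ℤ => (z : ℝ))).det := Int.cast_det A
  have hA0 : A.det ≠ 0 := by
    intro h
    apply hdet0
    rw [Matrix.det_mul, ← hAdet, h]; simp
  have hAM : (A.det.natAbs : ℝ) ≤ M := by
    have h1 := Matrix.det_le (A := g * A.map (fun z : ℤ => (z : ℝ)))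
      (abv := AbsoluteValue.abs) (x := K₁) (fun i j => by
        rw [hgA]; exact ha2 j i)
    rw [Matrix.det_mul, ← hAdet] at h1
    simp only [AbsoluteValue.abs_apply, abs_mul, hg, one_mul, nsmul_eq_mul] at h1
    rw [Nat.cast_natAbs, Int.cast_abs]
    exact h1
  obtain ⟨U, hU, hb⟩ := exists_unimodular_of_bounded g ⌊M⌋₊ K₁ (by linarith) A
    (Nat.le_floor hAM) hA0 (fun i j => by rw [hgA]; exact ha2 j i)
  exact ⟨U, hU, hb⟩

/-- Counting lattice points in a ball, for a unimodular lattice with first minimum at least `ρ`. -/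
lemma exists_card_le (ι : Type*) [Fintype ι] [DecidableEq ι] {ρ : ℝ} (hρ : 0 < ρ) :
    ∃ K : ℝ, 0 ≤ K ∧ ∀ g : Matrix ι ι ℝ, |g.det| = 1 →
      (∀ a : ι → ℤ, a ≠ 0 → ρ ≤ ‖g.mulVec (iv a)‖) →
      ∀ T : ℝ, 0 ≤ T → ∀ S : Finset (ι → ℤ), (∀ a ∈ S, ‖g.mulVec (iv a)‖ ≤ T) →
        (S.card : ℝ) ≤ (2 * (T + K)) ^ Fintype.card ι := by
  obtain ⟨K, hK1, hK⟩ := exists_reduced ι hρ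
  refine ⟨Fintype.card ι * K, by positivity, fun g hg hlow T hT S hS => ?_⟩
  obtain ⟨U, hU, hUb⟩ := hK g hg hlow
  set g' := g * U.map (fun z : ℤ => (z : ℝ)) with hg'
  have hUunit : IsUnit U.det := Int.isUnit_iff_abs_eq.mpr hU
  have hg'det : |g'.det| = 1 := by
    rw [hg', Matrix.det_mul, abs_mul, hg, ← Int.cast_det, ← Int.cast_abs, hU]; simp
  have hg'0 : g'.det ≠ 0 := by intro h; simp [h] at hg'det
  set φ : (ι → ℤ) → (ι → ℤ) := fun a => U⁻¹.mulVec a with hφ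
  have hφU : ∀ a, U.mulVec (φ a) = a := by
    intro a
    rw [hφ, Matrix.mulVec_mulVec, Matrix.mul_nonsing_inv _ hUunit, Matrix.one_mulVec]
  have hφg : ∀ a, g'.mulVec (iv (φ a)) = g.mulVec (iv a) := by
    intro a
    rw [hg', ← Matrix.mulVec_mulVec, ← iv_mulVec, hφU]
  have hφinj : Function.Injective φ := fun a b h => by
    rw [← hφU a, ← hφU b, h]
  set C : (ι → ℤ) → Set (ι → ℝ) :=
    fun a => Set.univ.pi fun i => Set.Ico ((φ a i : ℤ) : ℝ) ((φ a i : ℤ) + 1) with hC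
  have hCvol : ∀ a, MeasureTheory.volume (C a) = 1 := by
    intro a; rw [hC]; simp only [Real.volume_pi_Ico]; simp
  have hCdisj : ∀ a b, a ≠ b → Disjoint (C a) (C b) := by
    intro a b hab
    rw [Set.disjoint_left]
    intro x hxa hxb
    apply hab
    apply hφinj
    ext i
    have h1 := hxa i (Set.mem_univ i)
    have h2 := hxb i (Set.mem_univ i)
    rw [← Int.floor_eq_iff.mpr ⟨h1.1, h1.2⟩, ← Int.floor_eq_iff.mpr ⟨h2.1, h2.2⟩]
  have hsub : (⋃ a ∈ S, C a) ⊆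
      (Matrix.toLin' g') ⁻¹' (Metric.closedBall 0 (T + Fintype.card ι * K)) := by
    intro x hx
    simp only [Set.mem_iUnion] at hx
    obtain ⟨a, haS, hxa⟩ := hx
    simp only [Set.mem_preimage, Metric.mem_closedBall, dist_zero_right, Matrix.toLin'_apply]
    have hx' : x = iv (φ a) + (x - iv (φ a)) := by simp
    rw [hx', Matrix.mulVec_add, hφg]
    refine (norm_add_le _ _).trans (add_le_add (hS a haS) ?_)
    rw [pi_norm_le_iff_of_nonneg (by positivity)]
    intro i
    rw [Real.norm_eq_abs]
    calc _ ≤ ∑ j, |g' i j * (x - iv (φ a)) j| := by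
          simp only [Matrix.mulVec, dotProduct]; exact Finset.abs_sum_le_sum_abs _ _
      _ ≤ ∑ j : ι, K := by
          refine Finset.sum_le_sum fun j _ => ?_
          rw [abs_mul]
          have h1 := hxa j (Set.mem_univ j)
          have h2 : |(x - iv (φ a)) j| ≤ 1 := by
            simp only [Pi.sub_apply, iv]
            rw [abs_of_nonneg (by linarith [h1.1])]; linarith [h1.2]
          calc _ ≤ K * 1 := mul_le_mul (hUb i j) h2 (abs_nonneg _) (by linarith)
            _ = K := mul_one K
      _ = _ := by simp
  have hmeas := MeasureTheory.measure_mono (μ := MeasureTheory.volume) hsub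
  rw [MeasureTheory.measure_biUnion_finset (fun a _ b _ hab => hCdisj a b hab)
    (fun a _ => MeasurableSet.univ_pi fun i => measurableSet_Ico)] at hmeas
  simp only [hCvol, Finset.sum_const, nsmul_eq_mul, mul_one] at hmeas
  rw [MeasureTheory.Measure.addHaar_preimage_linearMap _ (by simpa using hg'0),
    Real.volume_pi_closedBall _ (by positivity), LinearMap.det_toLin', abs_inv, hg'det] at hmeas
  simp only [inv_one, ENNReal.ofReal_one, one_mul] at hmeas
  rw [← ENNReal.ofReal_natCast, ENNReal.ofReal_le_ofReal_iff (by positivity)] at hmeas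
  exact hmeas

/-- The volume of a slab in the unit cube. -/
lemma volume_slab_le {κ : Type*} [Fintype κ] [DecidableEq κ] (v : κ → ℝ) {t : ℝ} (ht : 0 < t)
    (hv : t ≤ ‖v‖) (b δ : ℝ) (hδ : 0 ≤ δ) :
    MeasureTheory.volume {η : κ → ℝ | (∀ j, η j ∈ Set.Icc (0:ℝ) 1) ∧ |b + ∑ j, η j * v j| ≤ δ} ≤
      ENNReal.ofReal (2 * δ / t) := by
  obtain ⟨i, hi⟩ : ∃ i, t ≤ |v i| := by
    by_contra! h
    have : ‖v‖ < t := by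
      rw [pi_norm_lt_iff ht]; exact h
    linarith
  set M : Matrix κ κ ℝ := (1 : Matrix κ κ ℝ).updateRow i v with hM
  have hdet : M.det = v i := by
    rw [hM, ← Matrix.cramer_transpose_apply, Matrix.transpose_one, Matrix.cramer_one]; simp
  have hd0 : M.det ≠ 0 := by
    rw [hdet]; intro h; rw [h] at hi; simp at hi; linarith
  have hsub : {η : κ → ℝ | (∀ j, η j ∈ Set.Icc (0:ℝ) 1) ∧ |b + ∑ j, η j * v j| ≤ δ} ⊆
      (Matrix.toLin' M) ⁻¹' (Set.Icc (Function.update 0 i (-b - δ)) (Function.update 1 i (-b + δ))) := by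
    rintro η ⟨h1, h2⟩
    simp only [Set.mem_preimage, Matrix.toLin'_apply]
    rw [abs_le] at h2
    have hMi : M.mulVec η i = ∑ j, η j * v j := by
      simp [Matrix.mulVec, dotProduct, hM, mul_comm]
    have hMj : ∀ j, j ≠ i → M.mulVec η j = η j := by
      intro j hj
      simp [Matrix.mulVec, dotProduct, hM, Matrix.updateRow_ne hj, Matrix.one_apply]
    constructor <;> intro j <;> by_cases hj : j = i
    · subst hj; rw [hMi]; simp; linarith
    · rw [hMj j hj]; simp [hj]; exact (h1 j).1
    · subst hj; rw [hMi]; simp; linarith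
    · rw [hMj j hj]; simp [hj]; exact (h1 j).2
  refine (MeasureTheory.measure_mono hsub).trans ?_
  rw [MeasureTheory.Measure.addHaar_preimage_linearMap _ (by simpa using hd0), Real.volume_Icc_pi,
    LinearMap.det_toLin', hdet]
  have : ∏ j, ENNReal.ofReal (Function.update (1 : κ → ℝ) i (-b + δ) j -
      Function.update (0 : κ → ℝ) i (-b - δ) j) = ENNReal.ofReal (2 * δ) := by
    rw [Finset.prod_eq_single i]
    · simp only [Function.update_self]; congr 1; ring
    · intro j _ hj; simp [hj]
    · simp
  rw [this, ← ENNReal.ofReal_mul (abs_nonneg _)]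
  apply ENNReal.ofReal_le_ofReal
  rw [abs_inv, inv_mul_eq_div]
  gcongr

/-- The volume of the matrices in the unit cube sending `v` into a small box. -/
lemma volume_slabs_le {κ ν : Type*} [Fintype κ] [DecidableEq κ] [Fintype ν] (v : κ → ℝ) {t : ℝ}
    (ht : 0 < t) (hv : t ≤ ‖v‖) (b : ν → ℝ) (δ : ℝ) (hδ : 0 ≤ δ) :
    MeasureTheory.volume {η : ν → κ → ℝ | ∀ i, (∀ j, η i j ∈ Set.Icc (0:ℝ) 1) ∧
      |b i + ∑ j, η i j * v j| ≤ δ} ≤ ENNReal.ofReal ((2 * δ / t) ^ Fintype.card ν) := by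
  have : {η : ν → κ → ℝ | ∀ i, (∀ j, η i j ∈ Set.Icc (0:ℝ) 1) ∧ |b i + ∑ j, η i j * v j| ≤ δ} =
      Set.univ.pi fun i => {η : κ → ℝ | (∀ j, η j ∈ Set.Icc (0:ℝ) 1) ∧ |b i + ∑ j, η j * v j| ≤ δ} := by
    ext η; simp [Set.mem_pi]
  rw [this, MeasureTheory.volume_pi_pi, ENNReal.ofReal_pow (by positivity)]
  calc _ ≤ ∏ i : ν, ENNReal.ofReal (2 * δ / t) :=
        Finset.prod_le_prod' fun i _ => volume_slab_le v ht hv (b i) δ hδ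
    _ = _ := by simp

/-- A lower bound `ρ` for the first minimum of a lattice, rescaled by `X` and `L`. -/
def Nice {κ ν σ : Type*} [Fintype κ] [Fintype ν] [Fintype σ]
    (P : Matrix κ σ ℝ) (F : Matrix ν σ ℝ) (ρ X L : ℝ) : Prop :=
  ∀ a : σ → ℤ, a ≠ 0 → ρ * X ≤ ‖P.mulVec (iv a)‖ ∨ ρ * L ≤ ‖F.mulVec (iv a)‖

lemma fromRows_mulVec_norm_le {κ ν σ : Type*} [Fintype κ] [Fintype ν] [Fintype σ]
    (P : Matrix κ σ ℝ) (F : Matrix ν σ ℝ) (v : σ → ℝ) {T : ℝ} (hT : 0 ≤ T)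
    (h1 : ‖P.mulVec v‖ ≤ T) (h2 : ‖F.mulVec v‖ ≤ T) : ‖(P.fromRows F).mulVec v‖ ≤ T := by
  rw [pi_norm_le_iff_of_nonneg hT] at *
  rintro (i | i)
  · exact h1 i
  · exact h2 i

lemma norm_le_fromRows_mulVec {κ ν σ : Type*} [Fintype κ] [Fintype ν] [Fintype σ]
    (P : Matrix κ σ ℝ) (F : Matrix ν σ ℝ) (v : σ → ℝ) :
    ‖P.mulVec v‖ ≤ ‖(P.fromRows F).mulVec v‖ ∧ ‖F.mulVec v‖ ≤ ‖(P.fromRows F).mulVec v‖ := by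
  constructor <;> rw [pi_norm_le_iff_of_nonneg (norm_nonneg _)] <;> intro i
  · exact norm_le_pi_norm ((P.fromRows F).mulVec v) (Sum.inl i)
  · exact norm_le_pi_norm ((P.fromRows F).mulVec v) (Sum.inr i)

lemma sum_range_pow_le {x : ℝ} (hx : 2 ≤ x) (J : ℕ) :
    ∑ j ∈ Finset.range (J + 1), x ^ j ≤ 2 * x ^ J := by
  induction J with
  | zero => simp
  | succ J ih =>
    rw [Finset.sum_range_succ, pow_succ]
    have : 0 ≤ x ^ J := by positivity
    nlinarith

lemma sum_range_inv_pow_le {x : ℝ} (hx : 2 ≤ x) (J : ℕ) :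
    ∑ j ∈ Finset.range (J + 1), (x ^ j)⁻¹ ≤ 2 := by
  have : ∀ J : ℕ, ∑ j ∈ Finset.range (J + 1), (x ^ j)⁻¹ ≤ 2 - (x ^ J)⁻¹ := by
    intro J
    induction J with
    | zero => norm_num
    | succ J ih =>
      rw [Finset.sum_range_succ]
      have h0 : 0 < x ^ J := by positivity
      have : 2 * (x ^ (J + 1))⁻¹ ≤ (x ^ J)⁻¹ := by
        rw [pow_succ, mul_inv]
        have : x⁻¹ ≤ 2⁻¹ := by gcongr
        nlinarith [inv_pos.mpr h0]
      linarith
  have h := this J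
  have : 0 < (x ^ J)⁻¹ := by positivity
  linarith

lemma mulVec_abs_le {ι κ : Type*} [Fintype κ] (A : Matrix ι κ ℝ) {K : ℝ}
    (hA : ∀ i j, |A i j| ≤ K) (v : κ → ℝ) (i : ι) :
    |A.mulVec v i| ≤ Fintype.card κ * K * ‖v‖ := by
  by_cases hκ : Nonempty κ
  · obtain ⟨j0⟩ := hκ
    have hK : 0 ≤ K := (abs_nonneg _).trans (hA i j0)
    calc _ ≤ ∑ j, |A i j * v j| := by
          simp only [Matrix.mulVec, dotProduct]; exact Finset.abs_sum_le_sum_abs _ _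
      _ ≤ ∑ j : κ, K * ‖v‖ := by
          refine Finset.sum_le_sum fun j _ => ?_
          rw [abs_mul]
          exact mul_le_mul (hA i j) (norm_le_pi_norm v j) (abs_nonneg _) hK
      _ = _ := by simp [mul_assoc]
  · have := not_nonempty_iff.mp hκ
    simp [Matrix.mulVec, dotProduct]

lemma mulVec_norm_le {ι κ : Type*} [Fintype ι] [Fintype κ] (A : Matrix ι κ ℝ) {K : ℝ} (hK : 0 ≤ K)
    (hA : ∀ i j, |A i j| ≤ K) (v : κ → ℝ) :
    ‖A.mulVec v‖ ≤ Fintype.card κ * K * ‖v‖ := by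
  rw [pi_norm_le_iff_of_nonneg (by positivity)]
  intro i
  exact mulVec_abs_le A hA v i

set_option maxHeartbeats 1000000 in
/-- One long step along the diagonal flow, after normalisation: a bounded shear improves the
first minimum to a universal bound. -/
lemma exists_shear_unimodular (κ ν : Type*) [Fintype κ] [DecidableEq κ] [Nonempty κ]
    [Fintype ν] [DecidableEq ν] [Nonempty ν] :
    ∃ ρs : ℝ, 0 < ρs ∧ ρs ≤ 1 ∧ ∀ ρ₀ : ℝ, 0 < ρ₀ → ∃ R₀ : ℝ, 2 ≤ R₀ ∧
      ∀ (P : Matrix κ (κ ⊕ ν) ℝ) (F : Matrix ν (κ ⊕ ν) ℝ), |(P.fromRows F).det| = 1 →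
        Nice P F ρ₀ 1 1 → ∀ R l : ℝ, R₀ ≤ R → 0 < l →
        R ^ Fintype.card κ * l ^ Fintype.card ν = 1 →
        ∃ Δ : Matrix ν κ ℝ, (∀ i j, |Δ i j| ≤ 1) ∧ Nice P (F + Δ * P) ρs R l := by
  set c := Fintype.card κ with hc
  set n := Fintype.card ν with hn
  have hc1 : 1 ≤ c := Fintype.card_pos
  have hn1 : 1 ≤ n := Fintype.card_pos
  have hcr : (1:ℝ) ≤ c := by exact_mod_cast hc1
  set p := c + n with hp
  set C₁ : ℝ := 4 ^ p * (4 * c) ^ p * 2 ^ n with hC₁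
  have hC₁0 : 1 ≤ C₁ := by
    have h1 : (1:ℝ) ≤ 4 ^ p := one_le_pow₀ (by norm_num)
    have h2 : (1:ℝ) ≤ (4 * c) ^ p := one_le_pow₀ (by linarith)
    have h3 : (1:ℝ) ≤ 2 ^ n := one_le_pow₀ (by norm_num)
    exact one_le_mul_of_one_le_of_one_le (one_le_mul_of_one_le_of_one_le h1 h2) h3
  set ρs : ℝ := 1 / (8 * C₁) with hρs
  have hρs0 : 0 < ρs := by positivity
  have hρs1 : ρs ≤ 1 := by
    rw [hρs, div_le_one (by positivity)]; linarith
  refine ⟨ρs, hρs0, hρs1, fun ρ₀ hρ₀ => ?_⟩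
  obtain ⟨K, hK0, hK⟩ := exists_card_le (κ ⊕ ν) hρ₀
  have hpcard : Fintype.card (κ ⊕ ν) = p := by simp [hp, hc, hn]
  set ρ₁ : ℝ := ρ₀ / (2 * c) with hρ₁
  have hρ₁0 : 0 < ρ₁ := by positivity
  set C₂ : ℝ := 4 ^ p * K ^ p * 2 ^ n with hC₂
  have hC₂0 : 0 ≤ C₂ := by positivity
  set R₀ : ℝ := 2 + (2 / ρ₀) ^ n + ρ₁ / ρs + 8 * C₂ * (ρ₁ ^ n)⁻¹ with hR₀
  have e1 : 0 ≤ (2 / ρ₀) ^ n := by positivity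
  have e2 : 0 ≤ ρ₁ / ρs := by positivity
  have e3 : 0 ≤ 8 * C₂ * (ρ₁ ^ n)⁻¹ := by positivity
  refine ⟨R₀, by linarith, fun P F hdet hnice R l hR hl hRl => ?_⟩
  have hR1 : 1 ≤ R := by linarith
  have hR0 : 0 < R := by linarith
  have hlow : ∀ a : κ ⊕ ν → ℤ, a ≠ 0 → ρ₀ ≤ ‖(P.fromRows F).mulVec (iv a)‖ := by
    intro a ha
    have hb := norm_le_fromRows_mulVec P F (iv a)
    rcases hnice a ha with h | h
    · linarith [hb.1]
    · linarith [hb.2]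
  have hln : l ^ n ≤ 1 / R := by
    rw [le_div_iff₀ hR0, ← hRl, mul_comm]
    refine mul_le_mul_of_nonneg_right (le_self_pow₀ hR1 (by omega)) (by positivity)
  set δ : ℝ := ρs * l with hδ
  have hδ0 : 0 < δ := by positivity
  have hδn : δ ^ n ≤ ρs ^ n * l ^ n := by rw [hδ, mul_pow]
  have hlρ : l ≤ ρ₀ / 2 := by
    by_contra! hlt
    have h1 : (ρ₀ / 2) ^ n < l ^ n := by gcongr
    have h2 : (2 / ρ₀) ^ n ≤ R := by linarith
    have h3 : (ρ₀ / 2) ^ n * (2 / ρ₀) ^ n = 1 := by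
      rw [← mul_pow]; rw [show ρ₀ / 2 * (2 / ρ₀) = 1 by field_simp]; simp
    have h4 : (ρ₀ / 2) ^ n * R < 1 := by
      have := h1.trans_le hln
      rwa [lt_div_iff₀ hR0] at this
    have h5 : 0 < (ρ₀ / 2) ^ n := by positivity
    nlinarith
  have hδρ : δ ≤ ρ₀ / 2 := by
    rw [hδ]; nlinarith
  -- dyadic shells
  set T : ℕ → ℝ := fun j => 2 ^ j * ρ₁ with hT
  have hT0 : ∀ j, 0 < T j := fun j => by positivity
  obtain ⟨J, hJ1, hJ2⟩ := exists_nat_pow_near (x := ρs * R / ρ₁) (y := 2) (by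
    rw [one_le_div hρ₁0]
    have : ρ₁ / ρs ≤ R := by linarith
    rwa [div_le_iff₀ hρs0, mul_comm] at this) (by norm_num)
  have hTJ : T J ≤ ρs * R := by rwa [le_div_iff₀ hρ₁0] at hJ1
  have hTJ' : ρs * R < T (J + 1) := by rwa [div_lt_iff₀ hρ₁0] at hJ2
  have hfin : ∀ j, ∃ S : Finset (κ ⊕ ν → ℤ),
      (∀ a, a ∈ S ↔ T j ≤ ‖P.mulVec (iv a)‖ ∧ ‖P.mulVec (iv a)‖ ≤ 2 * T j ∧
        ‖F.mulVec (iv a)‖ ≤ 4 * c * T j) ∧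
      (S.card : ℝ) ≤ (2 * (4 * c * T j + K)) ^ p := by
    intro j
    set B : Set (κ ⊕ ν → ℤ) := {a | T j ≤ ‖P.mulVec (iv a)‖ ∧ ‖P.mulVec (iv a)‖ ≤ 2 * T j ∧
        ‖F.mulVec (iv a)‖ ≤ 4 * c * T j} with hB
    have hball : ∀ a ∈ B, ‖(P.fromRows F).mulVec (iv a)‖ ≤ 4 * c * T j := by
      intro a ha
      refine fromRows_mulVec_norm_le _ _ _ (by have := hT0 j; positivity) (ha.2.1.trans ?_) ha.2.2
      have := hT0 j
      nlinarith
    have hbd : ∀ S : Finset (κ ⊕ ν → ℤ), (S : Set _) ⊆ B →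
        (S.card : ℝ) ≤ (2 * (4 * c * T j + K)) ^ p := by
      intro S hS
      rw [← hpcard]
      exact hK _ hdet hlow _ (by have := hT0 j; positivity) S fun a ha => hball a (hS ha)
    have hBfin : B.Finite := by
      by_contra hinf
      obtain ⟨S, hSB, hScard⟩ := Set.Infinite.exists_subset_card_eq hinf
        (⌊(2 * (4 * c * T j + K)) ^ p⌋₊ + 1)
      have h1 := hbd S hSB
      rw [hScard] at h1
      have h2 := Nat.lt_floor_add_one ((2 * (4 * c * T j + K)) ^ p)
      push_cast at h1
      linarith
    refine ⟨hBfin.toFinset, fun a => by simp [hB], hbd _ (by simp)⟩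
  choose S hS hScard using hfin
  set bad : (κ ⊕ ν → ℤ) → Set (ν → κ → ℝ) := fun a => {η | ∀ i, (∀ j, η i j ∈ Set.Icc (0:ℝ) 1) ∧
      |F.mulVec (iv a) i + ∑ j, η i j * P.mulVec (iv a) j| ≤ δ} with hbad
  set cube : Set (ν → κ → ℝ) := Set.univ.pi fun _ => Set.univ.pi fun _ => Set.Icc (0:ℝ) 1 with hcube
  have hcubevol : MeasureTheory.volume cube = 1 := by
    rw [hcube, MeasureTheory.volume_pi_pi]
    refine Finset.prod_eq_one fun i _ => ?_
    rw [MeasureTheory.volume_pi_pi]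
    simp
  have hsmall : MeasureTheory.volume (⋃ j ∈ Finset.range (J + 1), ⋃ a ∈ S j, bad a) < 1 := by
    have hstep : ∀ j, MeasureTheory.volume (⋃ a ∈ S j, bad a) ≤
        ENNReal.ofReal (C₁ * δ ^ n * T j ^ c + C₂ * δ ^ n * (T j ^ n)⁻¹) := by
      intro j
      have hTj := hT0 j
      calc _ ≤ ∑ a ∈ S j, MeasureTheory.volume (bad a) := MeasureTheory.measure_biUnion_finset_le _ _
        _ ≤ ∑ a ∈ S j, ENNReal.ofReal ((2 * δ / T j) ^ n) := by
            refine Finset.sum_le_sum fun a ha => ?_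
            exact volume_slabs_le _ hTj ((hS j a).mp ha).1 _ δ hδ0.le
        _ = ENNReal.ofReal ((S j).card * (2 * δ / T j) ^ n) := by
            rw [Finset.sum_const, nsmul_eq_mul, ENNReal.ofReal_mul (by positivity),
              ENNReal.ofReal_natCast]
        _ ≤ _ := by
            apply ENNReal.ofReal_le_ofReal
            have h1 : ((S j).card : ℝ) ≤ 4 ^ p * ((4 * c) ^ p * T j ^ p + K ^ p) := by
              refine (hScard j).trans ?_
              rw [mul_pow]
              have h2 : (4 * c * T j + K) ^ p ≤ 2 ^ p * ((4 * c * T j) ^ p + K ^ p) := by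
                refine (add_pow_le (by positivity) hK0 p).trans ?_
                gcongr
                · norm_num
                · omega
              calc _ ≤ 2 ^ p * (2 ^ p * ((4 * c * T j) ^ p + K ^ p)) := by gcongr
                _ = _ := by
                  have h3 : (4:ℝ) ^ p = 2 ^ p * 2 ^ p := by rw [← mul_pow]; norm_num
                  rw [mul_pow (4 * (c:ℝ))]
                  generalize (4 * (c:ℝ)) ^ p = A
                  rw [h3]; ring
            calc _ ≤ 4 ^ p * ((4 * c) ^ p * T j ^ p + K ^ p) * (2 * δ / T j) ^ n := by gcongr
              _ = _ := by
                rw [div_pow, mul_pow 2 δ, hC₁, hC₂]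
                generalize (4 * (c:ℝ)) ^ p = A
                generalize (4:ℝ) ^ p = B
                generalize K ^ p = D
                rw [hp, pow_add (T j) c n]
                field_simp
    calc _ ≤ ∑ j ∈ Finset.range (J + 1), MeasureTheory.volume (⋃ a ∈ S j, bad a) :=
          MeasureTheory.measure_biUnion_finset_le _ _
      _ ≤ ∑ j ∈ Finset.range (J + 1),
          ENNReal.ofReal (C₁ * δ ^ n * T j ^ c + C₂ * δ ^ n * (T j ^ n)⁻¹) :=
          Finset.sum_le_sum fun j _ => hstep j
      _ = ENNReal.ofReal (∑ j ∈ Finset.range (J + 1),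
            (C₁ * δ ^ n * T j ^ c + C₂ * δ ^ n * (T j ^ n)⁻¹)) := by
          rw [ENNReal.ofReal_sum_of_nonneg]
          intro j _
          have := hT0 j
          positivity
      _ ≤ ENNReal.ofReal (1 / 2) := by
          apply ENNReal.ofReal_le_ofReal
          rw [Finset.sum_add_distrib, ← Finset.mul_sum, ← Finset.mul_sum]
          have h1 : ∑ j ∈ Finset.range (J + 1), T j ^ c ≤ 2 * (ρs * R) ^ c := by
            calc _ = (∑ j ∈ Finset.range (J + 1), ((2:ℝ) ^ c) ^ j) * ρ₁ ^ c := by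
                  rw [Finset.sum_mul]
                  refine Finset.sum_congr rfl fun j _ => ?_
                  rw [hT]; simp only; rw [mul_pow, ← pow_mul, ← pow_mul, mul_comm j c]
              _ ≤ 2 * ((2:ℝ) ^ c) ^ J * ρ₁ ^ c := by
                  gcongr
                  exact sum_range_pow_le (le_self_pow₀ (by norm_num) (by omega)) J
              _ = 2 * (T J) ^ c := by
                  rw [hT]; simp only; rw [mul_pow, ← pow_mul, ← pow_mul, mul_comm J c]; ring
              _ ≤ _ := by have := hT0 J; gcongr
          have h2 : ∑ j ∈ Finset.range (J + 1), (T j ^ n)⁻¹ ≤ 2 * (ρ₁ ^ n)⁻¹ := by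
            calc _ = (∑ j ∈ Finset.range (J + 1), (((2:ℝ) ^ n) ^ j)⁻¹) * (ρ₁ ^ n)⁻¹ := by
                  rw [Finset.sum_mul]
                  refine Finset.sum_congr rfl fun j _ => ?_
                  rw [hT]; simp only; rw [mul_pow, ← pow_mul, ← pow_mul, mul_comm j n, mul_inv]
              _ ≤ _ := by
                  gcongr
                  exact sum_range_inv_pow_le (le_self_pow₀ (by norm_num) (by omega)) J
          have h3 : C₁ * δ ^ n * (2 * (ρs * R) ^ c) ≤ 1 / 4 := by
            calc _ = 2 * C₁ * (ρs ^ c * ρs ^ n) * (R ^ c * l ^ n) := by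
                  rw [hδ, mul_pow, mul_pow]; ring
              _ = 2 * C₁ * ρs ^ p := by rw [hRl, hp, pow_add, mul_one]
              _ ≤ 2 * C₁ * ρs := by
                  gcongr
                  exact pow_le_of_le_one hρs0.le hρs1 (by omega)
              _ = 1 / 4 := by rw [hρs]; field_simp; norm_num
          have h4 : C₂ * δ ^ n * (2 * (ρ₁ ^ n)⁻¹) ≤ 1 / 4 := by
            have h5 : δ ^ n ≤ 1 / R := by
              refine hδn.trans ((mul_le_of_le_one_left (by positivity) ?_).trans hln)
              exact pow_le_one₀ hρs0.le hρs1
            calc _ ≤ C₂ * (1 / R) * (2 * (ρ₁ ^ n)⁻¹) := by gcongr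
              _ = (8 * C₂ * (ρ₁ ^ n)⁻¹) / R * (1 / 4) := by ring
              _ ≤ 1 * (1 / 4) := by
                  gcongr
                  rw [div_le_one hR0]; linarith
              _ = 1 / 4 := by norm_num
          have h6 : C₁ * δ ^ n * ∑ j ∈ Finset.range (J + 1), T j ^ c ≤ 1 / 4 :=
            le_trans (by gcongr) h3
          have h7 : C₂ * δ ^ n * ∑ j ∈ Finset.range (J + 1), (T j ^ n)⁻¹ ≤ 1 / 4 :=
            le_trans (by gcongr) h4
          linarith
      _ < 1 := by
          rw [show (1 : ENNReal) = ENNReal.ofReal 1 by simp]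
          exact (ENNReal.ofReal_lt_ofReal_iff (by norm_num)).mpr (by norm_num)
  obtain ⟨Δ, hΔc, hΔ⟩ : ∃ Δ ∈ cube, Δ ∉ ⋃ j ∈ Finset.range (J + 1), ⋃ a ∈ S j, bad a := by
    by_contra! hcon
    have := MeasureTheory.measure_mono (μ := MeasureTheory.volume) hcon
    rw [hcubevol] at this
    exact absurd hsmall (not_lt.mpr this)
  have hΔ01 : ∀ i j, Δ i j ∈ Set.Icc (0:ℝ) 1 := fun i j => hΔc i (Set.mem_univ i) j (Set.mem_univ j)
  have hΔ1 : ∀ i j, |Matrix.of Δ i j| ≤ 1 := fun i j => by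
    rw [Matrix.of_apply, abs_of_nonneg (hΔ01 i j).1]; exact (hΔ01 i j).2
  refine ⟨Matrix.of Δ, hΔ1, fun a ha => ?_⟩
  by_contra! hcon
  obtain ⟨hc1', hc2'⟩ := hcon
  have hexp : (F + Matrix.of Δ * P).mulVec (iv a) =
      F.mulVec (iv a) + (Matrix.of Δ).mulVec (P.mulVec (iv a)) := by
    rw [Matrix.add_mulVec, Matrix.mulVec_mulVec]
  rw [hexp] at hc2'
  set u := P.mulVec (iv a) with hu
  have hΔu : ‖(Matrix.of Δ).mulVec u‖ ≤ c * ‖u‖ := by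
    have := mulVec_norm_le (Matrix.of Δ) zero_le_one hΔ1 u
    rwa [mul_one] at this
  have hFu : ‖F.mulVec (iv a)‖ ≤ δ + c * ‖u‖ := by
    calc _ = ‖(F.mulVec (iv a) + (Matrix.of Δ).mulVec u) - (Matrix.of Δ).mulVec u‖ := by simp
      _ ≤ _ := (norm_sub_le _ _).trans (add_le_add hc2'.le hΔu)
  have hu1 : ρ₁ ≤ ‖u‖ := by
    by_contra! hlt
    have h1 : c * ‖u‖ < ρ₀ / 2 := by
      rw [hρ₁, lt_div_iff₀ (by positivity)] at hlt
      linarith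
    have h2 : ‖u‖ < ρ₀ := by nlinarith [norm_nonneg u]
    rcases hnice a ha with h | h
    · linarith
    · linarith
  obtain ⟨j, hj1, hj2⟩ := exists_nat_pow_near (x := ‖u‖ / ρ₁) (y := 2)
    (by rwa [one_le_div hρ₁0]) (by norm_num)
  rw [le_div_iff₀ hρ₁0] at hj1
  rw [div_lt_iff₀ hρ₁0] at hj2
  have hjJ : j < J + 1 := by
    by_contra! hle
    have : T (J + 1) ≤ T j := by
      simp only [hT]; gcongr; norm_num
    have h3 : T j ≤ ‖u‖ := hj1
    linarith
  apply hΔ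
  simp only [Set.mem_iUnion, Finset.mem_range]
  refine ⟨j, hjJ, a, (hS j a).mpr ⟨hj1, ?_, ?_⟩, ?_⟩
  · refine hj2.le.trans (le_of_eq ?_)
    simp only [hT]; ring
  · have h4 : ‖u‖ ≤ 2 * T j := by
      refine hj2.le.trans (le_of_eq ?_)
      simp only [hT]; ring
    have h5 : δ ≤ c * ‖u‖ := by
      have : ρ₀ / 2 = c * ρ₁ := by rw [hρ₁]; field_simp
      nlinarith
    nlinarith
  · intro i
    refine ⟨hΔ01 i, ?_⟩
    have := (norm_le_pi_norm (F.mulVec (iv a) + (Matrix.of Δ).mulVec u) i).trans hc2'.le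
    exact this

lemma det_shear {κ ν : Type*} [Fintype κ] [DecidableEq κ] [Fintype ν] [DecidableEq ν]
    (P : Matrix κ (κ ⊕ ν) ℝ) (F : Matrix ν (κ ⊕ ν) ℝ) (Δ : Matrix ν κ ℝ) :
    (P.fromRows (F + Δ * P)).det = (P.fromRows F).det := by
  have : P.fromRows (F + Δ * P) = Matrix.fromBlocks 1 0 Δ 1 * P.fromRows F := by
    ext (i | i) j
    · simp [Matrix.mul_apply, Fintype.sum_sum_type, Matrix.one_apply]
    · simp [Matrix.mul_apply, Fintype.sum_sum_type, Matrix.one_apply, add_comm]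
  rw [this, Matrix.det_mul, Matrix.det_fromBlocks_zero₁₂]; simp

lemma det_fromRows_smul {κ ν : Type*} [Fintype κ] [DecidableEq κ] [Fintype ν] [DecidableEq ν]
    (P : Matrix κ (κ ⊕ ν) ℝ) (F : Matrix ν (κ ⊕ ν) ℝ) (x l : ℝ) :
    ((x • P).fromRows (l • F)).det =
      x ^ Fintype.card κ * l ^ Fintype.card ν * (P.fromRows F).det := by
  have : (x • P).fromRows (l • F) =
      Matrix.diagonal (Sum.elim (fun _ : κ => x) (fun _ : ν => l)) * P.fromRows F := by
    ext (i | i) j <;> simp [Matrix.diagonal_mul]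
  rw [this, Matrix.det_mul, Matrix.det_diagonal, Fintype.prod_sum_type]; simp

lemma exists_root {X D : ℝ} (hX : 0 < X) (hD : 0 < D) (c : ℕ) {n : ℕ} (hn : n ≠ 0) :
    ∃ L : ℝ, 0 < L ∧ X ^ c * L ^ n = D := by
  refine ⟨(D / X ^ c) ^ ((n : ℝ)⁻¹), by positivity, ?_⟩
  rw [Real.rpow_inv_natCast_pow (by positivity) hn]
  field_simp

lemma root_anti {X X' L L' D : ℝ} {c n : ℕ} (hn : n ≠ 0) (hX : 0 < X) (hXX : X ≤ X')
    (hL : 0 < L) (h : X ^ c * L ^ n = D) (h' : X' ^ c * L' ^ n = D) : L' ≤ L := by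
  by_contra! hlt
  have h1 : X ^ c ≤ X' ^ c := by gcongr
  have h2 : L ^ n < L' ^ n := by gcongr
  have h3 : 0 < X ^ c := by positivity
  have h4 : 0 < L ^ n := by positivity
  nlinarith

lemma Nice.mono {κ ν σ : Type*} [Fintype κ] [Fintype ν] [Fintype σ]
    {P : Matrix κ σ ℝ} {F : Matrix ν σ ℝ} {ρ X L ρ' X' L' : ℝ} (h : Nice P F ρ X L)
    (h1 : ρ' * X' ≤ ρ * X) (h2 : ρ' * L' ≤ ρ * L) : Nice P F ρ' X' L' := fun a ha =>
  (h a ha).imp h1.trans h2.trans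

lemma Nice.shear {κ ν σ : Type*} [Fintype κ] [Fintype ν] [Fintype σ]
    {P : Matrix κ σ ℝ} {F : Matrix ν σ ℝ} {ρ X L C : ℝ} (h : Nice P F ρ X L)
    (hρ : 0 ≤ ρ) (hX : 0 < X) (hL : 0 ≤ L) (hC : 0 ≤ C) {Δ : Matrix ν κ ℝ}
    (hΔ : ∀ i j, |Δ i j| ≤ C * (L / X)) :
    Nice P (F + Δ * P) (ρ / (1 + C * Fintype.card κ)) X L := by
  intro a ha
  by_contra! hcon
  obtain ⟨h1, h2⟩ := hcon
  set c : ℝ := (Fintype.card κ : ℝ)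
  have hc0 : 0 ≤ c := Nat.cast_nonneg _
  have hk : 0 < 1 + C * c := by positivity
  rw [Matrix.add_mulVec, ← Matrix.mulVec_mulVec] at h2
  have h3 := mulVec_norm_le Δ (by positivity) hΔ (P.mulVec (iv a))
  have h4 : ‖F.mulVec (iv a)‖ < ρ * L := by
    calc _ = ‖(F.mulVec (iv a) + Δ.mulVec (P.mulVec (iv a))) - Δ.mulVec (P.mulVec (iv a))‖ := by simp
      _ ≤ _ := norm_sub_le _ _
      _ < ρ / (1 + C * c) * L + c * (C * (L / X)) * ‖P.mulVec (iv a)‖ := add_lt_add_of_lt_of_le h2 h3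
      _ ≤ ρ / (1 + C * c) * L + c * (C * (L / X)) * (ρ / (1 + C * c) * X) := by gcongr
      _ = ρ * L := by field_simp
  have h5 : ‖P.mulVec (iv a)‖ < ρ * X := by
    refine h1.trans_le ?_
    gcongr
    exact div_le_self hρ (by nlinarith [mul_nonneg hC hc0])
  rcases h a ha with h | h
  · linarith
  · linarith

lemma inv_smul_mulVec_norm {τ σ : Type*} [Fintype τ] [Fintype σ] {x : ℝ} (hx : 0 < x)
    (A : Matrix τ σ ℝ) (v : σ → ℝ) : ‖(x⁻¹ • A).mulVec v‖ = ‖A.mulVec v‖ / x := by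
  rw [Matrix.smul_mulVec, norm_smul, norm_inv, Real.norm_of_nonneg hx.le, inv_mul_eq_div]

lemma exists_shear_step (κ ν : Type*) [Fintype κ] [DecidableEq κ] [Nonempty κ]
    [Fintype ν] [DecidableEq ν] [Nonempty ν] :
    ∃ ρs : ℝ, 0 < ρs ∧ ρs ≤ 1 ∧ ∀ ρ₀ : ℝ, 0 < ρ₀ → ∃ R₀ : ℝ, 2 ≤ R₀ ∧
      ∀ (P : Matrix κ (κ ⊕ ν) ℝ) (F : Matrix ν (κ ⊕ ν) ℝ) (X L X' L' : ℝ), 0 < X → 0 < L →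
        R₀ * X ≤ X' → 0 < L' →
        X ^ Fintype.card κ * L ^ Fintype.card ν = |(P.fromRows F).det| →
        X' ^ Fintype.card κ * L' ^ Fintype.card ν = |(P.fromRows F).det| →
        Nice P F ρ₀ X L →
        ∃ Δ : Matrix ν κ ℝ, (∀ i j, |Δ i j| ≤ L / X) ∧ Nice P (F + Δ * P) ρs X' L' := by
  obtain ⟨ρs, h0, h1, h2⟩ := exists_shear_unimodular κ ν
  refine ⟨ρs, h0, h1, fun ρ₀ hρ₀ => ?_⟩
  obtain ⟨R₀, hR₀, hR⟩ := h2 ρ₀ hρ₀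
  refine ⟨R₀, hR₀, fun P F X L X' L' hX hL hXX hL' hD hD' hN => ?_⟩
  obtain ⟨Δ, hΔ1, hΔ2⟩ := hR (X⁻¹ • P) (L⁻¹ • F) (by
      rw [det_fromRows_smul, abs_mul, ← hD, abs_of_pos (by positivity), inv_pow, inv_pow]
      field_simp) (by
      intro a ha
      rw [inv_smul_mulVec_norm hX, inv_smul_mulVec_norm hL, mul_one, le_div_iff₀ hX, le_div_iff₀ hL]
      exact hN a ha) (X' / X) (L' / L) (by rwa [le_div_iff₀ hX]) (by positivity) (by
      rw [div_pow, div_pow, div_mul_div_comm, hD', hD, div_self]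
      rw [← hD]; positivity)
  refine ⟨(L / X) • Δ, fun i j => ?_, fun a ha => ?_⟩
  · rw [Matrix.smul_apply, smul_eq_mul, abs_mul, abs_of_pos (by positivity)]
    exact mul_le_of_le_one_right (by positivity) (hΔ1 i j)
  · have := hΔ2 a ha
    have e : L⁻¹ • F + Δ * (X⁻¹ • P) = L⁻¹ • (F + ((L / X) • Δ) * P) := by
      rw [smul_add, Matrix.mul_smul, Matrix.smul_mul, smul_smul]
      congr 2
      field_simp
    rw [e, inv_smul_mulVec_norm hX, inv_smul_mulVec_norm hL, le_div_iff₀ hX, le_div_iff₀ hL] at this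
    have e1 : ρs * (X' / X) * X = ρs * X' := by field_simp
    have e2 : ρs * (L' / L) * L = ρs * L' := by field_simp
    rwa [e1, e2] at this

/-- A phase of the construction: the lattice stays well rounded along the diagonal flow from
scale `X` to scale `Y` after one shear, with a universal bound at the end of a long phase. -/
lemma exists_shear_phase (κ ν : Type*) [Fintype κ] [DecidableEq κ] [Nonempty κ]
    [Fintype ν] [DecidableEq ν] [Nonempty ν] :
    ∃ ρs : ℝ, 0 < ρs ∧ ρs ≤ 1 ∧ ∀ ρ₀ : ℝ, 0 < ρ₀ → ∃ R₀ : ℝ, 2 ≤ R₀ ∧ ∃ ρ₁ : ℝ, 0 < ρ₁ ∧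
      ∀ (P : Matrix κ (κ ⊕ ν) ℝ) (F : Matrix ν (κ ⊕ ν) ℝ) (X L Y : ℝ), 0 < X → 0 < L → X ≤ Y →
        X ^ Fintype.card κ * L ^ Fintype.card ν = |(P.fromRows F).det| → Nice P F ρ₀ X L →
        ∃ Δ : Matrix ν κ ℝ, (∀ i j, |Δ i j| ≤ 2 * (L / X)) ∧
          (∀ X' L' : ℝ, X ≤ X' → X' ≤ Y → 0 < L' →
            X' ^ Fintype.card κ * L' ^ Fintype.card ν = |(P.fromRows F).det| →
            Nice P (F + Δ * P) ρ₁ X' L') ∧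
          (R₀ * X ≤ Y → ∀ L' : ℝ, 0 < L' →
            Y ^ Fintype.card κ * L' ^ Fintype.card ν = |(P.fromRows F).det| →
            Nice P (F + Δ * P) ρs Y L') := by
  obtain ⟨ρs, h0, h1, h2⟩ := exists_shear_step κ ν
  refine ⟨ρs, h0, h1, fun ρ₀ hρ₀ => ?_⟩
  set ρm := min ρ₀ ρs with hρm
  have hρm0 : 0 < ρm := lt_min hρ₀ h0
  obtain ⟨R₀, hR₀, hR⟩ := h2 ρm hρm0
  have hn : Fintype.card ν ≠ 0 := Fintype.card_ne_zero
  set c := Fintype.card κ with hc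
  set ρ₁ := ρm / (1 + 2 * c) / R₀ ^ 2 with hρ₁
  have hR0 : 0 < R₀ := by linarith
  have hρ₁0 : 0 < ρ₁ := by positivity
  refine ⟨R₀, hR₀, ρ₁, hρ₁0, ?_⟩
  -- near the start of the phase
  have near : ∀ (P : Matrix κ (κ ⊕ ν) ℝ) (F : Matrix ν (κ ⊕ ν) ℝ) (X L X' L' : ℝ), 0 < X → 0 < L →
      X ≤ X' → X' ≤ R₀ ^ 2 * X → L' ≤ L → Nice P F ρm X L →
      ∀ Δ : Matrix ν κ ℝ, (∀ i j, |Δ i j| ≤ 2 * (L / X)) → Nice P (F + Δ * P) ρ₁ X' L' := by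
    intro P F X L X' L' hX hL _ hX' hL' hN Δ hΔ
    refine (hN.shear hρm0.le hX hL.le (by norm_num) hΔ).mono ?_ ?_
    · rw [hρ₁, div_mul_eq_mul_div, div_le_iff₀ (by positivity), mul_assoc]
      gcongr
      linarith
    · have : ρ₁ ≤ ρm / (1 + 2 * c) := div_le_self (by positivity) (by nlinarith)
      calc ρ₁ * L' ≤ ρ₁ * L := by gcongr
        _ ≤ _ := by gcongr
  have main : ∀ N : ℕ, ∀ (P : Matrix κ (κ ⊕ ν) ℝ) (F : Matrix ν (κ ⊕ ν) ℝ) (X L Y : ℝ),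
      0 < X → 0 < L → X ≤ Y → Y < R₀ ^ (N + 2) * X →
      X ^ c * L ^ Fintype.card ν = |(P.fromRows F).det| → Nice P F ρm X L →
        ∃ Δ : Matrix ν κ ℝ, (∀ i j, |Δ i j| ≤ 2 * (L / X)) ∧
          (∀ X' L' : ℝ, X ≤ X' → X' ≤ Y → 0 < L' →
            X' ^ c * L' ^ Fintype.card ν = |(P.fromRows F).det| →
            Nice P (F + Δ * P) ρ₁ X' L') ∧
          (R₀ * X ≤ Y → ∀ L' : ℝ, 0 < L' →
            Y ^ c * L' ^ Fintype.card ν = |(P.fromRows F).det| →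
            Nice P (F + Δ * P) ρs Y L') := by
    intro N
    induction N with
    | zero =>
      intro P F X L Y hX hL hXY hY hD hN
      rw [zero_add] at hY
      have hXL : 0 < L / X := by positivity
      by_cases hsh : R₀ * X ≤ Y
      · obtain ⟨LY, hLY, hLYD⟩ := exists_root (X := Y) (D := |(P.fromRows F).det|) (by linarith)
          (by rw [← hD]; positivity) c hn
        obtain ⟨Δ, hΔ1, hΔ2⟩ := hR P F X L Y LY hX hL hsh hLY hD hLYD hN
        have hΔ : ∀ i j, |Δ i j| ≤ 2 * (L / X) := fun i j => (hΔ1 i j).trans (by linarith)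
        refine ⟨Δ, hΔ, fun X' L' h3 h4 _ h6 => ?_, fun _ L' h3 h4 => ?_⟩
        · exact near P F X L X' L' hX hL h3 (by linarith) (root_anti hn hX h3 hL hD h6) hN Δ hΔ
        · have : L' ≤ LY := root_anti hn (by linarith) le_rfl hLY hLYD h4
          exact hΔ2.mono le_rfl (by gcongr)
      · refine ⟨0, fun i j => by simp; positivity, fun X' L' h3 h4 _ h6 => ?_,
          fun h => absurd h hsh⟩
        exact near P F X L X' L' hX hL h3 (by linarith) (root_anti hn hX h3 hL hD h6) hN 0
          (fun i j => by simp; positivity)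
    | succ N ih =>
      intro P F X L Y hX hL hXY hY hD hN
      by_cases hlong : Y < R₀ ^ (N + 2) * X
      · exact ih P F X L Y hX hL hXY hlong hD hN
      have hXL : 0 < L / X := by positivity
      have hRX : 0 < R₀ * X := by positivity
      obtain ⟨L₁, hL₁, hL₁D⟩ := exists_root (X := R₀ * X) (D := |(P.fromRows F).det|) hRX
          (by rw [← hD]; positivity) c hn
      obtain ⟨Δ₀, hΔ₀1, hΔ₀2⟩ := hR P F X L (R₀ * X) L₁ hX hL le_rfl hL₁ hD hL₁D hN
      have hdet := det_shear P F Δ₀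
      have hYge : R₀ * (R₀ * X) ≤ Y := by
        refine le_trans ?_ (not_lt.mp hlong)
        rw [← mul_assoc, ← sq]
        gcongr
        · linarith
        · omega
      have hL₁L : L₁ ≤ L := root_anti hn hX (by nlinarith) hL hD hL₁D
      obtain ⟨Δ₁, hΔ₁1, hΔ₁2, hΔ₁3⟩ := ih P (F + Δ₀ * P) (R₀ * X) L₁ Y hRX hL₁ (by nlinarith)
        (by rw [← mul_assoc, ← pow_succ]; exact hY) (by rw [hdet]; exact hL₁D)
        (hΔ₀2.mono (by gcongr; exact min_le_right _ _) (by gcongr; exact min_le_right _ _))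
      have hsum : F + Δ₀ * P + Δ₁ * P = F + (Δ₀ + Δ₁) * P := by
        rw [Matrix.add_mul, add_assoc]
      rw [hsum, hdet] at hΔ₁2 hΔ₁3
      have hΔ : ∀ i j, |(Δ₀ + Δ₁) i j| ≤ 2 * (L / X) := by
        intro i j
        rw [Matrix.add_apply]
        have h3 : L₁ / (R₀ * X) ≤ L / X / 2 := by
          rw [div_div]
          exact div_le_div₀ hL.le hL₁L (by positivity) (by nlinarith)
        calc _ ≤ |Δ₀ i j| + |Δ₁ i j| := abs_add_le _ _
          _ ≤ L / X + 2 * (L₁ / (R₀ * X)) := add_le_add (hΔ₀1 i j) (hΔ₁1 i j)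
          _ ≤ _ := by linarith
      refine ⟨Δ₀ + Δ₁, hΔ, fun X' L' h3 h4 h5 h6 => ?_, fun _ L' h3 h4 => hΔ₁3 hYge L' h3 h4⟩
      by_cases h7 : R₀ * X ≤ X'
      · exact hΔ₁2 X' L' h7 h4 h5 h6
      · refine near P F X L X' L' hX hL h3 ?_ (root_anti hn hX h3 hL hD h6) hN _ hΔ
        push Not at h7
        nlinarith
  intro P F X L Y hX hL hXY hD hN
  obtain ⟨N, hN'⟩ := pow_unbounded_of_one_lt (Y / X) (show 1 < R₀ by linarith)
  rw [div_lt_iff₀ hX] at hN'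
  refine main N P F X L Y hX hL hXY (hN'.trans_le ?_) hD
    (hN.mono (by gcongr; exact min_le_left _ _) (by gcongr; exact min_le_left _ _))
  gcongr
  · linarith
  · omega

/-- Minkowski's theorem for a lattice with determinant `X ^ c * L ^ n`. -/
lemma exists_short {κ ν : Type*} [Fintype κ] [DecidableEq κ] [Nonempty κ]
    [Fintype ν] [DecidableEq ν] (P : Matrix κ (κ ⊕ ν) ℝ) (F : Matrix ν (κ ⊕ ν) ℝ) {X L : ℝ}
    (hX : 0 < X) (hL : 0 < L)
    (hD : X ^ Fintype.card κ * L ^ Fintype.card ν = |(P.fromRows F).det|) :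
    ∃ a : κ ⊕ ν → ℤ, a ≠ 0 ∧ ‖P.mulVec (iv a)‖ ≤ 2 * X ∧ ‖F.mulVec (iv a)‖ ≤ 2 * L := by
  have h0 : 0 < |(P.fromRows F).det| := by rw [← hD]; positivity
  obtain ⟨a, ha, h⟩ := exists_int_mulVec_lt (P.fromRows F) (abs_pos.mp h0)
    (Sum.elim (fun _ => 2 * X) (fun _ => 2 * L)) (by rintro (i | i) <;> simp <;> positivity) (by
      rw [Fintype.prod_sum_type]
      simp only [Sum.elim_inl, Sum.elim_inr, Finset.prod_const, Finset.card_univ]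
      rw [mul_pow, mul_pow, mul_mul_mul_comm, hD, ← pow_add]
      exact lt_mul_of_one_lt_left h0 (one_lt_pow₀ (by norm_num)
        (by have := Fintype.card_ne_zero (α := κ); omega)))
  refine ⟨a, ha, ?_, ?_⟩ <;> rw [pi_norm_le_iff_of_nonneg (by positivity)] <;> intro i
  · exact (h (Sum.inl i)).le
  · exact (h (Sum.inr i)).le

lemma exists_reduce_row_step {ι : Type*} [Fintype ι] [DecidableEq ι] (k : ι → ℤ) (i j : ι)
    (hij : i ≠ j) (hj : k j ≠ 0) (hle : |k j| ≤ |k i|) :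
    ∃ W : Matrix ι ι ℤ, W.det = 1 ∧ ∑ l, (Matrix.vecMul k W l).natAbs < ∑ l, (k l).natAbs := by
  obtain ⟨s, hs⟩ : ∃ s : ℤ, |k i + k j * s| < |k i| := by
    rcases lt_or_gt_of_ne hj with h1 | h1 <;> rcases le_total (k i) 0 with h2 | h2
    · refine ⟨-1, ?_⟩
      rw [abs_of_neg h1, abs_of_nonpos h2] at hle
      rw [abs_of_nonpos h2, abs_lt]; constructor <;> linarith
    · refine ⟨1, ?_⟩
      rw [abs_of_neg h1, abs_of_nonneg h2] at hle
      rw [abs_of_nonneg h2, abs_lt]; constructor <;> linarith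
    · refine ⟨1, ?_⟩
      rw [abs_of_pos h1, abs_of_nonpos h2] at hle
      rw [abs_of_nonpos h2, abs_lt]; constructor <;> linarith
    · refine ⟨-1, ?_⟩
      rw [abs_of_pos h1, abs_of_nonneg h2] at hle
      rw [abs_of_nonneg h2, abs_lt]; constructor <;> linarith
  refine ⟨Matrix.transvection j i s, Matrix.det_transvection_of_ne _ _ hij.symm _, ?_⟩
  have hv : ∀ l, Matrix.vecMul k (Matrix.transvection j i s) l =
      k l + if l = i then k j * s else 0 := by
    intro l
    rw [Matrix.transvection, Matrix.vecMul_add, Matrix.vecMul_one, Pi.add_apply]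
    congr 1
    by_cases h : l = i
    · subst h; simp [Matrix.vecMul, dotProduct, Matrix.single_apply]
    · simp [Matrix.vecMul, dotProduct, h, Ne.symm h]
  apply Finset.sum_lt_sum
  · intro l _
    rw [hv]
    by_cases h : l = i
    · rw [h]; simp only [if_true]; zify; exact hs.le
    · simp [h]
  · refine ⟨i, Finset.mem_univ i, ?_⟩
    rw [hv]; simp only [if_true]; zify; exact hs

/-- Every integer row can be brought to the form `(0, …, d, …, 0)` by a unimodular matrix. -/
lemma exists_reduce_row {ι : Type*} [Fintype ι] [DecidableEq ι] (j₀ : ι) (N : ℕ) :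
    ∀ k : ι → ℤ, ∑ l, (k l).natAbs ≤ N →
    ∃ W : Matrix ι ι ℤ, |W.det| = 1 ∧ ∃ d : ℤ, Matrix.vecMul k W = Pi.single j₀ d := by
  induction N using Nat.strong_induction_on with
  | _ N ih =>
  intro k hk
  by_cases hex : ∃ i j, i ≠ j ∧ k i ≠ 0 ∧ k j ≠ 0
  · obtain ⟨i, j, hij, hi, hj⟩ := hex
    have : ∃ W : Matrix ι ι ℤ, W.det = 1 ∧ ∑ l, (Matrix.vecMul k W l).natAbs < ∑ l, (k l).natAbs := by
      rcases le_total |k j| |k i| with h | h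
      · exact exists_reduce_row_step k i j hij hj h
      · exact exists_reduce_row_step k j i hij.symm hi h
    obtain ⟨W, hW, hlt⟩ := this
    obtain ⟨W', hW', d, hd⟩ := ih _ (hlt.trans_le hk) (Matrix.vecMul k W) le_rfl
    refine ⟨W * W', ?_, d, ?_⟩
    · rw [Matrix.det_mul, hW, one_mul, hW']
    · rw [← Matrix.vecMul_vecMul, hd]
  · push Not at hex
    by_cases h0 : k = 0
    · refine ⟨1, by simp, 0, by simp [h0]⟩
    obtain ⟨i, hi⟩ := Function.ne_iff.mp h0
    have hk' : k = Pi.single i (k i) := by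
      ext l
      by_cases h : l = i
      · subst h; simp
      · rw [Pi.single_eq_of_ne h]
        exact hex i l (Ne.symm h) hi
    refine ⟨(Equiv.swap i j₀).permMatrix ℤ, ?_, k i, ?_⟩
    · rw [Matrix.det_permutation]
      rcases Int.units_eq_one_or (Equiv.Perm.sign (Equiv.swap i j₀)) with h | h <;> simp [h]
    · conv_lhs => rw [hk']
      ext l
      rw [Matrix.single_vecMul]
      simp only [Pi.smul_apply, Matrix.row_apply, Equiv.Perm.permMatrix, PEquiv.toMatrix_apply,
        Equiv.toPEquiv_apply, Option.mem_def, Option.some.injEq, Equiv.swap_apply_left,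
        smul_eq_mul, mul_ite, mul_one, mul_zero, Pi.single_apply]
      simp only [eq_comm]

lemma inv_entry_le {ι : Type*} [Fintype ι] [DecidableEq ι] (G : Matrix ι ι ℝ) (hG : |G.det| = 1)
    {K : ℝ} (hK : 1 ≤ K) (hb : ∀ i j, |G i j| ≤ K) (i j : ι) :
    |G⁻¹ i j| ≤ (Fintype.card ι).factorial * K ^ Fintype.card ι := by
  have hdet : G.det ≠ 0 := by intro h; simp [h] at hG
  rw [Matrix.inv_def, Matrix.smul_apply, smul_eq_mul, abs_mul, Ring.inverse_eq_inv', abs_inv, hG,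
    inv_one, one_mul, Matrix.adjugate_apply]
  have := Matrix.det_le (A := G.updateRow j (Pi.single i 1)) (abv := AbsoluteValue.abs) (x := K)
    (by
      intro a b
      rw [AbsoluteValue.abs_apply]
      by_cases h : a = j
      · subst h
        rw [Matrix.updateRow_self, Pi.single_apply]
        split_ifs <;> simp <;> linarith
      · rw [Matrix.updateRow_ne h]; exact hb a b)
  simpa [nsmul_eq_mul] using this

set_option maxHeartbeats 1000000 in
/-- A primitive integral functional on a unimodular lattice, close to a given direction. -/
lemma exists_functional (ι : Type*) [Fintype ι] [DecidableEq ι] {ρ κ : ℝ} (hρ : 0 < ρ)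
    (hκ : 0 < κ) :
    ∃ C : ℝ, 1 ≤ C ∧ ∀ G : Matrix ι ι ℝ, |G.det| = 1 →
      (∀ a : ι → ℤ, a ≠ 0 → ρ ≤ ‖G.mulVec (iv a)‖) →
      ∀ (d : ι → ℝ) (i₀ j₀ : ι), (∀ i, |d i| ≤ 1) → d i₀ = 1 →
      ∃ (B : Matrix ι ι ℤ) (e : ι → ℝ) (c : ℝ), |B.det| = 1 ∧ e i₀ = 1 ∧ (∀ i, |e i - d i| ≤ κ) ∧
        1 / C ≤ c ∧ c ≤ C ∧
        c • Matrix.vecMul e (G * B.map (fun z : ℤ => (z : ℝ))) = Pi.single j₀ 1 := by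
  obtain ⟨K, hK1, hK⟩ := exists_reduced ι hρ
  set p := Fintype.card ι with hp
  set K' : ℝ := p.factorial * K ^ p with hK'
  have hK'0 : 0 ≤ K' := by positivity
  set H : ℝ := 2 * (p * K') * (1 + 2 / κ) + 1 with hH
  have hpK : 0 ≤ p * K' := by positivity
  have hH1 : 1 ≤ H := by rw [hH]; have : 0 ≤ 2 * (p * K') * (1 + 2 / κ) := by positivity
                         linarith
  set C : ℝ := 2 * H * (p * K + 1) + 2 * H with hC
  have hpK2 : 0 ≤ p * K := by positivity
  refine ⟨C, by nlinarith, fun G hG hlow d i₀ j₀ hd hdi => ?_⟩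
  obtain ⟨U, hU, hUb⟩ := hK G hG hlow
  set G' := G * U.map (fun z : ℤ => (z : ℝ)) with hG'
  have hG'det : |G'.det| = 1 := by
    rw [hG', Matrix.det_mul, abs_mul, hG, ← Int.cast_det, ← Int.cast_abs, hU]; simp
  have hG'0 : G'.det ≠ 0 := by intro h; simp [h] at hG'det
  have hG'u : IsUnit G'.det := isUnit_iff_ne_zero.mpr hG'0
  set f : ι → ℝ := Matrix.vecMul (H • d) G' with hf
  set k : ι → ℤ := fun j => round (f j) with hk
  set r : ι → ℝ := iv k - f with hr
  set s : ι → ℝ := Matrix.vecMul r G'⁻¹ with hs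
  have hrb : ∀ j, |r j| ≤ 1 / 2 := fun j => by
    rw [hr]; simp only [Pi.sub_apply, iv, hk]; rw [abs_sub_comm]; exact abs_sub_round _
  have hsb : ∀ j, |s j| ≤ p * K' / 2 := by
    intro j
    calc |s j| ≤ ∑ i, |r i * G'⁻¹ i j| := by
          simp only [hs, Matrix.vecMul, dotProduct]; exact Finset.abs_sum_le_sum_abs _ _
      _ ≤ ∑ i : ι, 1 / 2 * K' := by
          refine Finset.sum_le_sum fun i _ => ?_
          rw [abs_mul]
          exact mul_le_mul (hrb i) (inv_entry_le G' hG'det hK1 hUb i j) (abs_nonneg _) (by norm_num)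
      _ = _ := by rw [Finset.sum_const, Finset.card_univ, nsmul_eq_mul]; ring
  have hkG : iv k = Matrix.vecMul (H • d + s) G' := by
    rw [Matrix.add_vecMul, hs, Matrix.vecMul_vecMul, Matrix.nonsing_inv_mul _ hG'u,
      Matrix.vecMul_one, hr]; simp [hf]
  obtain ⟨W, hW, g, hg⟩ := exists_reduce_row j₀ _ k le_rfl
  set q : ℝ := H + s i₀ with hq
  have hsi := abs_le.mp (hsb i₀)
  have hpH : p * K' / 2 ≤ H / 2 := by
    have : 0 ≤ 2 * (p * K') * (2 / κ) := by positivity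
    nlinarith
  have hqH : H / 2 ≤ q := by rw [hq]; linarith [hsi.1]
  have hqH2 : q ≤ 2 * H := by rw [hq]; linarith [hsi.2]
  have hq0 : 0 < q := by linarith
  have hWunit : IsUnit W.det := Int.isUnit_iff_abs_eq.mpr hW
  -- the content `g` of the row is nonzero and bounded
  have hkW : k = Matrix.vecMul (Pi.single j₀ g) W⁻¹ := by
    rw [← hg, Matrix.vecMul_vecMul, Matrix.mul_nonsing_inv _ hWunit, Matrix.vecMul_one]
  have hk0 : k ≠ 0 := by
    intro h0
    have h1 : Matrix.vecMul (H • d + s) G' = 0 := by rw [← hkG, h0]; ext; simp [iv]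
    have h2 : H • d + s = 0 := by
      have := congrArg (fun v => Matrix.vecMul v G'⁻¹) h1
      simpa [Matrix.vecMul_vecMul, Matrix.mul_nonsing_inv _ hG'u] using this
    have := congrFun h2 i₀
    simp only [Pi.add_apply, Pi.smul_apply, hdi, smul_eq_mul, mul_one, Pi.zero_apply] at this
    rw [← hq] at this
    linarith
  have hg0 : g ≠ 0 := by
    rintro rfl
    apply hk0; rw [hkW]; simp
  have hgb : |(g : ℝ)| ≤ H * (p * K + 1) := by
    obtain ⟨j, hj⟩ := Function.ne_iff.mp hk0
    have h1 : k j = g * W⁻¹ j₀ j := by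
      conv_lhs => rw [hkW]
      rw [Matrix.single_vecMul]; simp
    have h2 : |g| ≤ |k j| := by
      apply Int.le_of_dvd (abs_pos.mpr hj)
      rw [abs_dvd_abs]; exact ⟨_, h1⟩
    have h3 : |(g:ℝ)| ≤ |(k j : ℝ)| := by exact_mod_cast h2
    have h4 : |f j| ≤ H * (p * K) := by
      calc |f j| ≤ ∑ i, |(H • d) i * G' i j| := by
            simp only [hf, Matrix.vecMul, dotProduct]; exact Finset.abs_sum_le_sum_abs _ _
        _ ≤ ∑ i : ι, H * K := by
            refine Finset.sum_le_sum fun i _ => ?_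
            rw [abs_mul]
            refine mul_le_mul ?_ (hUb i j) (abs_nonneg _) (by linarith)
            rw [Pi.smul_apply, smul_eq_mul, abs_mul, abs_of_pos (by linarith)]
            nlinarith [hd i]
        _ = _ := by rw [Finset.sum_const, Finset.card_univ, nsmul_eq_mul]; ring
    have h5 : (k j : ℝ) = f j + r j := by simp [hr, iv]
    have h6 := hrb j
    calc _ ≤ |f j + r j| := by rw [← h5]; exact h3
      _ ≤ |f j| + |r j| := abs_add_le _ _
      _ ≤ _ := by nlinarith
  -- make the content positive
  obtain ⟨W, g, hW, hg, hg0⟩ : ∃ (W : Matrix ι ι ℤ) (g' : ℤ), |W.det| = 1 ∧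
      Matrix.vecMul k W = Pi.single j₀ g' ∧ 0 < g' ∧ |(g':ℝ)| ≤ H * (p * K + 1) := by
    rcases lt_or_gt_of_ne hg0 with h | h
    · refine ⟨-W, -g, ?_, ?_, by linarith, by simpa using hgb⟩
      · rw [Matrix.det_neg, abs_mul, hW]; simp
      · rw [Matrix.vecMul_neg, hg, Pi.single_neg]
    · exact ⟨W, g, hW, hg, h, hgb⟩
  obtain ⟨hg0, hgb⟩ := hg0
  have hgr : (1:ℝ) ≤ g := by exact_mod_cast hg0
  have hgpos : (0:ℝ) < g := by linarith
  rw [abs_of_pos hgpos] at hgb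
  refine ⟨U * W, q⁻¹ • (H • d + s), q / g, ?_, ?_, ?_, ?_, ?_, ?_⟩
  · rw [Matrix.det_mul, abs_mul, hU, hW, one_mul]
  · simp [hdi, hq]; field_simp
    exact div_self hq0.ne'
  · intro i
    have : (q⁻¹ • (H • d + s)) i - d i = (s i - d i * s i₀) / q := by
      simp only [Pi.smul_apply, Pi.add_apply, smul_eq_mul]
      field_simp
      rw [hq]; ring
    rw [this, abs_div, abs_of_pos hq0, div_le_iff₀ hq0]
    have h1 : |s i - d i * s i₀| ≤ p * K' := by
      have h3 : |d i * s i₀| ≤ p * K' / 2 := by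
        rw [abs_mul]; exact (mul_le_of_le_one_left (abs_nonneg _) (hd i)).trans (hsb i₀)
      exact (abs_sub _ _).trans (by linarith [hsb i])
    refine h1.trans (le_trans ?_ (mul_le_mul_of_nonneg_left hqH hκ.le))
    rw [hH]
    have : κ * ((2 * (p * K') * (1 + 2 / κ) + 1) / 2) = p * K' * κ + 2 * (p * K') + κ / 2 := by
      field_simp
    rw [this]
    nlinarith [mul_nonneg hpK hκ.le]
  · rw [div_le_div_iff₀ (by nlinarith) hgpos]
    nlinarith
  · rw [div_le_iff₀ hgpos]
    nlinarith
  · have h1 : Matrix.vecMul (iv k) (W.map (fun z : ℤ => (z : ℝ))) = Pi.single j₀ (g : ℝ) := by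
      ext l
      have h2 := congrFun hg l
      have h3 : Matrix.vecMul (iv k) (W.map (fun z : ℤ => (z : ℝ))) l =
          ((Matrix.vecMul k W l : ℤ) : ℝ) := by
        simp [Matrix.vecMul, dotProduct, iv]
      rw [h3, h2, Pi.single_apply, Pi.single_apply]; split_ifs <;> simp
    have hmap : G * (U * W).map (fun z : ℤ => (z : ℝ)) = G' * W.map (fun z : ℤ => (z : ℝ)) := by
      rw [hG', Matrix.mul_assoc]
      congr 1
      exact Matrix.map_mul (f := Int.castRingHom ℝ)
    rw [hmap, Matrix.smul_vecMul, ← Matrix.vecMul_vecMul, ← hkG, h1, smul_smul]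
    ext l
    rw [Pi.smul_apply, Pi.single_apply, Pi.single_apply]
    split_ifs
    · simp; field_simp
    · simp

/-- The real matrix underlying an integer matrix. -/
abbrev rc {ι κ : Type*} (M : Matrix ι κ ℤ) : Matrix ι κ ℝ := M.map (fun z : ℤ => (z : ℝ))

/-- The remainder `Ξ x - y`. -/
def lv {α ν : Type*} [Fintype α] (Ξ : Matrix ν α ℝ) (x : α → ℤ) (y : ν → ℤ) : ν → ℝ :=
  Ξ.mulVec (iv x) - iv y

/-- The functional `A x + A₁ y`. -/
def wv {α ν τ : Type*} [Fintype α] [Fintype ν] (A : Matrix τ α ℝ) (A₁ : Matrix τ ν ℝ)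
    (x : α → ℤ) (y : ν → ℤ) : τ → ℝ :=
  A.mulVec (iv x) + A₁.mulVec (iv y)

lemma lv_add {α ν : Type*} [Fintype α] (Ξ : Matrix ν α ℝ) (x x' : α → ℤ) (y y' : ν → ℤ) :
    lv Ξ (x + x') (y + y') = lv Ξ x y + lv Ξ x' y' := by
  simp only [lv, iv_add, Matrix.mulVec_add]; abel

lemma wv_add {α ν τ : Type*} [Fintype α] [Fintype ν] (A : Matrix τ α ℝ) (A₁ : Matrix τ ν ℝ)
    (x x' : α → ℤ) (y y' : ν → ℤ) :
    wv A A₁ (x + x') (y + y') = wv A A₁ x y + wv A A₁ x' y' := by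
  simp only [wv, iv_add, Matrix.mulVec_add]; abel

lemma iv_smul {ι : Type*} (k : ℤ) (a : ι → ℤ) : iv (k • a) = (k : ℝ) • iv a := by
  ext; simp [iv]

lemma lv_smul {α ν : Type*} [Fintype α] (Ξ : Matrix ν α ℝ) (k : ℤ) (x : α → ℤ) (y : ν → ℤ) :
    lv Ξ (k • x) (k • y) = (k : ℝ) • lv Ξ x y := by
  simp only [lv, iv_smul, Matrix.mulVec_smul, smul_sub]

lemma wv_smul {α ν τ : Type*} [Fintype α] [Fintype ν] (A : Matrix τ α ℝ) (A₁ : Matrix τ ν ℝ)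
    (k : ℤ) (x : α → ℤ) (y : ν → ℤ) :
    wv A A₁ (k • x) (k • y) = (k : ℝ) • wv A A₁ x y := by
  simp only [wv, iv_smul, Matrix.mulVec_smul, smul_add]

lemma lv_add_left {α ν : Type*} [Fintype α] (Ξ Δ : Matrix ν α ℝ) (x : α → ℤ) (y : ν → ℤ) :
    lv (Ξ + Δ) x y = lv Ξ x y + Δ.mulVec (iv x) := by
  simp only [lv, Matrix.add_mulVec]; abel

lemma lv_add_mul {α ν τ : Type*} [Fintype α] [Fintype ν] (A : Matrix τ α ℝ) (A₁ : Matrix τ ν ℝ)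
    (Ξ : Matrix ν α ℝ) (x : α → ℤ) (y : ν → ℤ) (i : τ → ℤ) :
    lv (A + A₁ * Ξ) x i = (wv A A₁ x y - iv i) + A₁.mulVec (lv Ξ x y) := by
  simp only [lv, wv, Matrix.add_mulVec, Matrix.mulVec_sub, Matrix.mulVec_mulVec]; abel

lemma one_le_norm_iv {ι : Type*} [Fintype ι] {a : ι → ℤ} (ha : a ≠ 0) : 1 ≤ ‖iv a‖ := by
  obtain ⟨j, hj⟩ := Function.ne_iff.mp ha
  refine le_trans ?_ (norm_le_pi_norm (iv a) j)
  rw [Real.norm_eq_abs]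
  have : 1 ≤ |a j| := Int.one_le_abs hj
  simp only [iv]
  exact_mod_cast this

lemma exists_round {α ν : Type*} [Fintype α] [Fintype ν] (Ξ : Matrix ν α ℝ) (x : α → ℤ) :
    ∃ y : ν → ℤ, ‖lv Ξ x y‖ ≤ 1 / 2 := by
  refine ⟨fun j => round (Ξ.mulVec (iv x) j), ?_⟩
  rw [pi_norm_le_iff_of_nonneg (by norm_num)]
  intro j
  simpa [lv, iv] using abs_sub_round (Ξ.mulVec (iv x) j)

/-- At height `X` the minimum of the joint remainder is comparable to `l`. -/
def Est {α ν τ : Type*} [Fintype α] [Fintype ν] [Fintype τ] (Ξ : Matrix ν α ℝ)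
    (Γ : Matrix τ α ℝ) (X l K : ℝ) : Prop :=
  (∀ x : α → ℤ, x ≠ 0 → ∀ (y : ν → ℤ) (i : τ → ℤ), ‖iv x‖ < X / K →
    l / K ≤ ‖lv Ξ x y‖ ∨ l / K ≤ ‖lv Γ x i‖) ∧
  ∃ x : α → ℤ, x ≠ 0 ∧ ∃ (y : ν → ℤ) (i : τ → ℤ),
    ‖iv x‖ ≤ K * X ∧ ‖lv Ξ x y‖ ≤ K * l ∧ ‖lv Γ x i‖ ≤ K * l

lemma Est.mono {α ν τ : Type*} [Fintype α] [Fintype ν] [Fintype τ] {Ξ : Matrix ν α ℝ}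
    {Γ : Matrix τ α ℝ} {X l K X' l' K' : ℝ} (h : Est Ξ Γ X l K)
    (h1 : X' / K' ≤ X / K) (h2 : l' / K' ≤ l / K) (h3 : K * X ≤ K' * X') (h4 : K * l ≤ K' * l') :
    Est Ξ Γ X' l' K' := by
  obtain ⟨hl, x, hx, y, i, hu1, hu2, hu3⟩ := h
  exact ⟨fun x hx y i hX => (hl x hx y i (hX.trans_le h1)).imp h2.trans h2.trans,
    x, hx, y, i, hu1.trans h3, hu2.trans h4, hu3.trans h4⟩

lemma Est.mono_const {α ν τ : Type*} [Fintype α] [Fintype ν] [Fintype τ] {Ξ : Matrix ν α ℝ}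
    {Γ : Matrix τ α ℝ} {X l K K' : ℝ} (h : Est Ξ Γ X l K) (hX : 0 ≤ X) (hl : 0 ≤ l) (hK : 0 < K)
    (hKK : K ≤ K') : Est Ξ Γ X l K' :=
  h.mono (by gcongr) (by gcongr) (by gcongr) (by gcongr)

lemma lv_sub_norm_le {α ν : Type*} [Fintype α] [Fintype ν] {M M' : Matrix ν α ℝ}
    {X l C : ℝ} (hX : X ≠ 0) (hl : 0 ≤ l / X) (hC : 0 ≤ C)
    (hM : ∀ i j, |(M' - M) i j| ≤ C * (l / X)) (x : α → ℤ) (y : ν → ℤ) (s : ℝ)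
    (hs : ‖iv x‖ ≤ s * X) : ‖lv M' x y - lv M x y‖ ≤ Fintype.card α * C * s * l := by
  have h1 : lv M' x y - lv M x y = (M' - M).mulVec (iv x) := by
    simp only [lv, Matrix.sub_mulVec]; abel
  rw [h1]
  refine (mulVec_norm_le _ (by positivity) hM _).trans ?_
  calc _ ≤ Fintype.card α * (C * (l / X)) * (s * X) := by gcongr
    _ = _ := by field_simp

lemma Est.perturb {α ν τ : Type*} [Fintype α] [Fintype ν] [Fintype τ] {Ξ Ξ' : Matrix ν α ℝ}
    {Γ Γ' : Matrix τ α ℝ} {X l K C : ℝ} (h : Est Ξ Γ X l K) (hX : 0 < X) (hl : 0 < l)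
    (hK : 0 < K) (hC : 0 ≤ C) (hΞ : ∀ i j, |(Ξ' - Ξ) i j| ≤ C * (l / X))
    (hΓ : ∀ i j, |(Γ' - Γ) i j| ≤ C * (l / X)) :
    Est Ξ' Γ' X l (K * (1 + Fintype.card α * C)) := by
  set c : ℝ := Fintype.card α * C with hc
  have hc0 : 0 ≤ c := by positivity
  obtain ⟨hlow, x, hx, y, i, hu1, hu2, hu3⟩ := h
  have hK' : 0 < K * (1 + c) := by positivity
  have hdiv : ∀ z : ℝ, z / (K * (1 + c)) = z / K - c * (z / (K * (1 + c))) := by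
    intro z; field_simp; ring
  refine ⟨fun x hx y i hX' => ?_, x, hx, y, i, hu1.trans ?_, ?_, ?_⟩
  · have hs : ‖iv x‖ ≤ (1 / (K * (1 + c))) * X := by
      rw [one_div_mul_eq_div]; exact hX'.le
    have hlt : ‖iv x‖ < X / K := hX'.trans_le (by
      rw [div_le_div_iff_of_pos_left hX hK' hK]; nlinarith)
    have e : c * (1 / (K * (1 + c))) * l = c * (l / (K * (1 + c))) := by ring
    rcases hlow x hx y i hlt with h | h
    · left
      have h1 := lv_sub_norm_le hX.ne' (by positivity) hC hΞ x y _ hs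
      have h2 := norm_sub_norm_le (lv Ξ x y) (lv Ξ' x y)
      rw [norm_sub_rev] at h2
      rw [hdiv l]; rw [e] at h1; linarith
    · right
      have h1 := lv_sub_norm_le hX.ne' (by positivity) hC hΓ x i _ hs
      have h2 := norm_sub_norm_le (lv Γ x i) (lv Γ' x i)
      rw [norm_sub_rev] at h2
      rw [hdiv l]; rw [e] at h1; linarith
  · gcongr; nlinarith
  · have h1 := lv_sub_norm_le hX.ne' (by positivity) hC hΞ x y _ hu1
    have h2 := norm_sub_norm_le (lv Ξ' x y) (lv Ξ x y)
    nlinarith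
  · have h1 := lv_sub_norm_le hX.ne' (by positivity) hC hΓ x i _ hu1
    have h2 := norm_sub_norm_le (lv Γ' x i) (lv Γ x i)
    nlinarith

lemma est_of_split {α ν τ : Type*} [Fintype α] [Nonempty α] [Fintype ν] [Fintype τ]
    {Ξ : Matrix ν α ℝ} {A : Matrix τ α ℝ} {A₁ : Matrix τ ν ℝ} {X l K : ℝ}
    (hX : 1 ≤ X) (hl : 0 < l) (hK : 1 ≤ K) (hA : ∀ i j, |A₁ i j| ≤ 1)
    (hlow : ∀ x : α → ℤ, x ≠ 0 → ∀ (y : ν → ℤ) (i : τ → ℤ), ‖iv x‖ < X / K →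
      ‖lv Ξ x y‖ < l / K → ‖wv A A₁ x y - iv i‖ < l / K → False)
    (hup : ∃ (x : α → ℤ) (y : ν → ℤ) (i : τ → ℤ), (x = 0 → y ≠ 0) ∧
      ‖iv x‖ ≤ K * X ∧ ‖lv Ξ x y‖ ≤ K * l ∧ ‖wv A A₁ x y - iv i‖ ≤ K * l) :
    Est Ξ (A + A₁ * Ξ) X l (K * (1 + Fintype.card ν)) := by
  have hc : (0:ℝ) ≤ Fintype.card ν := by positivity
  have hK' : 0 < K * (1 + Fintype.card ν) := by positivity
  have hKK : K ≤ K * (1 + Fintype.card ν) := by nlinarith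
  have hKK' : ∀ z : ℝ, 0 ≤ z → z / (K * (1 + Fintype.card ν)) ≤ z / K := fun z hz => by gcongr
  refine ⟨fun x hx y i hX' => ?_, ?_⟩
  · by_contra! hcon
    obtain ⟨h1, h2⟩ := hcon
    refine hlow x hx y i (hX'.trans_le (hKK' X (by linarith)))
      (h1.trans_le (hKK' l hl.le)) ?_
    rw [lv_add_mul A A₁ Ξ x y i] at h2
    have h3 := mulVec_norm_le A₁ zero_le_one hA (lv Ξ x y)
    have h4 := norm_sub_le (wv A A₁ x y - iv i + A₁.mulVec (lv Ξ x y)) (A₁.mulVec (lv Ξ x y))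
    rw [add_sub_cancel_right] at h4
    have h5 : l / K = l / (K * (1 + Fintype.card ν)) +
        Fintype.card ν * 1 * (l / (K * (1 + Fintype.card ν))) := by field_simp
    have h6 : (Fintype.card ν : ℝ) * 1 * ‖lv Ξ x y‖ ≤
        Fintype.card ν * 1 * (l / (K * (1 + Fintype.card ν))) := by gcongr
    linarith
  · by_cases hKl : 1 ≤ K * l
    · have h1 : (1 : α → ℤ) ≠ 0 := one_ne_zero
      obtain ⟨y, hy⟩ := exists_round Ξ (1 : α → ℤ)
      obtain ⟨i, hi⟩ := exists_round (A + A₁ * Ξ) (1 : α → ℤ)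
      refine ⟨1, h1, y, i, ?_, by nlinarith, by nlinarith⟩
      have : iv (1 : α → ℤ) = 1 := by ext; simp [iv]
      rw [this]
      have : ‖(1 : α → ℝ)‖ ≤ 1 := by
        rw [pi_norm_le_iff_of_nonneg zero_le_one]; intro; simp
      nlinarith
    · obtain ⟨x, y, i, hxy, h1, h2, h3⟩ := hup
      refine ⟨x, fun h0 => ?_, y, i, ?_, ?_, ?_⟩
      · have h4 := one_le_norm_iv (hxy h0)
        have : lv Ξ x y = - iv y := by
          have h5 : iv (0 : α → ℤ) = 0 := by ext; simp [iv]
          rw [h0, lv, h5, Matrix.mulVec_zero, zero_sub]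
        rw [this, norm_neg] at h2
        linarith
      · refine h1.trans ?_; gcongr
      · refine h2.trans ?_; gcongr
      · rw [lv_add_mul A A₁ Ξ x y i]
        refine (norm_add_le _ _).trans ?_
        have h4 := mulVec_norm_le A₁ zero_le_one hA (lv Ξ x y)
        have h5 : (Fintype.card ν : ℝ) * 1 * ‖lv Ξ x y‖ ≤ Fintype.card ν * 1 * (K * l) := by
          gcongr
        nlinarith

/-- The matrix of remainders of the lattice vectors. -/
def rem {α ν σ : Type*} [Fintype α] (Ξ : Matrix ν α ℝ) (Bx : Matrix α σ ℤ) (By : Matrix ν σ ℤ) :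
    Matrix ν σ ℝ := Ξ * rc Bx - rc By

lemma rem_mulVec {α ν σ : Type*} [Fintype α] [Fintype σ] (Ξ : Matrix ν α ℝ) (Bx : Matrix α σ ℤ)
    (By : Matrix ν σ ℤ) (a : σ → ℤ) :
    (rem Ξ Bx By).mulVec (iv a) = lv Ξ (Bx.mulVec a) (By.mulVec a) := by
  simp only [rem, lv, Matrix.sub_mulVec, iv_mulVec, Matrix.mulVec_mulVec]

lemma rem_add {α ν σ : Type*} [Fintype α] (Ξ Δ : Matrix ν α ℝ) (Bx : Matrix α σ ℤ)
    (By : Matrix ν σ ℤ) : rem (Ξ + Δ) Bx By = rem Ξ Bx By + Δ * rc Bx := by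
  simp only [rem, Matrix.add_mul]; abel

/-- The columns of `(Bx, By)` generate the lattice on which `A x + A₁ y` is integral. -/
def IsGen {α ν τ σ : Type*} [Fintype α] [Fintype ν] [Fintype σ] (A : Matrix τ α ℝ)
    (A₁ : Matrix τ ν ℝ) (Bx : Matrix α σ ℤ) (By : Matrix ν σ ℤ) : Prop :=
  (∀ a : σ → ℤ, ∃ i : τ → ℤ, wv A A₁ (Bx.mulVec a) (By.mulVec a) = iv i) ∧
  ∀ (x : α → ℤ) (y : ν → ℤ) (i : τ → ℤ), wv A A₁ x y = iv i →
    ∃ a : σ → ℤ, x = Bx.mulVec a ∧ y = By.mulVec a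

lemma submatrix_mulVec_iv {ι σ σ' : Type*} [Fintype σ] [Fintype σ'] (M : Matrix ι σ ℝ)
    (e : σ' ≃ σ) (a : σ' → ℤ) :
    (M.submatrix id e).mulVec (iv a) = M.mulVec (iv (a ∘ e.symm)) := by
  ext i
  simp only [Matrix.mulVec, dotProduct, Matrix.submatrix_apply, id_eq, iv]
  rw [← e.sum_comp]
  simp

lemma nice_submatrix {κ ν σ σ' : Type*} [Fintype κ] [Fintype ν] [Fintype σ] [Fintype σ']
    {P : Matrix κ σ ℝ} {F : Matrix ν σ ℝ} (e : σ' ≃ σ) {ρ X L : ℝ} :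
    Nice (P.submatrix id e) (F.submatrix id e) ρ X L ↔ Nice P F ρ X L := by
  constructor
  · intro h a ha
    have h1 := h (a ∘ e) (fun h0 => ha (by
      ext i; have := congrFun h0 (e.symm i); simpa using this))
    rw [submatrix_mulVec_iv, submatrix_mulVec_iv] at h1
    simpa [Function.comp_assoc] using h1
  · intro h a ha
    rw [submatrix_mulVec_iv, submatrix_mulVec_iv]
    exact h _ (fun h0 => ha (by ext i; have := congrFun h0 (e i); simpa using this))

lemma exists_shear_phase_equiv (κ ν : Type*) [Fintype κ] [DecidableEq κ] [Nonempty κ]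
    [Fintype ν] [DecidableEq ν] [Nonempty ν] :
    ∃ ρs : ℝ, 0 < ρs ∧ ρs ≤ 1 ∧ ∀ ρ₀ : ℝ, 0 < ρ₀ → ∃ R₀ : ℝ, 2 ≤ R₀ ∧ ∃ ρ₁ : ℝ, 0 < ρ₁ ∧
      ∀ (σ : Type) [Fintype σ] (e : κ ⊕ ν ≃ σ) (P : Matrix κ σ ℝ) (F : Matrix ν σ ℝ) (X L Y : ℝ),
        0 < X → 0 < L → X ≤ Y →
        X ^ Fintype.card κ * L ^ Fintype.card ν = |((P.fromRows F).submatrix id e).det| →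
        Nice P F ρ₀ X L →
        ∃ Δ : Matrix ν κ ℝ, (∀ i j, |Δ i j| ≤ 2 * (L / X)) ∧
          (∀ X' L' : ℝ, X ≤ X' → X' ≤ Y → 0 < L' →
            X' ^ Fintype.card κ * L' ^ Fintype.card ν =
              X ^ Fintype.card κ * L ^ Fintype.card ν → Nice P (F + Δ * P) ρ₁ X' L') ∧
          (R₀ * X ≤ Y → ∀ L' : ℝ, 0 < L' →
            Y ^ Fintype.card κ * L' ^ Fintype.card ν =
              X ^ Fintype.card κ * L ^ Fintype.card ν → Nice P (F + Δ * P) ρs Y L') := by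
  obtain ⟨ρs, h1, h2, h3⟩ := exists_shear_phase κ ν
  refine ⟨ρs, h1, h2, fun ρ₀ hρ₀ => ?_⟩
  obtain ⟨R₀, hR₀, ρ₁, hρ₁, h4⟩ := h3 ρ₀ hρ₀
  refine ⟨R₀, hR₀, ρ₁, hρ₁, fun σ _ e P F X L Y hX hL hXY hD hN => ?_⟩
  have hsub : (P.fromRows F).submatrix id e =
      (P.submatrix id e).fromRows (F.submatrix id e) := by
    ext i j; rcases i with i | i <;> rfl
  rw [hsub] at hD
  obtain ⟨Δ, hΔ1, hΔ2, hΔ3⟩ := h4 _ _ X L Y hX hL hXY hD ((nice_submatrix e).mpr hN)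
  have hmul : F.submatrix id e + Δ * P.submatrix id e = (F + Δ * P).submatrix id e := by
    ext i j; simp [Matrix.mul_apply]
  rw [hmul, ← hD] at hΔ2 hΔ3
  exact ⟨Δ, hΔ1, fun X' L' a b c d => (nice_submatrix e).mp (hΔ2 X' L' a b c d),
    fun a L' c d => (nice_submatrix e).mp (hΔ3 a L' c d)⟩

lemma exists_short_equiv {κ ν σ : Type*} [Fintype κ] [DecidableEq κ] [Nonempty κ]
    [Fintype ν] [DecidableEq ν] [Fintype σ] (e : κ ⊕ ν ≃ σ) (P : Matrix κ σ ℝ) (F : Matrix ν σ ℝ)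
    {X L : ℝ} (hX : 0 < X) (hL : 0 < L)
    (hD : X ^ Fintype.card κ * L ^ Fintype.card ν = |((P.fromRows F).submatrix id e).det|) :
    ∃ a : σ → ℤ, a ≠ 0 ∧ ‖P.mulVec (iv a)‖ ≤ 2 * X ∧ ‖F.mulVec (iv a)‖ ≤ 2 * L := by
  have hsub : (P.fromRows F).submatrix id e =
      (P.submatrix id e).fromRows (F.submatrix id e) := by
    ext i j; rcases i with i | i <;> rfl
  rw [hsub] at hD
  obtain ⟨a, ha, h1, h2⟩ := exists_short _ _ hX hL hD
  rw [submatrix_mulVec_iv] at h1 h2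
  exact ⟨_, fun h0 => ha (by ext i; have := congrFun h0 (e i); simpa using this), h1, h2⟩

lemma det_shear_equiv {κ ν σ : Type*} [Fintype κ] [DecidableEq κ] [Fintype ν] [DecidableEq ν]
    (e : κ ⊕ ν ≃ σ) (P : Matrix κ σ ℝ) (F : Matrix ν σ ℝ) (Δ : Matrix ν κ ℝ) :
    ((P.fromRows (F + Δ * P)).submatrix id e).det = ((P.fromRows F).submatrix id e).det := by
  have hsub : ∀ F : Matrix ν σ ℝ, (P.fromRows F).submatrix id e =
      (P.submatrix id e).fromRows (F.submatrix id e) := by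
    intro F; ext i j; rcases i with i | i <;> rfl
  have hmul : (F + Δ * P).submatrix id e = F.submatrix id e + Δ * P.submatrix id e := by
    ext i j; simp [Matrix.mul_apply]
  rw [hsub, hsub, hmul, det_shear]

/-- The phase in which only the real functionals `Ξ` are deformed. -/
lemma exists_full_phase (α ν : Type*) [Fintype α] [DecidableEq α] [Nonempty α]
    [Fintype ν] [DecidableEq ν] [Nonempty ν] :
    ∃ ρs : ℝ, 0 < ρs ∧ ρs ≤ 1 ∧ ∀ ρ₀ : ℝ, 0 < ρ₀ → ∃ R₀ : ℝ, 2 ≤ R₀ ∧ ∃ K : ℝ, 1 ≤ K ∧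
      ∀ (τ σ : Type) [Fintype τ] [Fintype σ] (e : α ⊕ ν ≃ σ) (Ξ : Matrix ν α ℝ)
        (A : Matrix τ α ℝ) (A₁ : Matrix τ ν ℝ) (Bx : Matrix α σ ℤ) (By : Matrix ν σ ℤ)
        (P L Y : ℝ), 1 ≤ P → 0 < L → R₀ * P ≤ Y →
        P ^ Fintype.card α * L ^ Fintype.card ν =
          |(((rc Bx).fromRows (rem Ξ Bx By)).submatrix id e).det| →
        Nice (rc Bx) (rem Ξ Bx By) ρ₀ P L →
        IsGen A A₁ Bx By →
        (∀ x y i, wv A A₁ x y ≠ iv i → ρ₀ * L ≤ ‖wv A A₁ x y - iv i‖) →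
        (∀ i j, |A₁ i j| ≤ 1) →
        ∃ Ξ' : Matrix ν α ℝ, (∀ i j, |(Ξ' - Ξ) i j| ≤ 2 * (L / P)) ∧
          |(((rc Bx).fromRows (rem Ξ' Bx By)).submatrix id e).det| =
            P ^ Fintype.card α * L ^ Fintype.card ν ∧
          (∀ X l : ℝ, P ≤ X → X ≤ Y → 0 < l →
            X ^ Fintype.card α * l ^ Fintype.card ν =
              P ^ Fintype.card α * L ^ Fintype.card ν →
            Est Ξ' (A + A₁ * Ξ') X l K) ∧
          ∀ l : ℝ, 0 < l → Y ^ Fintype.card α * l ^ Fintype.card ν =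
              P ^ Fintype.card α * L ^ Fintype.card ν →
            Nice (rc Bx) (rem Ξ' Bx By) ρs Y l := by
  obtain ⟨ρs, h1, h2, h3⟩ := exists_shear_phase_equiv α ν
  refine ⟨ρs, h1, h2, fun ρ₀ hρ₀ => ?_⟩
  obtain ⟨R₀, hR₀, ρ₁, hρ₁, h4⟩ := h3 ρ₀ hρ₀
  set K : ℝ := 2 + 1 / ρ₁ + 1 / ρ₀ with hK
  have hK1 : 1 ≤ K := by
    have : 0 < 1 / ρ₁ := by positivity
    have : 0 < 1 / ρ₀ := by positivity
    linarith
  have hKρ₁ : 1 / K ≤ ρ₁ := by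
    rw [div_le_iff₀ (by linarith)]
    have : ρ₁ * (1 / ρ₁) = 1 := by field_simp
    have : 0 < 1 / ρ₀ := by positivity
    rw [hK]; nlinarith
  have hKρ₀ : 1 / K ≤ ρ₀ := by
    rw [div_le_iff₀ (by linarith)]
    have : ρ₀ * (1 / ρ₀) = 1 := by field_simp
    have : 0 < 1 / ρ₁ := by positivity
    rw [hK]; nlinarith
  refine ⟨R₀, hR₀, K * (1 + Fintype.card ν), by
    have : (0:ℝ) ≤ Fintype.card ν := by positivity
    nlinarith, ?_⟩
  intro τ σ _ _ e Ξ A A₁ Bx By P L Y hP hL hPY hD hN hG hgap hA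
  obtain ⟨Δ, hΔ1, hΔ2, hΔ3⟩ := h4 σ e _ _ P L Y (by linarith) hL (by nlinarith) hD hN
  rw [← rem_add] at hΔ2 hΔ3
  have hdet := det_shear_equiv e (rc Bx) (rem Ξ Bx By) Δ
  rw [← rem_add] at hdet
  refine ⟨Ξ + Δ, by simpa using hΔ1, by rw [hdet, hD], fun X l hX hXY hl hXl => ?_, hΔ3 hPY⟩
  have hX0 : 0 < X := by linarith
  have hlL : l ≤ L := root_anti (Fintype.card_ne_zero (α := ν)) (by linarith) hX hL rfl hXl
  refine est_of_split (by linarith) hl hK1 hA ?_ ?_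
  · intro x hx y i hxX hly hwi
    have hw : wv A A₁ x y = iv i := by
      by_contra hne
      have := hgap x y i hne
      have h5 : l / K ≤ ρ₀ * L := by
        rw [← one_div_mul_eq_div]; gcongr
      linarith
    obtain ⟨a, rfl, rfl⟩ := hG.2 x y i hw
    have ha : a ≠ 0 := by rintro rfl; exact hx (Matrix.mulVec_zero _)
    rcases hΔ2 X l hX hXY hl hXl a ha with h | h
    · rw [← iv_mulVec] at h
      have : X / K ≤ ρ₁ * X := by rw [← one_div_mul_eq_div]; gcongr
      linarith
    · rw [rem_mulVec] at h
      have : l / K ≤ ρ₁ * l := by rw [← one_div_mul_eq_div]; gcongr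
      linarith
  · obtain ⟨a, ha, h5, h6⟩ := exists_short_equiv e (rc Bx) (rem (Ξ + Δ) Bx By) hX0 hl
      (by rw [hdet, ← hD, hXl])
    rw [rem_mulVec] at h6
    rw [← iv_mulVec] at h5
    obtain ⟨i, hi⟩ := hG.1 a
    have h2K : 2 ≤ K := by
      have : 0 < 1 / ρ₁ := by positivity
      have : 0 < 1 / ρ₀ := by positivity
      linarith
    refine ⟨Bx.mulVec a, By.mulVec a, i, fun hx hy => ?_, h5.trans (by gcongr),
      h6.trans (by gcongr), by rw [hi, sub_self, norm_zero]; positivity⟩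
    have h7 : (rc Bx).mulVec (iv a) = 0 := by rw [← iv_mulVec, hx]; ext; simp [iv]
    have h8 : (rem Ξ Bx By).mulVec (iv a) = 0 := by
      rw [rem_mulVec, hx, hy]
      have : ∀ ι : Type _, iv (0 : ι → ℤ) = 0 := fun ι => by ext; simp [iv]
      rw [lv, this, Matrix.mulVec_zero]; ext; simp [iv]
    rcases hN a ha with h | h
    · rw [h7, norm_zero] at h; nlinarith [mul_pos hρ₀ (by linarith : (0:ℝ) < P)]
    · rw [h8, norm_zero] at h; nlinarith [mul_pos hρ₀ hL]

/-- The rearrangement of rows moving the distinguished coordinate to the end. -/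
def eW (κ ν : Type*) : (κ ⊕ Unit) ⊕ ν ≃ κ ⊕ (ν ⊕ Unit) :=
  (Equiv.sumAssoc κ Unit ν).trans (Equiv.sumCongr (Equiv.refl κ) (Equiv.sumComm Unit ν))

lemma det_move_row {κ ν : Type*} [Fintype κ] [DecidableEq κ] [Fintype ν] [DecidableEq ν]
    (P : Matrix (κ ⊕ Unit) (κ ⊕ (ν ⊕ Unit)) ℝ) (F : Matrix ν (κ ⊕ (ν ⊕ Unit)) ℝ) (ε : ℝ) :
    ((P.submatrix Sum.inl id).fromRows (F.fromRows (ε • P.submatrix Sum.inr id))).det =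
      ε * ((P.fromRows F).submatrix id (eW κ ν)).det := by
  have h1 : (P.submatrix Sum.inl id).fromRows (F.fromRows (ε • P.submatrix Sum.inr id)) =
      Matrix.diagonal (Sum.elim (fun _ : κ => (1:ℝ)) (Sum.elim (fun _ : ν => 1) fun _ => ε)) *
        (P.fromRows F).submatrix (eW κ ν).symm id := by
    ext (i | i | i) j <;> simp [Matrix.diagonal_mul, eW, Equiv.sumAssoc, Equiv.sumComm]
  have h2 : ((P.fromRows F).submatrix (eW κ ν).symm id).det =
      ((P.fromRows F).submatrix id (eW κ ν)).det := by
    rw [← Matrix.det_submatrix_equiv_self (eW κ ν) ((P.fromRows F).submatrix (eW κ ν).symm id),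
      Matrix.submatrix_submatrix]
    congr 1
    ext i j; simp
  rw [h1, Matrix.det_mul, Matrix.det_diagonal, h2]
  simp [Fintype.prod_sum_type]

/-- The row of values of the functional `T` on the lattice vectors. -/
def tauRow {α σ : Type*} [Fintype α] (T : α → ℝ) (Bx : Matrix α σ ℤ) : Matrix Unit σ ℝ :=
  fun _ j => T ⬝ᵥ (fun i => (Bx i j : ℝ))

lemma tauRow_mulVec {α σ : Type*} [Fintype α] [Fintype σ] (T : α → ℝ) (Bx : Matrix α σ ℤ)
    (a : σ → ℤ) : (tauRow T Bx).mulVec (iv a) = fun _ => T ⬝ᵥ iv (Bx.mulVec a) := by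
  ext u
  rw [iv_mulVec, Matrix.dotProduct_mulVec]
  simp [tauRow, Matrix.mulVec, Matrix.vecMul, dotProduct]

lemma wv_vecMulVec {α ν τ : Type*} [Fintype α] [Fintype ν] (A : Matrix τ α ℝ) (t : τ → ℝ)
    (T : α → ℝ) (A₁ : Matrix τ ν ℝ) (x : α → ℤ) (y : ν → ℤ) :
    wv (A + Matrix.vecMulVec t T) A₁ x y = wv A A₁ x y + (T ⬝ᵥ iv x) • t := by
  simp only [wv, Matrix.add_mulVec, Matrix.vecMulVec_mulVec]
  ext i; simp; ring

/-- The first coordinates of an integer vector. -/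
def fstv {κ : Type*} (x : κ ⊕ Unit → ℤ) : κ → ℝ := fun i => iv x (Sum.inl i)

lemma submatrix_inl_mulVec {κ σ : Type*} [Fintype σ] (Bx : Matrix (κ ⊕ Unit) σ ℤ) (a : σ → ℤ) :
    ((rc Bx).submatrix Sum.inl id).mulVec (iv a) = fstv (Bx.mulVec a) := by
  ext i
  rw [fstv, iv_mulVec]
  rfl

lemma fstv_norm_le {κ : Type*} [Fintype κ] (x : κ ⊕ Unit → ℤ) : ‖fstv x‖ ≤ ‖iv x‖ := by
  rw [pi_norm_le_iff_of_nonneg (norm_nonneg _)]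
  exact fun i => norm_le_pi_norm (iv x) (Sum.inl i)

lemma norm_iv_le {κ : Type*} [Fintype κ] (x : κ ⊕ Unit → ℤ) {R : ℝ} (hR : 0 ≤ R)
    (h1 : ‖fstv x‖ ≤ R) (h2 : |iv x (Sum.inr ())| ≤ R) : ‖iv x‖ ≤ R := by
  rw [pi_norm_le_iff_of_nonneg hR] at *
  rintro (i | i)
  · exact h1 i
  · exact h2

lemma dotProduct_abs_le {α : Type*} [Fintype α] (T v : α → ℝ) {C : ℝ} (hT : ∀ i, |T i| ≤ C) :
    |T ⬝ᵥ v| ≤ Fintype.card α * C * ‖v‖ := by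
  have := mulVec_abs_le (fun (_ : Unit) i => T i : Matrix Unit α ℝ) (fun _ j => hT j) v ()
  simpa [Matrix.mulVec] using this

lemma norm_fromRows_le {κ ν σ : Type*} [Fintype κ] [Fintype ν] [Fintype σ]
    (P : Matrix κ σ ℝ) (F : Matrix ν σ ℝ) (v : σ → ℝ) :
    ‖(P.fromRows F).mulVec v‖ ≤ max ‖P.mulVec v‖ ‖F.mulVec v‖ :=
  fromRows_mulVec_norm_le P F v ((norm_nonneg _).trans (le_max_left _ _)) (le_max_left _ _)
    (le_max_right _ _)

lemma dot_split {κ : Type*} [Fintype κ] (T : κ ⊕ Unit → ℝ) (x : κ ⊕ Unit → ℤ) :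
    T ⬝ᵥ iv x = (fun i => T (Sum.inl i)) ⬝ᵥ fstv x + T (Sum.inr ()) * iv x (Sum.inr ()) := by
  simp [dotProduct, Fintype.sum_sum_type, fstv]

set_option maxHeartbeats 2000000 in
/-- The phase in which one extra real functional is deformed together with `Ξ`. -/
lemma exists_extra_phase (κ ν : Type) [Fintype κ] [DecidableEq κ] [Nonempty κ]
    [Fintype ν] [DecidableEq ν] [Nonempty ν] {ρ₀ : ℝ} (hρ₀ : 0 < ρ₀) :
    ∃ ρ₁ : ℝ, 0 < ρ₁ ∧ ρ₁ ≤ 1 ∧ ∃ K : ℝ, 1 ≤ K ∧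
      ∀ (τ : Type) [Fintype τ] (Ξ : Matrix ν (κ ⊕ Unit) ℝ)
        (A : Matrix τ (κ ⊕ Unit) ℝ) (A₁ : Matrix τ ν ℝ) (Bx : Matrix (κ ⊕ Unit) (κ ⊕ (ν ⊕ Unit)) ℤ)
        (By : Matrix ν (κ ⊕ (ν ⊕ Unit)) ℤ) (P L Y D T₀ η : ℝ) (t : τ → ℝ) (j₀ : τ),
        1 ≤ P → 0 < L → P ≤ Y → 0 < D →
        P ^ (Fintype.card κ + 1) * L ^ Fintype.card ν =
          |(((rc Bx).fromRows (rem Ξ Bx By)).submatrix id (eW κ ν)).det| →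
        Nice (rc Bx) (rem Ξ Bx By) ρ₀ P L →
        IsGen A A₁ Bx By →
        (∀ i j, |A₁ i j| ≤ 1) →
        (∀ i, |t i| ≤ 1) → t j₀ = 1 →
        L / P * Y ≤ T₀ → L ≤ T₀ → D * L ≤ 1 →
        (∀ x y i, wv A A₁ x y ≠ iv i → 1 / D ≤ ‖wv A A₁ x y - iv i‖) →
        (∀ x y i, (∃ j : ℤ, wv A A₁ x y - iv i = ((j : ℝ) * T₀) • t) ∨
          ∀ c : ℝ, η ≤ ‖wv A A₁ x y - iv i + c • t‖) →
        (∀ X l : ℝ, P ≤ X → X ≤ Y → 0 < l → X ^ Fintype.card κ * l ^ (Fintype.card ν + 1) =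
            P ^ Fintype.card κ * L ^ (Fintype.card ν + 1) → 1 ≤ D * (L / P) * X → l ≤ η) →
        ∃ (Ξ' : Matrix ν (κ ⊕ Unit) ℝ) (T : κ ⊕ Unit → ℝ),
          (∀ i j, |(Ξ' - Ξ) i j| ≤ 2 * (L / P)) ∧ T (Sum.inr ()) = L / P ∧
          (∀ i, |T i| ≤ 2 * (L / P)) ∧
          |(((rc Bx).submatrix Sum.inl id).fromRows
            ((rem Ξ' Bx By).fromRows (tauRow T Bx))).det| =
              P ^ Fintype.card κ * L ^ (Fintype.card ν + 1) ∧
          ∀ X l : ℝ, P ≤ X → X ≤ Y → 0 < l →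
            X ^ Fintype.card κ * l ^ (Fintype.card ν + 1) =
              P ^ Fintype.card κ * L ^ (Fintype.card ν + 1) →
            Nice ((rc Bx).submatrix Sum.inl id) ((rem Ξ' Bx By).fromRows (tauRow T Bx)) ρ₁ X l ∧
            Est Ξ' (A + Matrix.vecMulVec t T + A₁ * Ξ') X l K := by
  obtain ⟨ρs, -, -, h3⟩ := exists_shear_phase_equiv κ (ν ⊕ Unit)
  obtain ⟨R₀, hR₀, ρ₁, hρ₁, h4⟩ := h3 ρ₀ hρ₀
  set c : ℝ := ((Fintype.card κ : ℕ) : ℝ) with hc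
  have hc0 : 0 ≤ c := by positivity
  have hcard : ((Fintype.card (κ ⊕ Unit) : ℕ) : ℝ) = c + 1 := by simp [hc]
  set K : ℝ := 2 + 1 / ρ₁ + 8 * (c + 1) with hK
  have h1ρ : 0 < 1 / ρ₁ := by positivity
  have hK1 : 1 ≤ K := by linarith
  have hK0 : 0 < K := by linarith
  have hKρ₁ : 1 / K ≤ ρ₁ := by
    rw [div_le_iff₀ (by linarith)]
    have : ρ₁ * (1 / ρ₁) = 1 := by field_simp
    rw [hK]; nlinarith
  refine ⟨min ρ₁ 1, by positivity, min_le_right _ _, K * (1 + Fintype.card ν), by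
    have : (0:ℝ) ≤ Fintype.card ν := by positivity
    nlinarith, ?_⟩
  intro τ _ Ξ A A₁ Bx By P L Y D T₀ η t j₀ hP hL hPY hD0 hD hN hG hA ht htj hYT hLT hDL hgap hdich hη
  set ε : ℝ := L / P with hε
  have hP0 : 0 < P := by linarith
  have hε0 : 0 < ε := by positivity
  have hεP : ε * P = L := by rw [hε]; field_simp
  have hdet0 : P ^ Fintype.card κ * L ^ Fintype.card (ν ⊕ Unit) =
      |((((rc Bx).submatrix Sum.inl id).fromRows ((rem Ξ Bx By).fromRows
        (ε • (rc Bx).submatrix Sum.inr id))).submatrix id (Equiv.refl _)).det| := by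
    rw [Equiv.coe_refl, Matrix.submatrix_id_id, det_move_row, abs_mul, ← hD, abs_of_pos hε0]
    simp only [Fintype.card_sum, Fintype.card_unit]
    rw [← hεP]; ring
  have hxr : ∀ a : κ ⊕ (ν ⊕ Unit) → ℤ, (ε • (rc Bx).submatrix (Sum.inr : Unit → _) id).mulVec (iv a)
      = fun _ => ε * iv (Bx.mulVec a) (Sum.inr ()) := by
    intro a; ext i; rw [Matrix.smul_mulVec, iv_mulVec]; rfl
  have hN0 : Nice ((rc Bx).submatrix Sum.inl id) ((rem Ξ Bx By).fromRows
        (ε • (rc Bx).submatrix (Sum.inr : Unit → _) id)) ρ₀ P L := by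
    intro a ha
    have h5 := norm_le_fromRows_mulVec (rem Ξ Bx By)
      (ε • (rc Bx).submatrix (Sum.inr : Unit → _) id) (iv a)
    rcases hN a ha with h | h
    · by_contra! hcon
      obtain ⟨h6, h7⟩ := hcon
      rw [submatrix_inl_mulVec] at h6
      have h8 := h5.2.trans_lt h7
      rw [hxr, pi_norm_const, Real.norm_eq_abs, abs_mul, abs_of_pos hε0, ← hεP] at h8
      have h9 : |iv (Bx.mulVec a) (Sum.inr ())| < ρ₀ * P := by
        by_contra! h10; nlinarith
      rw [← iv_mulVec] at h
      have := norm_iv_le (Bx.mulVec a) (R := max ‖fstv (Bx.mulVec a)‖ |iv (Bx.mulVec a) (Sum.inr ())|)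
        ((norm_nonneg _).trans (le_max_left _ _)) (le_max_left _ _) (le_max_right _ _)
      have := this.trans_lt (max_lt h6 h9)
      linarith
    · exact Or.inr (h.trans h5.1)
  obtain ⟨Δ, hΔ1, hΔ2, -⟩ := h4 _ (Equiv.refl _) _ _ P L Y hP0 hL hPY hdet0 hN0
  set Δν : Matrix ν (κ ⊕ Unit) ℝ := fun j i => Sum.elim (fun i => Δ (Sum.inl j) i) (fun _ => 0) i with hΔν
  set T : κ ⊕ Unit → ℝ := Sum.elim (fun i => Δ (Sum.inr ()) i) (fun _ => ε) with hT
  have hFrows : ((rem Ξ Bx By).fromRows (ε • (rc Bx).submatrix (Sum.inr : Unit → _) id)) +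
      Δ * (rc Bx).submatrix Sum.inl id = (rem (Ξ + Δν) Bx By).fromRows (tauRow T Bx) := by
    rw [rem_add]
    ext (i | i) j
    · have h5 : (Δν * rc Bx) i j = ∑ k, Δ (Sum.inl i) k * (Bx (Sum.inl k) j : ℝ) := by
        rw [Matrix.mul_apply, Fintype.sum_sum_type]; simp [hΔν]
      simp [h5, Matrix.mul_apply]
    · simp [Matrix.mul_apply, Fintype.sum_sum_type, tauRow, dotProduct, hT, add_comm]
  have hdet1 := det_shear_equiv (Equiv.refl _) ((rc Bx).submatrix Sum.inl id)
    ((rem Ξ Bx By).fromRows (ε • (rc Bx).submatrix (Sum.inr : Unit → _) id)) Δ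
  rw [hFrows] at hΔ2 hdet1
  have hTb : ∀ i, |T i| ≤ 2 * ε := by
    rintro (i | i)
    · exact hΔ1 (Sum.inr ()) i
    · simp only [hT, Sum.elim_inr]; rw [abs_of_pos hε0]; linarith
  have hTx : ∀ x : κ ⊕ Unit → ℤ, |T ⬝ᵥ iv x| ≤ (c + 1) * (2 * ε) * ‖iv x‖ := by
    intro x; have := dotProduct_abs_le T (iv x) hTb; rwa [hcard] at this
  simp only [Fintype.card_sum, Fintype.card_unit] at hΔ2 hdet0
  refine ⟨Ξ + Δν, T, ?_, rfl, hTb, ?_, fun X l hX hXY hl hXl => ⟨?_, ?_⟩⟩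
  · intro i j
    rw [add_sub_cancel_left]
    rcases j with j | j
    · exact hΔ1 (Sum.inl i) j
    · simp only [hΔν, Sum.elim_inr, abs_zero]; positivity
  · rw [hdet0, ← hdet1]; rfl
  · have hX0 : 0 < X := by linarith
    refine (hΔ2 X l hX hXY hl hXl).mono ?_ ?_ <;> gcongr <;> exact min_le_left _ _
  have hX0 : 0 < X := by linarith
  have hlL : l ≤ L := root_anti (Nat.succ_ne_zero _) hP0 hX hL rfl hXl
  have hεX : ε * X ≤ T₀ := le_trans (by gcongr) hYT
  have hlX : l ≤ ε * X := hlL.trans (by rw [← hεP]; gcongr)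
  refine est_of_split (by linarith) hl hK1 hA ?_ ?_
  · intro x hx y i hxX hly hwi
    rw [wv_vecMulVec] at hwi
    set s := T ⬝ᵥ iv x with hs
    have hsX : |s| ≤ ε * X / 4 := by
      refine (hTx x).trans ?_
      have : (c + 1) * (2 * ε) * ‖iv x‖ ≤ (c + 1) * (2 * ε) * (X / K) := by gcongr
      refine this.trans ?_
      have h8 : 8 * (c + 1) / K ≤ 1 := by rw [div_le_one hK0]; linarith
      calc _ = ε * X / 4 * (8 * (c + 1) / K) := by ring
        _ ≤ ε * X / 4 * 1 := by gcongr
        _ = _ := mul_one _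
    have hlK : l / K ≤ l / 2 := by gcongr; linarith
    rcases hdich x y i with ⟨j, hj⟩ | hfar
    · have h5 : wv A A₁ x y + s • t - iv i = ((j : ℝ) * T₀ + s) • t := by
        rw [add_smul, ← hj]; abel
      rw [h5] at hwi
      have h6 : |(j : ℝ) * T₀ + s| < l / K := by
        refine lt_of_le_of_lt ?_ hwi
        have := norm_le_pi_norm (((j : ℝ) * T₀ + s) • t) j₀
        simpa [htj] using this
      have hj0 : j = 0 := by
        by_contra hj0
        have h7 : (1:ℝ) ≤ |(j:ℝ)| := by exact_mod_cast Int.one_le_abs hj0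
        have h8 : |(j : ℝ) * T₀| ≤ |(j : ℝ) * T₀ + s| + |s| := by
          have := abs_sub ((j : ℝ) * T₀ + s) s
          rwa [add_sub_cancel_right] at this
        have hT₀ : 0 < T₀ := by linarith
        rw [abs_mul, abs_of_pos hT₀] at h8
        nlinarith
      subst hj0
      simp only [Int.cast_zero, zero_mul, zero_smul, sub_eq_zero, zero_add] at hj h6
      obtain ⟨a, rfl, rfl⟩ := hG.2 x y i hj
      have ha : a ≠ 0 := by rintro rfl; exact hx (Matrix.mulVec_zero _)
      rcases hΔ2 X l hX hXY hl hXl a ha with h | h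
      · rw [submatrix_inl_mulVec] at h
        have : X / K ≤ ρ₁ * X := by rw [← one_div_mul_eq_div]; gcongr
        have := fstv_norm_le (Bx.mulVec a)
        linarith
      · have h7 := h.trans (norm_fromRows_le _ _ _)
        rw [rem_mulVec, tauRow_mulVec, pi_norm_const, Real.norm_eq_abs, ← hs] at h7
        have : l / K ≤ ρ₁ * l := by rw [← one_div_mul_eq_div]; gcongr
        have := h7.trans_lt (max_lt hly h6)
        linarith
    · have h5 := hfar s
      rw [← sub_add_eq_add_sub] at hwi
      by_cases h6 : 1 ≤ D * ε * X
      · have := hη X l hX hXY hl hXl h6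
        linarith
      · push Not at h6
        by_cases hne : wv A A₁ x y = iv i
        · rw [hne, sub_self, zero_add] at hwi
          have h7 : |s| < l / K := by
            refine lt_of_le_of_lt ?_ hwi
            have := norm_le_pi_norm (s • t) j₀
            simpa [htj] using this
          obtain ⟨a, rfl, rfl⟩ := hG.2 x y i hne
          have ha : a ≠ 0 := by rintro rfl; exact hx (Matrix.mulVec_zero _)
          rcases hΔ2 X l hX hXY hl hXl a ha with h | h
          · rw [submatrix_inl_mulVec] at h
            have : X / K ≤ ρ₁ * X := by rw [← one_div_mul_eq_div]; gcongr
            have := fstv_norm_le (Bx.mulVec a)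
            linarith
          · have h7 := h.trans (norm_fromRows_le _ _ _)
            rw [rem_mulVec, tauRow_mulVec, pi_norm_const, Real.norm_eq_abs, ← hs] at h7
            have : l / K ≤ ρ₁ * l := by rw [← one_div_mul_eq_div]; gcongr
            have := h7.trans_lt (max_lt hly (by assumption))
            linarith
        have h7 := hgap x y i hne
        have h8 : ‖s • t‖ ≤ |s| := by
          rw [norm_smul, Real.norm_eq_abs]
          refine mul_le_of_le_one_right (abs_nonneg _) ?_
          rw [pi_norm_le_iff_of_nonneg zero_le_one]; exact ht
        have h9 : ‖wv A A₁ x y - iv i‖ ≤ ‖wv A A₁ x y - iv i + s • t‖ + ‖s • t‖ := by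
          have := norm_sub_le (wv A A₁ x y - iv i + s • t) (s • t)
          rwa [add_sub_cancel_right] at this
        have h10 : 1 / D < l / 2 + ε * X / 4 := by linarith
        rw [div_lt_iff₀ hD0] at h10
        nlinarith
  · obtain ⟨a, ha, h5, h6⟩ := exists_short_equiv (Equiv.refl _) ((rc Bx).submatrix Sum.inl id)
      ((rem (Ξ + Δν) Bx By).fromRows (tauRow T Bx)) hX0 hl (by
        rw [hdet1, ← hdet0]; simpa using hXl)
    have h7 := norm_le_fromRows_mulVec (rem (Ξ + Δν) Bx By) (tauRow T Bx) (iv a)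
    have h8 := h7.1.trans h6
    have h9 := h7.2.trans h6
    rw [rem_mulVec] at h8
    rw [tauRow_mulVec, pi_norm_const, Real.norm_eq_abs] at h9
    rw [submatrix_inl_mulVec] at h5
    obtain ⟨i, hi⟩ := hG.1 a
    have h2K : 2 ≤ K := by linarith
    refine ⟨Bx.mulVec a, By.mulVec a, i, fun hx hy => ?_, ?_, h8.trans (by gcongr), ?_⟩
    · have h7 : (rc Bx).mulVec (iv a) = 0 := by rw [← iv_mulVec, hx]; ext; simp [iv]
      have h8 : (rem Ξ Bx By).mulVec (iv a) = 0 := by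
        rw [rem_mulVec, hx, hy]
        have : ∀ ι : Type _, iv (0 : ι → ℤ) = 0 := fun ι => by ext; simp [iv]
        rw [lv, this, Matrix.mulVec_zero]; ext; simp [iv]
      rcases hN a ha with h | h
      · rw [h7, norm_zero] at h; nlinarith [mul_pos hρ₀ hP0]
      · rw [h8, norm_zero] at h; nlinarith [mul_pos hρ₀ hL]
    · refine norm_iv_le _ (by positivity) (h5.trans (by gcongr)) ?_
      rw [dot_split] at h9
      have h10 := dotProduct_abs_le (fun i => T (Sum.inl i)) (fstv (Bx.mulVec a)) (fun i => hTb _)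
      have h11 : (Fintype.card κ : ℝ) * (2 * ε) * ‖fstv (Bx.mulVec a)‖ ≤ c * (2 * ε) * (2 * X) := by
        gcongr
      have h12 : T (Sum.inr ()) = ε := rfl
      rw [h12] at h9
      set p := (fun i => T (Sum.inl i)) ⬝ᵥ fstv (Bx.mulVec a) with hp
      set z := iv (Bx.mulVec a) (Sum.inr ()) with hz
      have h13 : |ε * z| ≤ |p + ε * z| + |p| := by
        have := abs_sub (p + ε * z) p
        rwa [add_sub_cancel_left] at this
      rw [abs_mul, abs_of_pos hε0] at h13
      have h14 : ε * |z| ≤ ε * ((2 + 4 * c) * X) := by nlinarith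
      refine (le_of_mul_le_mul_left h14 hε0).trans ?_
      gcongr
      rw [hK]; linarith
    · rw [wv_vecMulVec, hi, add_sub_cancel_left, norm_smul, Real.norm_eq_abs]
      have h10 : ‖t‖ ≤ 1 := by rw [pi_norm_le_iff_of_nonneg zero_le_one]; exact ht
      calc _ ≤ 2 * l * 1 := mul_le_mul h9 h10 (norm_nonneg _) (by positivity)
        _ ≤ K * l := by rw [mul_one]; gcongr

lemma rc_mul {ι σ : Type*} [Fintype σ] (M : Matrix ι σ ℤ) (B : Matrix σ σ ℤ) :
    rc (M * B) = rc M * rc B := by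
  ext i j; simp [Matrix.mul_apply]

lemma rem_mul {α ν σ : Type*} [Fintype α] [Fintype σ] (Ξ : Matrix ν α ℝ) (Bx : Matrix α σ ℤ)
    (By : Matrix ν σ ℤ) (B : Matrix σ σ ℤ) : rem Ξ (Bx * B) (By * B) = rem Ξ Bx By * rc B := by
  rw [rem, rc_mul, rc_mul, rem, Matrix.sub_mul, Matrix.mul_assoc]

lemma exists_mulVec_eq {σ : Type*} [Fintype σ] [DecidableEq σ] {B : Matrix σ σ ℤ}
    (hB : |B.det| = 1) (a : σ → ℤ) : ∃ b : σ → ℤ, a = B.mulVec b := by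
  have hu : IsUnit B.det := Int.isUnit_iff_abs_eq.mpr hB
  exact ⟨B⁻¹.mulVec a, by rw [Matrix.mulVec_mulVec, Matrix.mul_nonsing_inv _ hu, Matrix.one_mulVec]⟩

lemma mulVec_ne_zero_of_det {σ : Type*} [Fintype σ] [DecidableEq σ] {B : Matrix σ σ ℤ}
    (hB : |B.det| = 1) {a : σ → ℤ} (ha : a ≠ 0) : B.mulVec a ≠ 0 := by
  have hu : IsUnit B.det := Int.isUnit_iff_abs_eq.mpr hB
  intro h
  have := congrArg (B⁻¹.mulVec) h
  rw [Matrix.mulVec_mulVec, Matrix.nonsing_inv_mul _ hu, Matrix.one_mulVec, Matrix.mulVec_zero] at this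
  exact ha this

lemma IsGen.mul {α ν τ σ : Type*} [Fintype α] [Fintype ν] [Fintype σ] [DecidableEq σ]
    {A : Matrix τ α ℝ} {A₁ : Matrix τ ν ℝ} {Bx : Matrix α σ ℤ} {By : Matrix ν σ ℤ}
    (h : IsGen A A₁ Bx By) {B : Matrix σ σ ℤ} (hB : |B.det| = 1) :
    IsGen A A₁ (Bx * B) (By * B) := by
  refine ⟨fun a => ?_, fun x y i hi => ?_⟩
  · rw [← Matrix.mulVec_mulVec, ← Matrix.mulVec_mulVec]; exact h.1 _
  · obtain ⟨a, h1, h2⟩ := h.2 x y i hi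
    obtain ⟨b, rfl⟩ := exists_mulVec_eq hB a
    exact ⟨b, by rw [h1, Matrix.mulVec_mulVec], by rw [h2, Matrix.mulVec_mulVec]⟩

/-- The functional `c (T x + a₀ (Ξ x - y) + ζ x_I)`. -/
def hv {κ ν : Type*} [Fintype κ] [Fintype ν] (c : ℝ) (T : κ ⊕ Unit → ℝ) (a₀ : ν → ℝ) (ζ : κ → ℝ)
    (Ξ : Matrix ν (κ ⊕ Unit) ℝ) (x : κ ⊕ Unit → ℤ) (y : ν → ℤ) : ℝ :=
  c * (T ⬝ᵥ iv x + a₀ ⬝ᵥ lv Ξ x y + ζ ⬝ᵥ fstv x)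

lemma hv_add {κ ν : Type*} [Fintype κ] [Fintype ν] (c : ℝ) (T : κ ⊕ Unit → ℝ) (a₀ : ν → ℝ)
    (ζ : κ → ℝ) (Ξ : Matrix ν (κ ⊕ Unit) ℝ) (x x' : κ ⊕ Unit → ℤ) (y y' : ν → ℤ) :
    hv c T a₀ ζ Ξ (x + x') (y + y') = hv c T a₀ ζ Ξ x y + hv c T a₀ ζ Ξ x' y' := by
  have : fstv (x + x') = fstv x + fstv x' := by ext; simp [fstv, iv]
  simp only [hv, lv_add, iv_add, this, dotProduct_add]; ring

lemma hv_smul {κ ν : Type*} [Fintype κ] [Fintype ν] (c : ℝ) (T : κ ⊕ Unit → ℝ) (a₀ : ν → ℝ)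
    (ζ : κ → ℝ) (Ξ : Matrix ν (κ ⊕ Unit) ℝ) (k : ℤ) (x : κ ⊕ Unit → ℤ) (y : ν → ℤ) :
    hv c T a₀ ζ Ξ (k • x) (k • y) = k * hv c T a₀ ζ Ξ x y := by
  have : fstv (k • x) = (k : ℝ) • fstv x := by ext; simp [fstv, iv]
  simp only [hv, lv_smul, iv_smul, this, dotProduct_smul, smul_eq_mul]; ring

/-- The matrix of the lattice in the coordinates `(x_I, Ξ x - y, T x)`. -/
def eMat {κ ν σ : Type*} [Fintype κ] (T : κ ⊕ Unit → ℝ) (Ξ : Matrix ν (κ ⊕ Unit) ℝ)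
    (Bx : Matrix (κ ⊕ Unit) σ ℤ) (By : Matrix ν σ ℤ) : Matrix (κ ⊕ (ν ⊕ Unit)) σ ℝ :=
  ((rc Bx).submatrix Sum.inl id).fromRows ((rem Ξ Bx By).fromRows (tauRow T Bx))

lemma eMat_mul {κ ν σ : Type*} [Fintype κ] [Fintype σ] (T : κ ⊕ Unit → ℝ)
    (Ξ : Matrix ν (κ ⊕ Unit) ℝ)
    (Bx : Matrix (κ ⊕ Unit) σ ℤ) (By : Matrix ν σ ℤ) (B : Matrix σ σ ℤ) :
    eMat T Ξ (Bx * B) (By * B) = eMat T Ξ Bx By * rc B := by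
  have h1 : (rc (Bx * B)).submatrix (Sum.inl : κ → κ ⊕ Unit) id =
      ((rc Bx).submatrix Sum.inl id) * rc B := by
    rw [rc_mul]; ext i j; simp [Matrix.mul_apply]
  have h2 : tauRow T (Bx * B) = tauRow T Bx * rc B := by
    ext i j
    have : tauRow T (Bx * B) i j = (Matrix.vecMul T (rc (Bx * B))) j := rfl
    rw [this, rc_mul, ← Matrix.vecMul_vecMul]
    rfl
  rw [eMat, h1, h2, rem_mul, eMat, Matrix.fromRows_mul, Matrix.fromRows_mul]

lemma abs_det_rc {σ : Type*} [Fintype σ] [DecidableEq σ] {B : Matrix σ σ ℤ} (hB : |B.det| = 1) :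
    |(rc B).det| = 1 := by
  have : (rc B).det = ((B.det : ℤ) : ℝ) := by
    have := (Int.castRingHom ℝ).map_det B
    simpa using this.symm
  rw [this]; exact_mod_cast hB

lemma exists_functional_basis (κ ν : Type) [Fintype κ] [DecidableEq κ] [Nonempty κ]
    [Fintype ν] [DecidableEq ν] [Nonempty ν] {ρ : ℝ} (hρ : 0 < ρ) :
    ∃ C : ℝ, 1 ≤ C ∧ ∀ (τ : Type) [Fintype τ] (Ξ : Matrix ν (κ ⊕ Unit) ℝ) (T : κ ⊕ Unit → ℝ)
      (A : Matrix τ (κ ⊕ Unit) ℝ) (A₁ : Matrix τ ν ℝ)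
      (Bx : Matrix (κ ⊕ Unit) (κ ⊕ (ν ⊕ Unit)) ℤ) (By : Matrix ν (κ ⊕ (ν ⊕ Unit)) ℤ)
      (X L : ℝ) (d : ν → ℝ), 0 < X → 0 < L →
      |(eMat T Ξ Bx By).det| = X ^ Fintype.card κ * L ^ (Fintype.card ν + 1) →
      Nice ((rc Bx).submatrix Sum.inl id) ((rem Ξ Bx By).fromRows (tauRow T Bx)) ρ X L →
      IsGen A A₁ Bx By → (∀ i, |d i| ≤ 1) →
      ∃ (Bx' : Matrix (κ ⊕ Unit) (κ ⊕ (ν ⊕ Unit)) ℤ) (By' : Matrix ν (κ ⊕ (ν ⊕ Unit)) ℤ)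
        (a₀ : ν → ℝ) (ζ : κ → ℝ) (c : ℝ),
        |(eMat T Ξ Bx' By').det| = X ^ Fintype.card κ * L ^ (Fintype.card ν + 1) ∧
        Nice ((rc Bx').submatrix Sum.inl id) ((rem Ξ Bx' By').fromRows (tauRow T Bx')) ρ X L ∧
        IsGen A A₁ Bx' By' ∧ (∀ i, |a₀ i - d i| ≤ 1 / 4) ∧ (∀ i, |ζ i| ≤ L / X / 4) ∧
        1 / C ≤ c * L ∧ c * L ≤ C ∧
        ∀ a, hv c T a₀ ζ Ξ (Bx'.mulVec a) (By'.mulVec a) = a (Sum.inr (Sum.inr ())) := by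
  obtain ⟨C, hC, h⟩ := exists_functional (κ ⊕ (ν ⊕ Unit)) hρ (show (0:ℝ) < 1 / 4 by norm_num)
  refine ⟨C, hC, fun τ _ Ξ T A A₁ Bx By X L d hX hL hD hN hG hd => ?_⟩
  set G := (X⁻¹ • (rc Bx).submatrix Sum.inl id).fromRows
    (L⁻¹ • (rem Ξ Bx By).fromRows (tauRow T Bx)) with hGdef
  have hGdet : |G.det| = 1 := by
    rw [hGdef, det_fromRows_smul, abs_mul]
    have : |(((rc Bx).submatrix Sum.inl id).fromRows ((rem Ξ Bx By).fromRows (tauRow T Bx))).det| =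
      X ^ Fintype.card κ * L ^ (Fintype.card ν + 1) := hD
    rw [this, abs_of_pos (by positivity)]
    simp only [Fintype.card_sum, Fintype.card_unit, inv_pow]
    field_simp
  have hGN : ∀ a : κ ⊕ (ν ⊕ Unit) → ℤ, a ≠ 0 → ρ ≤ ‖G.mulVec (iv a)‖ := by
    intro a ha
    have h1 := norm_le_fromRows_mulVec (X⁻¹ • (rc Bx).submatrix Sum.inl id)
      (L⁻¹ • (rem Ξ Bx By).fromRows (tauRow T Bx)) (iv a)
    rw [inv_smul_mulVec_norm hX, inv_smul_mulVec_norm hL] at h1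
    rcases hN a ha with h2 | h2
    · refine le_trans ?_ h1.1; rwa [le_div_iff₀ hX]
    · refine le_trans ?_ h1.2; rwa [le_div_iff₀ hL]
  obtain ⟨B, e, c, hB, he1, hed, hc1, hc2, heq⟩ := h G hGdet hGN
    (Sum.elim (fun _ => 0) (Sum.elim d fun _ => 1)) (Sum.inr (Sum.inr ())) (Sum.inr (Sum.inr ()))
    (by rintro (i | i | i) <;> simp [hd]) rfl
  refine ⟨Bx * B, By * B, fun i => e (Sum.inr (Sum.inl i)), fun i => L / X * e (Sum.inl i), c / L,
    ?_, ?_, hG.mul hB, fun i => hed (Sum.inr (Sum.inl i)), fun i => ?_, ?_, ?_, fun a => ?_⟩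
  · rw [eMat_mul, Matrix.det_mul, abs_mul, abs_det_rc hB, hD, mul_one]
  · intro a ha
    have h1 := hN _ (mulVec_ne_zero_of_det hB ha)
    rw [submatrix_inl_mulVec] at h1 ⊢
    have h5 : ∀ a, ((rem Ξ (Bx * B) (By * B)).fromRows (tauRow T (Bx * B))).mulVec (iv a) =
        ((rem Ξ Bx By).fromRows (tauRow T Bx)).mulVec (iv (B.mulVec a)) := by
      intro a
      rw [Matrix.fromRows_mulVec, Matrix.fromRows_mulVec, rem_mulVec, rem_mulVec, tauRow_mulVec,
        tauRow_mulVec]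
      simp only [Matrix.mulVec_mulVec]
    rw [h5]
    rwa [Matrix.mulVec_mulVec] at h1
  · have h1 := hed (Sum.inl i)
    simp only [Sum.elim_inl, sub_zero] at h1
    rw [abs_mul, abs_of_pos (by positivity)]
    calc _ ≤ L / X * (1 / 4) := by gcongr
      _ = _ := by ring
  · rwa [div_mul_cancel₀ _ hL.ne']
  · rwa [div_mul_cancel₀ _ hL.ne']
  · have h1 := congrArg (fun v => v ⬝ᵥ iv a) heq
    simp only [smul_dotProduct, single_dotProduct, smul_eq_mul, one_mul] at h1
    rw [← Matrix.dotProduct_mulVec, ← Matrix.mulVec_mulVec, ← iv_mulVec] at h1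
    have h2 : iv a (Sum.inr (Sum.inr ())) = (a (Sum.inr (Sum.inr ())) : ℝ) := rfl
    rw [← h2, ← h1, hv, ← Matrix.mulVec_mulVec, ← Matrix.mulVec_mulVec]
    set b := B.mulVec a
    have h3 : e ⬝ᵥ G.mulVec (iv b) = X⁻¹ * ((fun i => e (Sum.inl i)) ⬝ᵥ fstv (Bx.mulVec b)) +
        L⁻¹ * ((fun i => e (Sum.inr (Sum.inl i))) ⬝ᵥ lv Ξ (Bx.mulVec b) (By.mulVec b) +
          T ⬝ᵥ iv (Bx.mulVec b)) := by
      rw [hGdef, Matrix.fromRows_mulVec, Matrix.smul_mulVec, Matrix.smul_mulVec,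
        Matrix.fromRows_mulVec, submatrix_inl_mulVec, rem_mulVec, tauRow_mulVec]
      simp only [dotProduct, Fintype.sum_sum_type, Sum.elim_inl, Sum.elim_inr, Pi.smul_apply,
        smul_eq_mul, Finset.univ_unique, Finset.sum_singleton, he1, Finset.mul_sum, mul_add]
      simp only [one_mul]
      refine congrArg₂ _ ?_ (congrArg₂ _ ?_ rfl) <;> refine Finset.sum_congr rfl fun _ _ => ?_ <;> ring
    have h4 : (fun i => L / X * e (Sum.inl i)) ⬝ᵥ fstv (Bx.mulVec b) =
        L / X * ((fun i => e (Sum.inl i)) ⬝ᵥ fstv (Bx.mulVec b)) := by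
      simp only [dotProduct, Finset.mul_sum, mul_assoc]
    rw [h3, h4]
    field_simp
    ring

/-- The inclusion of integer vectors with vanishing last coordinate. -/
def ext0 {κ ν : Type*} (a : κ ⊕ ν → ℤ) : κ ⊕ (ν ⊕ Unit) → ℤ :=
  Sum.elim (fun i => a (Sum.inl i)) (Sum.elim (fun i => a (Sum.inr i)) fun _ => 0)

/-- The columns other than the last one. -/
def colV {ι κ ν R : Type*} (B : Matrix ι (κ ⊕ (ν ⊕ Unit)) R) : Matrix ι (κ ⊕ ν) R :=
  B.submatrix id (Sum.map id Sum.inl)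

lemma colV_mulVec {ι κ ν : Type*} [Fintype κ] [Fintype ν] (B : Matrix ι (κ ⊕ (ν ⊕ Unit)) ℤ)
    (a : κ ⊕ ν → ℤ) : (colV B).mulVec a = B.mulVec (ext0 a) := by
  ext i
  simp [Matrix.mulVec, dotProduct, Fintype.sum_sum_type, colV, ext0]

lemma updateCol_mulVec_last {ι κ ν : Type*} [Fintype κ] [Fintype ν] [DecidableEq κ]
    [DecidableEq ν] (B : Matrix ι (κ ⊕ (ν ⊕ Unit)) ℤ) (z : ι → ℤ) (a : κ ⊕ ν → ℤ) (k : ℤ) :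
    (B.updateCol (Sum.inr (Sum.inr ())) z).mulVec
      (ext0 a + k • Pi.single (Sum.inr (Sum.inr ())) 1) = B.mulVec (ext0 a) + k • z := by
  ext i
  simp [Matrix.mulVec, dotProduct, Fintype.sum_sum_type, ext0, mul_comm, add_assoc]

lemma mulVec_add_single {ι κ ν : Type*} [Fintype κ] [Fintype ν] [DecidableEq κ]
    [DecidableEq ν] (B : Matrix ι (κ ⊕ (ν ⊕ Unit)) ℤ) (a : κ ⊕ (ν ⊕ Unit) → ℤ) (k : ℤ) :
    B.mulVec (a + k • Pi.single (Sum.inr (Sum.inr ())) 1) =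
      B.mulVec a + k • B.mulVec (Pi.single (Sum.inr (Sum.inr ())) 1) := by
  rw [Matrix.mulVec_add, Matrix.mulVec_smul]

lemma exists_ext0 {κ ν : Type*} [DecidableEq κ] [DecidableEq ν] (a : κ ⊕ (ν ⊕ Unit) → ℤ) :
    ∃ b : κ ⊕ ν → ℤ, a = ext0 b + a (Sum.inr (Sum.inr ())) • Pi.single (Sum.inr (Sum.inr ())) 1 := by
  refine ⟨fun i => a (Sum.map id Sum.inl i), ?_⟩
  ext (i | i | i) <;> simp [ext0]

lemma colV_updateCol {ι κ ν : Type*} [DecidableEq κ] [DecidableEq ν]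
    (B : Matrix ι (κ ⊕ (ν ⊕ Unit)) ℤ) (z : ι → ℤ) :
    colV (B.updateCol (Sum.inr (Sum.inr ())) z) = colV B := by
  ext i (j | j) <;> simp [colV]

/-- Passing from the lattice `B` to the kernel of the integer functional `h` together with the new
vector `z = u₀ - N e`. -/
lemma kernel_lattice {κ ν τ : Type*} [Fintype κ] [Fintype ν] [Fintype τ] [DecidableEq κ]
    [DecidableEq ν] {A A' : Matrix τ (κ ⊕ Unit) ℝ} {A₁ A₁' : Matrix τ ν ℝ}
    {Bx : Matrix (κ ⊕ Unit) (κ ⊕ (ν ⊕ Unit)) ℤ} {By : Matrix ν (κ ⊕ (ν ⊕ Unit)) ℤ}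
    {c : ℝ} {T : κ ⊕ Unit → ℝ} {a₀ : ν → ℝ} {ζ : κ → ℝ} {Ξ : Matrix ν (κ ⊕ Unit) ℝ}
    {T₀ η ε' : ℝ} {t : τ → ℝ} {j₀ : τ} {x₀ : κ ⊕ Unit → ℤ} {y₀ : ν → ℤ} {i₀ : τ → ℤ} {N : ℤ}
    (hG : IsGen A A₁ Bx By)
    (hh : ∀ a, hv c T a₀ ζ Ξ (Bx.mulVec a) (By.mulVec a) = a (Sum.inr (Sum.inr ())))
    (ht : t j₀ = 1) (hu : wv A A₁ x₀ y₀ - iv i₀ = T₀ • t) (hε : 0 < ε')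
    (hdich : ∀ x y i, (∃ j : ℤ, wv A A₁ x y - iv i = ((j : ℝ) * T₀) • t) ∨
          ∀ c : ℝ, η ≤ ‖wv A A₁ x y - iv i + c • t‖)
    (hN : ε' * (hv c T a₀ ζ Ξ x₀ y₀ - N) = -T₀)
    (hw : ∀ x y, wv A' A₁' x y = wv A A₁ x y + (ε' * hv c T a₀ ζ Ξ x y) • t)
    {zx : κ ⊕ Unit → ℤ} {zy : ν → ℤ}
    (hzx : zx = x₀ + (-N) • Bx.mulVec (Pi.single (Sum.inr (Sum.inr ())) 1))
    (hzy : zy = y₀ + (-N) • By.mulVec (Pi.single (Sum.inr (Sum.inr ())) 1)) :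
    (∀ a : κ ⊕ (ν ⊕ Unit) → ℤ, ∃ i : τ → ℤ,
      wv A' A₁' ((Bx.updateCol (Sum.inr (Sum.inr ())) zx).mulVec a)
        ((By.updateCol (Sum.inr (Sum.inr ())) zy).mulVec a) = iv i) ∧
    ∀ x y i, ((∃ a, x = (Bx.updateCol (Sum.inr (Sum.inr ())) zx).mulVec a ∧
        y = (By.updateCol (Sum.inr (Sum.inr ())) zy).mulVec a) ∧ wv A' A₁' x y = iv i) ∨
      ε' ≤ ‖wv A' A₁' x y - iv i‖ ∨ η ≤ ‖wv A' A₁' x y - iv i‖ := by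
  have hez : hv c T a₀ ζ Ξ zx zy = hv c T a₀ ζ Ξ x₀ y₀ - N := by
    rw [hzx, hzy, hv_add, hv_smul, hh]; push_cast; simp; ring
  obtain ⟨ie, hie⟩ := hG.1 (Pi.single (Sum.inr (Sum.inr ())) 1)
  have hwz : wv A' A₁' zx zy = iv (i₀ + (-N) • ie) := by
    rw [hw, hez, hN, hzx, hzy, wv_add, wv_smul, hie, iv_add, iv_smul,
      show wv A A₁ x₀ y₀ = T₀ • t + iv i₀ by rw [← hu]; abel, neg_smul]
    abel
  have hw0 : ∀ a : κ ⊕ ν → ℤ, wv A' A₁' (Bx.mulVec (ext0 a)) (By.mulVec (ext0 a)) =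
      wv A A₁ (Bx.mulVec (ext0 a)) (By.mulVec (ext0 a)) := by
    intro a
    rw [hw, hh]; simp [ext0]
  constructor
  · intro a
    obtain ⟨b, hb⟩ := exists_ext0 a
    obtain ⟨i, hi⟩ := hG.1 (ext0 b)
    refine ⟨i + a (Sum.inr (Sum.inr ())) • (i₀ + (-N) • ie), ?_⟩
    rw [hb, updateCol_mulVec_last, updateCol_mulVec_last, wv_add, wv_smul, hwz, hw0, hi, iv_add,
      iv_smul, iv_add, iv_smul, ← hb, iv_add, iv_smul]
  · intro x y i
    rcases hdich x y i with ⟨j, hj⟩ | h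
    · have h1 : wv A A₁ (x + (-j) • x₀) (y + (-j) • y₀) = iv (i + (-j) • i₀) := by
        rw [wv_add, wv_smul, iv_add, iv_smul, show wv A A₁ x₀ y₀ = T₀ • t + iv i₀ by
          rw [← hu]; abel, show wv A A₁ x y = ((j : ℝ) * T₀) • t + iv i by rw [← hj]; abel]
        push_cast
        rw [smul_add, smul_smul, neg_mul, neg_smul]; abel
      obtain ⟨a, ha1, ha2⟩ := hG.2 _ _ _ h1
      have hx : x = Bx.mulVec a + j • x₀ := by rw [← ha1, neg_smul]; abel
      have hy : y = By.mulVec a + j • y₀ := by rw [← ha2, neg_smul]; abel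
      have h2 : wv A' A₁' x y - iv i =
          (ε' * ((a (Sum.inr (Sum.inr ())) + j * N : ℤ) : ℝ)) • t := by
        have e1 : hv c T a₀ ζ Ξ x y = a (Sum.inr (Sum.inr ())) + j * hv c T a₀ ζ Ξ x₀ y₀ := by
          rw [hx, hy, hv_add, hh, hv_smul]
        rw [hw, add_sub_right_comm, hj, ← add_smul, e1]
        congr 1
        push_cast
        linear_combination (j:ℝ) * hN
      by_cases hk : a (Sum.inr (Sum.inr ())) + j * N = 0
      · left
        obtain ⟨b, hb⟩ := exists_ext0 a
        have h3 : wv A' A₁' x y = iv i := by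
          rw [hk] at h2
          rw [← sub_eq_zero, h2]; simp
        have hk' : a (Sum.inr (Sum.inr ())) = j * -N := by linarith
        rw [hk'] at hb
        refine ⟨⟨ext0 b + j • Pi.single (Sum.inr (Sum.inr ())) 1, ?_, ?_⟩, h3⟩
        · rw [updateCol_mulVec_last, hx, hb, mulVec_add_single, hzx, smul_add, smul_smul]
          abel
        · rw [updateCol_mulVec_last, hy, hb, mulVec_add_single, hzy, smul_add, smul_smul]
          abel
      · right; left
        rw [h2]
        have h3 := norm_le_pi_norm
          ((ε' * ((a (Sum.inr (Sum.inr ())) + j * N : ℤ) : ℝ)) • t) j₀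
        refine le_trans ?_ h3
        rw [Pi.smul_apply, ht, smul_eq_mul, mul_one, Real.norm_eq_abs, abs_mul, abs_of_pos hε]
        have h4 : (1:ℝ) ≤ |((a (Sum.inr (Sum.inr ())) + j * N : ℤ) : ℝ)| := by
          exact_mod_cast Int.one_le_abs hk
        nlinarith
    · right; right
      have := h (ε' * hv c T a₀ ζ Ξ x y)
      rwa [hw, add_sub_right_comm]

lemma det_row_combination {κ ν : Type*} [Fintype κ] [DecidableEq κ] [Fintype ν] [DecidableEq ν]
    (P : Matrix κ (κ ⊕ (ν ⊕ Unit)) ℝ) (F : Matrix ν (κ ⊕ (ν ⊕ Unit)) ℝ)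
    (R : Matrix Unit (κ ⊕ (ν ⊕ Unit)) ℝ) (c : ℝ) (u : Matrix Unit ν ℝ) (v : Matrix Unit κ ℝ) :
    (P.fromRows (F.fromRows (c • R + u * F + v * P))).det = c * (P.fromRows (F.fromRows R)).det := by
  have h : P.fromRows (F.fromRows (c • R + u * F + v * P)) =
      Matrix.fromBlocks 1 0 ((0 : Matrix ν κ ℝ).fromRows v)
        (Matrix.fromBlocks 1 0 u (c • (1 : Matrix Unit Unit ℝ))) * P.fromRows (F.fromRows R) := by
    rw [Matrix.fromBlocks_mul_fromRows, Matrix.fromRows_mul, Matrix.fromBlocks_mul_fromRows]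
    ext (i | i | i) j
    · simp
    · simp
    · simp only [Matrix.fromRows_apply_inr, Matrix.add_apply, Matrix.one_mul, Matrix.zero_mul,
        Matrix.smul_mul]
      ring
  rw [h, Matrix.det_mul, Matrix.det_fromBlocks_zero₁₂, Matrix.det_fromBlocks_zero₁₂]
  simp

lemma det_last_row {κ ν : Type*} [Fintype κ] [DecidableEq κ] [Fintype ν] [DecidableEq ν]
    (P : Matrix κ (κ ⊕ (ν ⊕ Unit)) ℝ) (F : Matrix ν (κ ⊕ (ν ⊕ Unit)) ℝ) (s : ℝ)
    (R : Matrix Unit (κ ⊕ (ν ⊕ Unit)) ℝ) 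
    (hR : ∀ i j, R i j = s * (Pi.single (Sum.inr (Sum.inr ())) 1 : κ ⊕ (ν ⊕ Unit) → ℝ) j) :
    (P.fromRows (F.fromRows R)).det = s * ((colV P).fromRows (colV F)).det := by
  rw [← Matrix.det_submatrix_equiv_self (Equiv.sumAssoc κ ν Unit) (P.fromRows (F.fromRows R))]
  have h : (P.fromRows (F.fromRows R)).submatrix (Equiv.sumAssoc κ ν Unit)
      (Equiv.sumAssoc κ ν Unit) =
      Matrix.fromBlocks ((colV P).fromRows (colV F))
        ((P.fromRows (F.fromRows R)).submatrix (Sum.map id Sum.inl) fun _ => Sum.inr (Sum.inr ())) 0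
        (s • (1 : Matrix Unit Unit ℝ)) := by
    ext ((i | i) | i) ((j | j) | j) <;> first | rfl | skip
    · exact (hR i (Sum.inl j)).trans (by simp)
    · exact (hR i (Sum.inr (Sum.inl j))).trans (by simp)
    · exact (hR i (Sum.inr (Sum.inr j))).trans (by simp)
  rw [h, Matrix.det_fromBlocks_zero₂₁]
  simp [mul_comm]

lemma colV_rem {κ ν α : Type*} [Fintype α] (Ξ : Matrix ν α ℝ)
    (Bx : Matrix α (κ ⊕ (ν ⊕ Unit)) ℤ) (By : Matrix ν (κ ⊕ (ν ⊕ Unit)) ℤ) :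
    colV (rem Ξ Bx By) = rem Ξ (colV Bx) (colV By) := by
  ext i j; simp [colV, rem, Matrix.mul_apply]

/-- The matrix of the kernel lattice in the coordinates `(x_I, Ξ x - y)`. -/
def vMat {κ ν : Type*} [Fintype κ] (Ξ : Matrix ν (κ ⊕ Unit) ℝ)
    (Bx : Matrix (κ ⊕ Unit) (κ ⊕ (ν ⊕ Unit)) ℤ) (By : Matrix ν (κ ⊕ (ν ⊕ Unit)) ℤ) :
    Matrix (κ ⊕ ν) (κ ⊕ ν) ℝ :=
  ((rc (colV Bx)).submatrix Sum.inl id).fromRows (rem Ξ (colV Bx) (colV By))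

lemma det_eMat_eq_vMat {κ ν : Type*} [Fintype κ] [DecidableEq κ] [Fintype ν] [DecidableEq ν]
    (T : κ ⊕ Unit → ℝ) (a₀ : ν → ℝ) (ζ : κ → ℝ) (c s : ℝ) (Ξ : Matrix ν (κ ⊕ Unit) ℝ)
    (Bx : Matrix (κ ⊕ Unit) (κ ⊕ (ν ⊕ Unit)) ℤ) (By : Matrix ν (κ ⊕ (ν ⊕ Unit)) ℤ)
    (h : ∀ a, hv c T a₀ ζ Ξ (Bx.mulVec a) (By.mulVec a) = s * a (Sum.inr (Sum.inr ()))) :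
    c * (eMat T Ξ Bx By).det = s * (vMat Ξ Bx By).det := by
  rw [vMat, eMat, ← colV_rem, ← det_row_combination _ _ _ c (Matrix.of fun _ => c • a₀)
    (Matrix.of fun _ => c • ζ)]
  refine det_last_row _ _ s _ ?_
  intro u j
  have h1 := h (Pi.single j 1)
  rw [hv, ← rem_mulVec, ← submatrix_inl_mulVec] at h1
  have hi : iv (Pi.single j 1 : κ ⊕ (ν ⊕ Unit) → ℤ) = Pi.single j 1 := by
    ext k; by_cases hk : k = j
    · subst hk; simp [iv]
    · simp [iv, hk]
  have h2 : T ⬝ᵥ iv (Bx.mulVec (Pi.single j 1)) = tauRow T Bx u j := by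
    have := congrFun (tauRow_mulVec T Bx (Pi.single j 1)) u
    rw [← this, hi, Matrix.mulVec_single_one]; rfl
  rw [h2, hi, Matrix.mulVec_single_one, Matrix.mulVec_single_one] at h1
  have h3 : ((Pi.single j 1 : κ ⊕ (ν ⊕ Unit) → ℤ) (Sum.inr (Sum.inr ())) : ℝ) =
      (Pi.single (Sum.inr (Sum.inr ())) 1 : κ ⊕ (ν ⊕ Unit) → ℝ) j := by
    by_cases hj : j = Sum.inr (Sum.inr ())
    · subst hj; simp
    · rw [Pi.single_eq_of_ne (Ne.symm hj), Pi.single_eq_of_ne hj]; simp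
  rw [h3] at h1
  rw [← h1]
  simp only [Matrix.add_apply, Matrix.smul_apply, Matrix.of_apply, Matrix.mul_apply, dotProduct, Pi.smul_apply, smul_eq_mul, mul_add, Finset.mul_sum,
    mul_assoc]
  rfl

lemma det_eMat_eq_wMat {κ ν : Type*} [Fintype κ] [DecidableEq κ] [Fintype ν] [DecidableEq ν]
    (T : κ ⊕ Unit → ℝ) (Ξ : Matrix ν (κ ⊕ Unit) ℝ)
    (Bx : Matrix (κ ⊕ Unit) (κ ⊕ (ν ⊕ Unit)) ℤ) (By : Matrix ν (κ ⊕ (ν ⊕ Unit)) ℤ) :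
    (eMat T Ξ Bx By).det = T (Sum.inr ()) *
      (((rc Bx).fromRows (rem Ξ Bx By)).submatrix id (eW κ ν)).det := by
  rw [← det_move_row, eMat]
  have h := det_row_combination ((rc Bx).submatrix Sum.inl id) (rem Ξ Bx By)
    (T (Sum.inr ()) • (rc Bx).submatrix Sum.inr id) 1 0
    (Matrix.of fun _ i => T (Sum.inl i))
  rw [one_mul] at h
  rw [← h]
  congr 3
  ext u j
  simp [tauRow, dotProduct, Fintype.sum_sum_type, Matrix.mul_apply, add_comm]

lemma lv_fromCols {κ ν : Type*} [Fintype κ] (Ξ : Matrix ν (κ ⊕ Unit) ℝ) (Δ : Matrix ν κ ℝ)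
    (x : κ ⊕ Unit → ℤ) (y : ν → ℤ) :
    lv (Ξ + Δ.fromCols 0) x y = lv Ξ x y + Δ.mulVec (fstv x) := by
  rw [lv_add_left]
  congr 1
  ext i
  simp [Matrix.mulVec, dotProduct, Fintype.sum_sum_type, fstv]

lemma rem_fromCols {κ ν σ : Type*} [Fintype κ] (Ξ : Matrix ν (κ ⊕ Unit) ℝ) (Δ : Matrix ν κ ℝ)
    (Bx : Matrix (κ ⊕ Unit) σ ℤ) (By : Matrix ν σ ℤ) :
    rem (Ξ + Δ.fromCols 0) Bx By = rem Ξ Bx By + Δ * (rc Bx).submatrix Sum.inl id := by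
  rw [rem_add]
  congr 1
  ext i j
  simp [Matrix.mul_apply, Fintype.sum_sum_type]

lemma hv_abs_le {κ ν : Type*} [Fintype κ] [Fintype ν] {c : ℝ} (hc : 0 ≤ c) (T : κ ⊕ Unit → ℝ)
    {a₀ : ν → ℝ} {ζ : κ → ℝ} {A z : ℝ} (ha : ∀ i, |a₀ i| ≤ A) (hζ : ∀ i, |ζ i| ≤ z)
    (Ξ : Matrix ν (κ ⊕ Unit) ℝ) (x : κ ⊕ Unit → ℤ) (y : ν → ℤ) :
    |hv c T a₀ ζ Ξ x y| ≤ c * (|T ⬝ᵥ iv x| + Fintype.card ν * A * ‖lv Ξ x y‖ +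
      Fintype.card κ * z * ‖fstv x‖) := by
  rw [hv, abs_mul, abs_of_nonneg hc]
  have h1 := dotProduct_abs_le a₀ (lv Ξ x y) ha
  have h2 := dotProduct_abs_le ζ (fstv x) hζ
  gcongr
  refine (abs_add_le _ _).trans (add_le_add ((abs_add_le _ _).trans ?_) h2)
  gcongr

lemma hv_zero_bound {κ ν : Type*} [Fintype κ] [Fintype ν] {c : ℝ} (hc : 0 < c)
    {T : κ ⊕ Unit → ℝ}
    {a₀ : ν → ℝ} {ζ : κ → ℝ} {A z : ℝ} (ha : ∀ i, |a₀ i| ≤ A) (hζ : ∀ i, |ζ i| ≤ z)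
    {Ξ : Matrix ν (κ ⊕ Unit) ℝ} {x : κ ⊕ Unit → ℤ} {y : ν → ℤ} (h : hv c T a₀ ζ Ξ x y = 0) :
    |T ⬝ᵥ iv x| ≤ Fintype.card ν * A * ‖lv Ξ x y‖ + Fintype.card κ * z * ‖fstv x‖ := by
  have h1 := dotProduct_abs_le a₀ (lv Ξ x y) ha
  have h2 := dotProduct_abs_le ζ (fstv x) hζ
  have h3 : T ⬝ᵥ iv x = -(a₀ ⬝ᵥ lv Ξ x y + ζ ⬝ᵥ fstv x) := by
    rcases mul_eq_zero.mp h with h | h <;> linarith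
  rw [h3, abs_neg]
  exact (abs_add_le _ _).trans (add_le_add h1 h2)

lemma root_compare {a b g C : ℝ} {r : ℕ} (hr : r ≠ 0) (ha : 0 < a) (hb : 0 < b) (hC : 1 ≤ C)
    (h : a ^ r = g * b ^ r) (h1 : 1 / C ≤ g) (h2 : g ≤ C) : b / C ≤ a ∧ a ≤ C * b := by
  have hC0 : 0 < C := by linarith
  have hCr : C ≤ C ^ r := le_self_pow₀ hC hr
  constructor
  · refine le_of_pow_le_pow_left₀ hr ha.le ?_
    rw [h, div_pow, div_eq_inv_mul]
    gcongr
    refine le_trans ?_ h1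
    rw [one_div]
    gcongr
  · refine le_of_pow_le_pow_left₀ hr (by positivity) ?_
    rw [h, mul_pow]
    gcongr
    linarith

set_option maxHeartbeats 1000000 in
/-- The shear phase on the kernel lattice of the functional `hv`. -/
lemma exists_kernel_shear (κ ν : Type) [Fintype κ] [DecidableEq κ] [Nonempty κ]
    [Fintype ν] [DecidableEq ν] [Nonempty ν] {ρ₁ C : ℝ} (hρ₁ : 0 < ρ₁) (hC : 1 ≤ C) :
    ∃ ρ₂ : ℝ, 0 < ρ₂ ∧ ∀ (Ξ : Matrix ν (κ ⊕ Unit) ℝ) (T : κ ⊕ Unit → ℝ)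
      (Bx : Matrix (κ ⊕ Unit) (κ ⊕ (ν ⊕ Unit)) ℤ) (By : Matrix ν (κ ⊕ (ν ⊕ Unit)) ℤ)
      (X L S : ℝ) (a₀ : ν → ℝ) (ζ : κ → ℝ) (c : ℝ), 0 < X → 0 < L → X ≤ S →
      |(eMat T Ξ Bx By).det| = X ^ Fintype.card κ * L ^ (Fintype.card ν + 1) →
      Nice ((rc Bx).submatrix Sum.inl id) ((rem Ξ Bx By).fromRows (tauRow T Bx)) ρ₁ X L →
      (∀ i, |a₀ i| ≤ 5 / 4) → (∀ i, |ζ i| ≤ L / X / 4) → 1 / C ≤ c * L → c * L ≤ C →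
      (∀ a, hv c T a₀ ζ Ξ (Bx.mulVec a) (By.mulVec a) = a (Sum.inr (Sum.inr ()))) →
      ∃ (Δ : Matrix ν κ ℝ) (LV : ℝ), 0 < LV ∧ L / C ≤ LV ∧ LV ≤ C * L ∧
        LV ^ Fintype.card ν = c * L * L ^ Fintype.card ν ∧
        |(vMat Ξ Bx By).det| = X ^ Fintype.card κ * LV ^ Fintype.card ν ∧
        (∀ i j, |Δ i j| ≤ 2 * (LV / X)) ∧
        ∀ X' l : ℝ, X ≤ X' → X' ≤ S → 0 < l →
          X' ^ Fintype.card κ * l ^ Fintype.card ν = X ^ Fintype.card κ * LV ^ Fintype.card ν →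
          (∀ a : κ ⊕ ν → ℤ, a ≠ 0 → ρ₂ * X' ≤ ‖fstv (Bx.mulVec (ext0 a))‖ ∨
            ρ₂ * l ≤ ‖lv (Ξ + Δ.fromCols 0) (Bx.mulVec (ext0 a)) (By.mulVec (ext0 a))‖) ∧
          ∃ a : κ ⊕ ν → ℤ, a ≠ 0 ∧ ‖fstv (Bx.mulVec (ext0 a))‖ ≤ 2 * X' ∧
            ‖lv (Ξ + Δ.fromCols 0) (Bx.mulVec (ext0 a)) (By.mulVec (ext0 a))‖ ≤ 2 * l := by
  obtain ⟨ρs, -, -, h3⟩ := exists_shear_phase_equiv κ ν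
  set k : ℝ := ((Fintype.card κ : ℕ) : ℝ) with hk
  set r : ℝ := ((Fintype.card ν : ℕ) : ℝ) with hr
  have hk0 : 0 ≤ k := by positivity
  have hr0 : 0 ≤ r := by positivity
  have hC0 : 0 < C := by linarith
  have hQ : 0 < C * (1 + 2 * r + k) := by positivity
  obtain ⟨R₀, hR₀, ρ₂, hρ₂, h4⟩ := h3 (ρ₁ / (C * (1 + 2 * r + k))) (by positivity)
  refine ⟨ρ₂, hρ₂, fun Ξ T Bx By X L S a₀ ζ c hX hL hXS hD hN ha hζ hc1 hc2 hh => ?_⟩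
  have hcL : 0 < c * L := lt_of_lt_of_le (by positivity) hc1
  have hc : 0 < c := pos_of_mul_pos_left hcL hL.le
  have hdet : |(vMat Ξ Bx By).det| = c * (X ^ Fintype.card κ * L ^ (Fintype.card ν + 1)) := by
    have := det_eMat_eq_vMat T a₀ ζ c 1 Ξ Bx By (by simpa using hh)
    rw [one_mul] at this
    rw [← this, abs_mul, abs_of_pos hc, hD]
  obtain ⟨LV, hLV, hLV2⟩ := exists_root hX (D := |(vMat Ξ Bx By).det|) (by rw [hdet]; positivity)
    (Fintype.card κ) (Fintype.card_ne_zero (α := ν))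
  have hLV3 : LV ^ Fintype.card ν = c * L * L ^ Fintype.card ν := by
    rw [hdet] at hLV2
    have hXp : X ^ Fintype.card κ ≠ 0 := by positivity
    apply mul_left_cancel₀ hXp
    rw [hLV2, pow_succ]; ring
  obtain ⟨hb1, hb2⟩ := root_compare (Fintype.card_ne_zero (α := ν)) hLV hL hC hLV3 hc1 hc2
  have hP : ∀ a : κ ⊕ ν → ℤ, ((rc (colV Bx)).submatrix Sum.inl id).mulVec (iv a) =
      fstv (Bx.mulVec (ext0 a)) := fun a => by rw [submatrix_inl_mulVec, colV_mulVec]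
  have hF : ∀ (Ξ : Matrix ν (κ ⊕ Unit) ℝ) (a : κ ⊕ ν → ℤ),
      (rem Ξ (colV Bx) (colV By)).mulVec (iv a) =
      lv Ξ (Bx.mulVec (ext0 a)) (By.mulVec (ext0 a)) := fun Ξ a => by
    rw [rem_mulVec, colV_mulVec, colV_mulVec]
  have hNV : Nice ((rc (colV Bx)).submatrix Sum.inl id) (rem Ξ (colV Bx) (colV By))
      (ρ₁ / (C * (1 + 2 * r + k))) X LV := by
    intro a ha0
    rw [hP, hF]
    by_contra! hcon
    obtain ⟨c1, c2⟩ := hcon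
    have ha1 : ext0 a ≠ 0 := by
      intro h0
      refine ha0 ?_
      ext i
      rcases i with i | i
      · exact congrFun h0 (Sum.inl i)
      · exact congrFun h0 (Sum.inr (Sum.inl i))
    have hz : hv c T a₀ ζ Ξ (Bx.mulVec (ext0 a)) (By.mulVec (ext0 a)) = 0 := by
      rw [hh]; simp [ext0]
    have hτ := hv_zero_bound hc ha hζ hz
    have c2' : ‖lv Ξ (Bx.mulVec (ext0 a)) (By.mulVec (ext0 a))‖ < ρ₁ / (1 + 2 * r + k) * L := by
      refine c2.trans_le ?_
      calc _ ≤ ρ₁ / (C * (1 + 2 * r + k)) * (C * L) := by gcongr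
        _ = _ := by field_simp
    have c1' : ‖fstv (Bx.mulVec (ext0 a))‖ < ρ₁ / (1 + 2 * r + k) * X := by
      refine c1.trans_le ?_
      gcongr
      nlinarith
    have hw : ρ₁ / (1 + 2 * r + k) ≤ ρ₁ := div_le_self hρ₁.le (by linarith)
    have hτ2 : |T ⬝ᵥ iv (Bx.mulVec (ext0 a))| < ρ₁ * L := by
      set w := ρ₁ / (1 + 2 * r + k) with hwd
      have e1 : w * (1 + 2 * r + k) = ρ₁ := by rw [hwd]; field_simp
      have hw0 : 0 < w := by positivity
      calc _ ≤ _ := hτ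
        _ ≤ r * (5 / 4) * (w * L) + k * (L / X / 4) * (w * X) := by gcongr
        _ = r * (5 / 4) * (w * L) + k * w * L / 4 := by field_simp
        _ < w * (1 + 2 * r + k) * L := by
          have : 0 ≤ r * (w * L) := by positivity
          have : 0 ≤ k * (w * L) := by positivity
          have : 0 < w * L := by positivity
          nlinarith
        _ = ρ₁ * L := by rw [e1]
    rcases hN _ ha1 with h | h
    · rw [submatrix_inl_mulVec] at h
      have : ρ₁ / (1 + 2 * r + k) * X ≤ ρ₁ * X := by gcongr
      linarith
    · have h5 := norm_fromRows_le (rem Ξ Bx By) (tauRow T Bx) (iv (ext0 a))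
      rw [rem_mulVec, tauRow_mulVec] at h5
      have h6 : ‖(fun _ : Unit => T ⬝ᵥ iv (Bx.mulVec (ext0 a)))‖ < ρ₁ * L := by
        rw [pi_norm_lt_iff (by positivity)]
        intro; exact hτ2
      have h7 : ρ₁ / (1 + 2 * r + k) * L ≤ ρ₁ * L := by gcongr
      have := h.trans h5
      rcases le_max_iff.mp this with h | h <;> linarith
  have hdet2 : X ^ Fintype.card κ * LV ^ Fintype.card ν =
      |((((rc (colV Bx)).submatrix Sum.inl id).fromRows
        (rem Ξ (colV Bx) (colV By))).submatrix id (Equiv.refl _)).det| := by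
    rw [hLV2]; rfl
  obtain ⟨Δ, hΔ1, hΔ2, -⟩ := h4 (κ ⊕ ν) (Equiv.refl _) _ _ X LV S hX hLV hXS hdet2 hNV
  refine ⟨Δ, LV, hLV, hb1, hb2, hLV3, hLV2.symm, hΔ1, fun X' l hX' hXS' hl hXl => ⟨?_, ?_⟩⟩
  · intro a ha
    have := hΔ2 X' l hX' hXS' hl hXl a ha
    rwa [← rem_fromCols, hP, hF] at this
  · have hdet3 : X' ^ Fintype.card κ * l ^ Fintype.card ν =
      |((((rc (colV Bx)).submatrix Sum.inl id).fromRows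
        (rem (Ξ + Δ.fromCols 0) (colV Bx) (colV By))).submatrix id (Equiv.refl _)).det| := by
      rw [rem_fromCols, det_shear_equiv, hXl, hdet2]
    obtain ⟨a, h1, h2, h3⟩ := exists_short_equiv _ _ _ (by linarith) hl hdet3
    rw [hP] at h2; rw [hF] at h3
    exact ⟨a, h1, h2, h3⟩

/-- The scalar choice of the integer `N` and of the rescaling `ε'`. -/
lemma exists_rescaling {c C L T₀ : ℝ} (h₀ : ℝ) (hC : 1 ≤ C) (hL : 0 < L) (h1 : 1 / C ≤ c * L)
    (h2 : c * L ≤ C) (h3 : 8 * C * L ≤ T₀) :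
    ∃ (N : ℤ) (ε' : ℝ), 0 < ε' ∧ ε' * (h₀ - N) = -T₀ ∧ |ε' * c - 1| ≤ C * L / T₀ ∧
      L / (2 * C) ≤ ε' ∧ c * T₀ / 2 ≤ |h₀ - N| := by
  have hC0 : 0 < C := by linarith
  have hT : 0 < T₀ := lt_of_lt_of_le (by positivity) h3
  have hcL : 0 < c * L := lt_of_lt_of_le (by positivity) h1
  have hc : 0 < c := pos_of_mul_pos_left hcL hL.le
  have h4 : 8 ≤ c * T₀ := by
    have : 1 ≤ c * L * C := by rwa [div_le_iff₀ hC0] at h1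
    nlinarith
  set N := round (h₀ + c * T₀) with hN
  have h5 := abs_sub_round (h₀ + c * T₀)
  rw [abs_le] at h5
  set g := (N : ℝ) - h₀ with hg
  have hg0 : 0 < g := by rw [hg]; linarith
  have hgc : |c * T₀ - g| ≤ 1 / 2 := by rw [abs_le, hg]; constructor <;> linarith
  rw [abs_le] at hgc
  refine ⟨N, T₀ / g, by positivity, ?_, ?_, ?_, ?_⟩
  · rw [show h₀ - N = -g by rw [hg]; ring]; field_simp
  · have : T₀ / g * c - 1 = (c * T₀ - g) / g := by field_simp
    rw [this, abs_div, abs_of_pos hg0, div_le_div_iff₀ hg0 hT]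
    have hb : |c * T₀ - g| ≤ 1 / 2 := abs_le.mpr hgc
    have h6 : T₀ ≤ C * L * (c * T₀) := by
      have : 1 ≤ c * L * C := by rwa [div_le_iff₀ hC0] at h1
      nlinarith
    have h7 : c * T₀ ≤ 2 * g := by linarith
    have h8 : C * L * (c * T₀) ≤ C * L * (2 * g) := by gcongr
    nlinarith
  · rw [div_le_div_iff₀ (by positivity) hg0]
    have : g ≤ 2 * (c * T₀) := by linarith
    have : L * g ≤ L * (2 * (c * T₀)) := by gcongr
    have : c * L * T₀ ≤ C * T₀ := by gcongr
    nlinarith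
  · rw [show h₀ - N = -g by rw [hg]; ring, abs_neg, abs_of_pos hg0]; linarith

lemma wv_kernel {κ ν τ : Type*} [Fintype κ] [Fintype ν] (A : Matrix τ (κ ⊕ Unit) ℝ)
    (A₁ : Matrix τ ν ℝ) (t : τ → ℝ) (T : κ ⊕ Unit → ℝ) (a₀ : ν → ℝ) (ζ : κ → ℝ) (c ε' : ℝ)
    (Ξ : Matrix ν (κ ⊕ Unit) ℝ) (x : κ ⊕ Unit → ℤ) (y : ν → ℤ) :
    wv (A + Matrix.vecMulVec t ((ε' * c) • (T + Matrix.vecMul a₀ Ξ + Sum.elim ζ fun _ => 0)))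
      (A₁ - Matrix.vecMulVec t ((ε' * c) • a₀)) x y =
      wv A A₁ x y + (ε' * hv c T a₀ ζ Ξ x y) • t := by
  have h1 : (Sum.elim ζ fun _ : Unit => (0:ℝ)) ⬝ᵥ iv x = ζ ⬝ᵥ fstv x := by
    simp [dotProduct, Fintype.sum_sum_type, fstv]
  rw [wv_vecMulVec]
  simp only [wv, Matrix.sub_mulVec, Matrix.vecMulVec_mulVec, smul_dotProduct, add_dotProduct, h1,
    ← Matrix.dotProduct_mulVec, hv, lv, dotProduct_sub]
  ext i
  simp
  ring

lemma norm_mulVec_fstv_le {κ ν : Type*} [Fintype κ] [Fintype ν] {Ξ : Matrix ν (κ ⊕ Unit) ℝ}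
    {Δ : Matrix ν κ ℝ} {z : ℝ} (hz : 0 ≤ z) (hΔ : ∀ i j, |Δ i j| ≤ z) (x : κ ⊕ Unit → ℤ)
    (y : ν → ℤ) : ‖lv Ξ x y‖ ≤ ‖lv (Ξ + Δ.fromCols 0) x y‖ + Fintype.card κ * z * ‖fstv x‖ := by
  have h1 := mulVec_norm_le Δ hz hΔ (fstv x)
  have h2 : lv Ξ x y = lv (Ξ + Δ.fromCols 0) x y - Δ.mulVec (fstv x) := by
    rw [lv_fromCols]; abel
  rw [h2]
  exact (norm_sub_le _ _).trans (by gcongr)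

lemma nice_kernel {κ ν : Type*} [Fintype κ] [DecidableEq κ]
    [Fintype ν] [DecidableEq ν] {ρ C : ℝ} (hρ : 0 < ρ) (hC : 1 ≤ C)
    (hρQ : ρ * (4 * (2 * (Fintype.card κ + 1) + 5 / 4 * Fintype.card ν *
      (1 + 2 * Fintype.card κ * C) + Fintype.card κ)) ≤ 1)
    {Ξ : Matrix ν (κ ⊕ Unit) ℝ} {T : κ ⊕ Unit → ℝ}
    {Bx : Matrix (κ ⊕ Unit) (κ ⊕ (ν ⊕ Unit)) ℤ} {By : Matrix ν (κ ⊕ (ν ⊕ Unit)) ℤ}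
    {X L S T₀ LV : ℝ} {a₀ : ν → ℝ} {ζ : κ → ℝ} {c hz : ℝ} (hX : 0 < X) (hL : 0 < L)
    (hε : 0 < T (Sum.inr ()))
    (hLε : L ≤ T (Sum.inr ()) * X) (hS : T (Sum.inr ()) * S = T₀)
    (hT : ∀ i, |T i| ≤ 2 * T (Sum.inr ())) (ha : ∀ i, |a₀ i| ≤ 5 / 4) (hζ : ∀ i, |ζ i| ≤ L / X / 4)
    (hc : 0 < c) (hCT : C * L ≤ T₀) (hLV : 0 < LV) (hLVC : LV ≤ C * L)
    (hh : ∀ a, hv c T a₀ ζ Ξ (Bx.mulVec a) (By.mulVec a) = a (Sum.inr (Sum.inr ())))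
    {Δ : Matrix ν κ ℝ} (hΔ : ∀ i j, |Δ i j| ≤ 2 * (LV / X))
    {zx : κ ⊕ Unit → ℤ} {zy : ν → ℤ} (hhz : hv c T a₀ ζ Ξ zx zy = hz) (hhz2 : c * T₀ / 2 ≤ |hz|)
    {X' l : ℝ} (hX' : X ≤ X') (hXS : X' ≤ S) (hlLV : l ≤ LV)
    (hN : ∀ a : κ ⊕ ν → ℤ, a ≠ 0 → ρ * X' ≤ ‖fstv (Bx.mulVec (ext0 a))‖ ∨
      ρ * l ≤ ‖lv (Ξ + Δ.fromCols 0) (Bx.mulVec (ext0 a)) (By.mulVec (ext0 a))‖) :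
    Nice (rc (Bx.updateCol (Sum.inr (Sum.inr ())) zx)) (rem (Ξ + Δ.fromCols 0)
      (Bx.updateCol (Sum.inr (Sum.inr ())) zx) (By.updateCol (Sum.inr (Sum.inr ())) zy)) ρ X' l := by
  intro a ha0
  rw [rem_mulVec, ← iv_mulVec]
  obtain ⟨b, hb⟩ := exists_ext0 a
  generalize a (Sum.inr (Sum.inr ())) = j at hb
  by_cases hj : j = 0
  · rw [hj, zero_smul, add_zero] at hb
    have hb0 : b ≠ 0 := by
      rintro rfl
      refine ha0 ?_
      rw [hb]; ext (i | i | i) <;> simp [ext0]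
    have hBx := updateCol_mulVec_last Bx zx b 0
    have hBy := updateCol_mulVec_last By zy b 0
    simp only [zero_smul, add_zero, ← hb] at hBx hBy
    rw [hBx, hBy, hb]
    exact (hN b hb0).imp_left fun h => h.trans (fstv_norm_le _)
  · rw [hb, updateCol_mulVec_last, updateCol_mulVec_last]
    by_contra! hcon
    set x := Bx.mulVec (ext0 b) + j • zx with hx
    set y := By.mulVec (ext0 b) + j • zy with hy
    obtain ⟨c1, c2⟩ := hcon
    set k : ℝ := ((Fintype.card κ : ℕ) : ℝ) with hk
    set r : ℝ := ((Fintype.card ν : ℕ) : ℝ) with hr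
    have hk0 : 0 ≤ k := by positivity
    have hr0 : 0 ≤ r := by positivity
    have hT0 : 0 < T₀ := lt_of_lt_of_le (by positivity) hCT
    have h1 : hv c T a₀ ζ Ξ x y = j * hz := by
      rw [hx, hy, hv_add, hv_smul, hh, hhz]; simp [ext0]
    have h2 : |hz| ≤ |hv c T a₀ ζ Ξ x y| := by
      rw [h1, abs_mul]
      have : (1:ℝ) ≤ |(j:ℝ)| := by exact_mod_cast Int.one_le_abs hj
      nlinarith [abs_nonneg hz]
    have h3 := hv_abs_le hc.le T ha hζ Ξ x y
    have hLVX : LV / X ≤ C * T (Sum.inr ()) := by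
      rw [div_le_iff₀ hX]; nlinarith
    have hLX : L / X ≤ T (Sum.inr ()) := by rwa [div_le_iff₀ hX]
    have h4 := norm_mulVec_fstv_le (Ξ := Ξ) (by positivity) hΔ x y
    have h5 := dotProduct_abs_le T (iv x) hT
    have h6 := fstv_norm_le x
    have hX'0 : 0 < X' := by linarith
    have hεX : T (Sum.inr ()) * X' ≤ T₀ := by rw [← hS]; gcongr
    have h7 : |T ⬝ᵥ iv x| ≤ 2 * (k + 1) * ρ * T₀ := by
      calc _ ≤ _ := h5
        _ ≤ (k + 1) * (2 * T (Sum.inr ())) * (ρ * X') := by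
          simp only [Fintype.card_sum, Fintype.card_unit]; push_cast; gcongr
        _ = 2 * (k + 1) * ρ * (T (Sum.inr ()) * X') := by ring
        _ ≤ _ := by gcongr
    have h8 : ‖lv Ξ x y‖ ≤ (1 + 2 * k * C) * ρ * T₀ := by
      calc _ ≤ _ := h4
        _ ≤ ρ * T₀ + k * (2 * (C * T (Sum.inr ()))) * (ρ * X') := by
          gcongr
          · refine c2.le.trans ?_
            gcongr
            linarith
          · linarith
        _ = ρ * T₀ + 2 * k * C * ρ * (T (Sum.inr ()) * X') := by ring
        _ ≤ ρ * T₀ + 2 * k * C * ρ * T₀ := by gcongr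
        _ = _ := by ring
    have h9 : k * (L / X / 4) * ‖fstv x‖ ≤ k * ρ * T₀ := by
      calc _ ≤ k * (T (Sum.inr ()) / 1) * (ρ * X') := by
            gcongr
            · norm_num
            · linarith
        _ = k * ρ * (T (Sum.inr ()) * X') := by ring
        _ ≤ _ := by gcongr
    have h10 : |T ⬝ᵥ iv x| + r * (5 / 4) * ‖lv Ξ x y‖ + k * (L / X / 4) * ‖fstv x‖ ≤ T₀ / 4 := by
      calc _ ≤ 2 * (k + 1) * ρ * T₀ + r * (5 / 4) * ((1 + 2 * k * C) * ρ * T₀) + k * ρ * T₀ := by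
            gcongr
        _ = ρ * (4 * (2 * (k + 1) + 5 / 4 * r * (1 + 2 * k * C) + k)) * T₀ / 4 := by ring
        _ ≤ 1 * T₀ / 4 := by gcongr
        _ = _ := by ring
    have h11 : c * (|T ⬝ᵥ iv x| + r * (5 / 4) * ‖lv Ξ x y‖ + k * (L / X / 4) * ‖fstv x‖) ≤
        c * (T₀ / 4) := by gcongr
    have : 0 < c * T₀ := by positivity
    linarith

lemma norm_kernel_short_le {κ ν : Type*} [Fintype κ] [Fintype ν] {C : ℝ} (hC : 1 ≤ C)
    {Ξ : Matrix ν (κ ⊕ Unit) ℝ} {T : κ ⊕ Unit → ℝ} {X L LV : ℝ} {a₀ : ν → ℝ} {ζ : κ → ℝ} {c : ℝ}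
    (hX : 0 < X) (hε : 0 < T (Sum.inr ())) (hLε : L ≤ T (Sum.inr ()) * X)
    (hT : ∀ i, |T i| ≤ 2 * T (Sum.inr ())) (ha : ∀ i, |a₀ i| ≤ 5 / 4) (hζ : ∀ i, |ζ i| ≤ L / X / 4)
    (hc : 0 < c) (hLV : 0 < LV) (hLVC : LV ≤ C * L)
    {Δ : Matrix ν κ ℝ} (hΔ : ∀ i j, |Δ i j| ≤ 2 * (LV / X)) {x : κ ⊕ Unit → ℤ} {y : ν → ℤ}
    {X' l : ℝ} (hX' : X ≤ X') (hlLV : l ≤ LV) (hh : hv c T a₀ ζ Ξ x y = 0)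
    (h1 : ‖fstv x‖ ≤ 2 * X') (h2 : ‖lv (Ξ + Δ.fromCols 0) x y‖ ≤ 2 * l) :
    ‖iv x‖ ≤ (2 + 5 / 4 * Fintype.card ν * (2 * C + 4 * Fintype.card κ * C) +
      5 * Fintype.card κ) * X' := by
  set k : ℝ := ((Fintype.card κ : ℕ) : ℝ) with hk
  set r : ℝ := ((Fintype.card ν : ℕ) : ℝ) with hr
  have hk0 : 0 ≤ k := by positivity
  have hr0 : 0 ≤ r := by positivity
  have hX'0 : 0 < X' := by linarith
  set e := T (Sum.inr ()) with he
  have hLVX : LV / X ≤ C * e := by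
    rw [div_le_iff₀ hX]; nlinarith
  have hLX : L / X ≤ e := by rwa [div_le_iff₀ hX]
  have hq : 0 ≤ 5 / 4 * r * (2 * C + 4 * k * C) := by positivity
  refine norm_iv_le x (by positivity) (h1.trans (by gcongr; linarith)) ?_
  have h3 := hv_zero_bound hc ha hζ hh
  have h4 := norm_mulVec_fstv_le (Ξ := Ξ) (by positivity) hΔ x y
  have h5 := dot_split T x
  have h6 := dotProduct_abs_le (fun i => T (Sum.inl i)) (fstv x) (fun i => hT (Sum.inl i))
  have hlb : l ≤ C * e * X' := by
    calc l ≤ C * L := hlLV.trans hLVC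
      _ ≤ C * (e * X) := by gcongr
      _ ≤ C * (e * X') := by gcongr
      _ = _ := by ring
  have h7 : ‖lv Ξ x y‖ ≤ (2 * C + 4 * k * C) * (e * X') := by
    calc _ ≤ _ := h4
      _ ≤ 2 * (C * e * X') + k * (2 * (C * e)) * (2 * X') := by
        gcongr
        linarith
      _ = _ := by ring
  have h8 : |e * iv x (Sum.inr ())| ≤ (5 / 4 * r * (2 * C + 4 * k * C) + 5 * k) * (e * X') := by
    have e1 : e * iv x (Sum.inr ()) = T ⬝ᵥ iv x - (fun i => T (Sum.inl i)) ⬝ᵥ fstv x := by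
      rw [h5]; ring
    rw [e1]
    calc _ ≤ _ := abs_sub _ _
      _ ≤ (r * (5 / 4) * ((2 * C + 4 * k * C) * (e * X')) + k * (e / 4) * (2 * X')) +
          k * (2 * e) * (2 * X') := by
        refine add_le_add (h3.trans ?_) (h6.trans ?_)
        · gcongr
        · gcongr
      _ = (5 / 4 * r * (2 * C + 4 * k * C)) * (e * X') + 9 / 2 * (k * (e * X')) := by ring
      _ ≤ _ := by
        have : 0 ≤ k * (e * X') := by positivity
        nlinarith
  rw [abs_mul, abs_of_pos hε] at h8
  have h9 : |iv x (Sum.inr ())| ≤ (5 / 4 * r * (2 * C + 4 * k * C) + 5 * k) * X' := by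
    refine le_of_mul_le_mul_left ?_ hε
    linarith
  linarith

lemma abs_mul_entry_le {τ ν α : Type*} [Fintype ν] {A : Matrix τ ν ℝ} {B : Matrix ν α ℝ} {a b : ℝ}
    (ha : 0 ≤ a) (hA : ∀ i j, |A i j| ≤ a) (hB : ∀ i j, |B i j| ≤ b) (i : τ) (j : α) :
    |(A * B) i j| ≤ Fintype.card ν * (a * b) := by
  rw [Matrix.mul_apply]
  refine (Finset.abs_sum_le_sum_abs _ _).trans ?_
  calc _ ≤ ∑ _k : ν, a * b := Finset.sum_le_sum fun k _ => by
        rw [abs_mul]; exact mul_le_mul (hA i k) (hB k j) (abs_nonneg _) ha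
    _ = _ := by simp

lemma det_kernel_basis {κ ν : Type*} [Fintype κ] [DecidableEq κ] [Fintype ν] [DecidableEq ν]
    {T : κ ⊕ Unit → ℝ} {a₀ : ν → ℝ} {ζ : κ → ℝ} {c hz θ S T₀ : ℝ} {Ξ : Matrix ν (κ ⊕ Unit) ℝ}
    {Δ : Matrix ν κ ℝ}
    {Bx : Matrix (κ ⊕ Unit) (κ ⊕ (ν ⊕ Unit)) ℤ} {By : Matrix ν (κ ⊕ (ν ⊕ Unit)) ℤ}
    (hh : ∀ a, hv c T a₀ ζ Ξ (Bx.mulVec a) (By.mulVec a) = a (Sum.inr (Sum.inr ())))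
    {zx : κ ⊕ Unit → ℤ} {zy : ν → ℤ} (hhz : hv c T a₀ ζ Ξ zx zy = hz)
    (hε : 0 < T (Sum.inr ())) (hc : 0 < c) (hθ : 0 < θ) (hS : T (Sum.inr ()) * S = T₀)
    (hθz : θ * |hz| = c * T₀) :
    |(((rc (Bx.updateCol (Sum.inr (Sum.inr ())) zx)).fromRows (rem (Ξ + Δ.fromCols 0)
      (Bx.updateCol (Sum.inr (Sum.inr ())) zx)
      (By.updateCol (Sum.inr (Sum.inr ())) zy))).submatrix id (eW κ ν)).det| =
      S / θ * |(vMat Ξ Bx By).det| := by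
  rw [rem_add, det_shear_equiv]
  have h1 : ∀ a, hv c T a₀ ζ Ξ ((Bx.updateCol (Sum.inr (Sum.inr ())) zx).mulVec a)
      ((By.updateCol (Sum.inr (Sum.inr ())) zy).mulVec a) = hz * a (Sum.inr (Sum.inr ())) := by
    intro a
    obtain ⟨b, hb⟩ := exists_ext0 a
    rw [hb, updateCol_mulVec_last, updateCol_mulVec_last, hv_add, hv_smul, hh, hhz]
    simp [ext0, mul_comm]
  have h2 := det_eMat_eq_vMat T a₀ ζ c hz Ξ _ _ h1
  have h3 : vMat Ξ (Bx.updateCol (Sum.inr (Sum.inr ())) zx)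
      (By.updateCol (Sum.inr (Sum.inr ())) zy) = vMat Ξ Bx By := by
    simp only [vMat, colV_updateCol]
  rw [h3, det_eMat_eq_wMat] at h2
  have h4 := congrArg abs h2
  rw [abs_mul, abs_mul, abs_mul, abs_of_pos hc, abs_of_pos hε] at h4
  set d := |(((rc (Bx.updateCol (Sum.inr (Sum.inr ())) zx)).fromRows (rem Ξ
      (Bx.updateCol (Sum.inr (Sum.inr ())) zx)
      (By.updateCol (Sum.inr (Sum.inr ())) zy))).submatrix id (eW κ ν)).det|
  rw [div_mul_eq_mul_div, eq_div_iff hθ.ne']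
  have hce : 0 < c * T (Sum.inr ()) := by positivity
  refine mul_left_cancel₀ hce.ne' ?_
  linear_combination θ * h4 + |(vMat Ξ Bx By).det| * hθz - c * |(vMat Ξ Bx By).det| * hS

lemma kernel_close {κ ν τ : Type*} [Fintype κ] [Fintype ν] [Fintype τ]
    {A : Matrix τ (κ ⊕ Unit) ℝ} {A₁ : Matrix τ ν ℝ} {Ξ : Matrix ν (κ ⊕ Unit) ℝ} {t : τ → ℝ}
    {T : κ ⊕ Unit → ℝ} {a₀ : ν → ℝ} {ζ : κ → ℝ} {θ S T₀ X L LV C : ℝ} {Δ : Matrix ν κ ℝ}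
    (hX : 0 < X) (hL : 0 < L) (hXS : X ≤ S) (hε : 0 < T (Sum.inr ()))
    (hS : T (Sum.inr ()) * S = T₀) (hT : ∀ i, |T i| ≤ 2 * T (Sum.inr ()))
    (hζ : ∀ i, |ζ i| ≤ L / X / 4) (hC : 1 ≤ C) (hθ : |θ - 1| ≤ C * L / T₀) (hθ2 : |θ| ≤ 9 / 8)
    (ht : ∀ i, |t i| ≤ 1) (hA : ∀ i j, |(A₁ - Matrix.vecMulVec t (θ • a₀)) i j| ≤ 1)
    (hLVC : LV ≤ C * L) (hΔ : ∀ i j, |Δ i j| ≤ 2 * (LV / X)) (i : τ) (j : κ ⊕ Unit) :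
    |((A + Matrix.vecMulVec t (θ • (T + Matrix.vecMul a₀ Ξ + Sum.elim ζ fun _ => 0))) +
      (A₁ - Matrix.vecMulVec t (θ • a₀)) * (Ξ + Δ.fromCols 0) -
      (A + Matrix.vecMulVec t T + A₁ * Ξ) : Matrix τ (κ ⊕ Unit) ℝ) i j| ≤ (2 * C + 1 + 2 * Fintype.card ν * C) * (L / X) := by
  have hvm : Matrix.vecMulVec t (θ • a₀) * Ξ = Matrix.vecMulVec t (θ • Matrix.vecMul a₀ Ξ) := by
    ext i j
    simp only [Matrix.mul_apply, Matrix.vecMulVec_apply, Matrix.vecMul, dotProduct,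
      Pi.smul_apply, smul_eq_mul, Finset.mul_sum]
    exact Finset.sum_congr rfl fun _ _ => by ring
  have e1 : (A + Matrix.vecMulVec t (θ • (T + Matrix.vecMul a₀ Ξ + Sum.elim ζ fun _ => 0))) +
      (A₁ - Matrix.vecMulVec t (θ • a₀)) * (Ξ + Δ.fromCols 0) -
      (A + Matrix.vecMulVec t T + A₁ * Ξ) =
      Matrix.vecMulVec t ((θ - 1) • T + θ • Sum.elim ζ fun _ => 0) +
      (A₁ - Matrix.vecMulVec t (θ • a₀)) * Δ.fromCols 0 := by
    rw [Matrix.mul_add, Matrix.sub_mul A₁ _ Ξ, hvm]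
    ext i j
    simp [Matrix.vecMulVec_apply]
    ring
  rw [e1]
  have hT0 : 0 < T₀ := by rw [← hS]; have := hX.trans_le hXS; positivity
  have hS0 : 0 < S := hX.trans_le hXS
  have hLX : 0 < L / X := by positivity
  have h2 : |(θ - 1) * T j| ≤ 2 * C * (L / X) := by
    rw [abs_mul]
    calc _ ≤ C * L / T₀ * (2 * T (Sum.inr ())) := by gcongr; exact hT j
      _ = 2 * C * (L / S) := by
        rw [← hS]; field_simp
      _ ≤ _ := by gcongr
  have h3 : |θ * (Sum.elim ζ (fun _ => 0) : κ ⊕ Unit → ℝ) j| ≤ L / X := by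
    rw [abs_mul]
    rcases j with j | j
    · calc _ ≤ 9 / 8 * (L / X / 4) := by gcongr; exact hζ j
        _ ≤ _ := by linarith
    · simpa using hLX.le
  have h4 : |(Matrix.vecMulVec t ((θ - 1) • T + θ • Sum.elim ζ fun _ => 0)) i j| ≤
      (2 * C + 1) * (L / X) := by
    rw [Matrix.vecMulVec_apply, abs_mul]
    calc _ ≤ 1 * (2 * C * (L / X) + L / X) := by
          gcongr
          · exact ht i
          · simp only [Pi.add_apply, Pi.smul_apply, smul_eq_mul]
            exact (abs_add_le _ _).trans (add_le_add h2 h3)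
      _ = _ := by ring
  have hΔ' : ∀ i j, |(Δ.fromCols (0 : Matrix ν Unit ℝ)) i j| ≤ 2 * (C * (L / X)) := by
    rintro i (j | j)
    · refine (hΔ i j).trans ?_
      rw [← mul_div_assoc C]; gcongr
    · simp; positivity
  have h5 := abs_mul_entry_le zero_le_one hA hΔ' i j
  refine (abs_add_le _ _).trans ((add_le_add h4 h5).trans ?_)
  apply le_of_eq; ring

set_option maxHeartbeats 2000000 in
lemma exists_kernel_phase (κ ν : Type) [Fintype κ] [DecidableEq κ] [Nonempty κ]
    [Fintype ν] [DecidableEq ν] [Nonempty ν] {ρ₁ : ℝ} (hρ₁ : 0 < ρ₁) :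
    ∃ ρ₃ K : ℝ, 0 < ρ₃ ∧ ρ₃ ≤ 1 ∧ 1 ≤ K ∧ ∀ (τ : Type) [Fintype τ] (Ξ : Matrix ν (κ ⊕ Unit) ℝ)
      (A : Matrix τ (κ ⊕ Unit) ℝ) (A₁ : Matrix τ ν ℝ)
      (Bx : Matrix (κ ⊕ Unit) (κ ⊕ (ν ⊕ Unit)) ℤ) (By : Matrix ν (κ ⊕ (ν ⊕ Unit)) ℤ)
      (T : κ ⊕ Unit → ℝ) (X L S T₀ η : ℝ) (t : τ → ℝ) (j₀ : τ)
      (x₀ : κ ⊕ Unit → ℤ) (y₀ : ν → ℤ) (i₀ : τ → ℤ),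
      1 ≤ X → 0 < L → X ≤ S → 0 < T (Sum.inr ()) → L ≤ T (Sum.inr ()) * X →
      T (Sum.inr ()) * S = T₀ → (∀ i, |T i| ≤ 2 * T (Sum.inr ())) →
      |(eMat T Ξ Bx By).det| = X ^ Fintype.card κ * L ^ (Fintype.card ν + 1) →
      Nice ((rc Bx).submatrix Sum.inl id) ((rem Ξ Bx By).fromRows (tauRow T Bx)) ρ₁ X L →
      IsGen A A₁ Bx By → (∀ i j, |A₁ i j| ≤ 1) → (∀ i, i ≠ j₀ → ∀ j, |A₁ i j| + 4 * |t i| ≤ 1) →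
      (∀ i, |t i| ≤ 1) → t j₀ = 1 → K * L ≤ T₀ → L ≤ η → wv A A₁ x₀ y₀ - iv i₀ = T₀ • t →
      (∀ x y i, (∃ j : ℤ, wv A A₁ x y - iv i = ((j : ℝ) * T₀) • t) ∨
          ∀ c : ℝ, η ≤ ‖wv A A₁ x y - iv i + c • t‖) →
      ∃ (Ξ' : Matrix ν (κ ⊕ Unit) ℝ) (A' : Matrix τ (κ ⊕ Unit) ℝ) (A₁' : Matrix τ ν ℝ)
        (Bx' : Matrix (κ ⊕ Unit) (κ ⊕ (ν ⊕ Unit)) ℤ) (By' : Matrix ν (κ ⊕ (ν ⊕ Unit)) ℤ) (L' : ℝ),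
        (∀ i j, |(Ξ' - Ξ) i j| ≤ K * (L / X)) ∧
        (∀ i j, |(A' + A₁' * Ξ' - (A + Matrix.vecMulVec t T + A₁ * Ξ) :
          Matrix τ (κ ⊕ Unit) ℝ) i j| ≤ K * (L / X)) ∧
        (∀ j, |A₁' j₀ j| ≤ 1) ∧ (∀ i j, |A₁' i j| ≤ |A₁ i j| + 4 * |t i|) ∧ 0 < L' ∧
        S ^ (Fintype.card κ + 1) * L' ^ Fintype.card ν =
          |(((rc Bx').fromRows (rem Ξ' Bx' By')).submatrix id (eW κ ν)).det| ∧
        Nice (rc Bx') (rem Ξ' Bx' By') ρ₃ S L' ∧ IsGen A' A₁' Bx' By' ∧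
        (∀ x y i, wv A' A₁' x y ≠ iv i → ρ₃ * L' ≤ ‖wv A' A₁' x y - iv i‖) ∧
        (∀ X' l, X ≤ X' → X' ≤ S → 0 < l → X' ^ Fintype.card κ * l ^ Fintype.card ν =
          X ^ Fintype.card κ * L ^ Fintype.card ν → Est Ξ' (A' + A₁' * Ξ') X' l K) ∧
        ∀ l, 0 < l → S ^ Fintype.card κ * l ^ Fintype.card ν =
          X ^ Fintype.card κ * L ^ Fintype.card ν → l / K ≤ L' ∧ L' ≤ K * l := by
  obtain ⟨C, hC, h1⟩ := exists_functional_basis κ ν hρ₁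
  obtain ⟨ρ₂, hρ₂, h2⟩ := exists_kernel_shear κ ν hρ₁ hC
  set k : ℝ := ((Fintype.card κ : ℕ) : ℝ) with hk
  set r : ℝ := ((Fintype.card ν : ℕ) : ℝ) with hr
  have hk0 : 0 ≤ k := by positivity
  have hr0 : 0 ≤ r := by positivity
  have hC0 : 0 < C := by linarith
  have hrn : Fintype.card ν ≠ 0 := Fintype.card_ne_zero
  set Q : ℝ := 4 * (2 * (k + 1) + 5 / 4 * r * (1 + 2 * k * C) + k) with hQ
  have hQ0 : 0 < Q := by positivity
  set ρ := min ρ₂ (1 / Q) with hρdef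
  have hρ : 0 < ρ := lt_min hρ₂ (by positivity)
  have hρQ : ρ * Q ≤ 1 := by
    rw [← le_div_iff₀ hQ0]; exact min_le_right _ _
  set ρ₃ := min (min (ρ / 2) (1 / (4 * C ^ 2))) 1 with hρ₃def
  have hρ₃ : 0 < ρ₃ := lt_min (lt_min (by positivity) (by positivity)) one_pos
  have hρ₃1 : ρ₃ ≤ 1 := min_le_right _ _
  have hρ₃2 : ρ₃ ≤ ρ / 2 := (min_le_left _ _).trans (min_le_left _ _)
  have hρ₃3 : ρ₃ ≤ 1 / (4 * C ^ 2) := (min_le_left _ _).trans (min_le_right _ _)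
  set H : ℝ := 2 + 5 / 4 * r * (2 * C + 4 * k * C) + 5 * k with hH
  have hH0 : 2 ≤ H := by
    have : 0 ≤ 5 / 4 * r * (2 * C + 4 * k * C) + 5 * k := by positivity
    linarith
  set K₀ : ℝ := 8 * C + H + C / ρ + C / ρ₂ + 2 * r * C + 1 with hK₀
  have hCρ : 0 ≤ C / ρ := by positivity
  have hCρ₂ : 0 ≤ C / ρ₂ := by positivity
  have hrC : 0 ≤ r * C := by positivity
  have hK₀1 : 8 * C ≤ K₀ := by linarith
  have hK₀pos : 0 < K₀ := by linarith
  have hK₀1' : 1 ≤ K₀ := by linarith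
  have hKK : K₀ ≤ K₀ * (1 + r) := by nlinarith
  refine ⟨ρ₃, K₀ * (1 + r), hρ₃, hρ₃1, by linarith, ?_⟩
  intro τ _ Ξ A A₁ Bx By T X L S T₀ η t j₀ x₀ y₀ i₀ hX1 hL hXS hε hLε hS hT hdet hN hG hA₁ hA₁t
    ht htj hKT hLη hu hdich
  have hX : 0 < X := by linarith
  have hS0 : 0 < S := by linarith
  have hT0 : 0 < T₀ := by rw [← hS]; positivity
  have hKT' : 8 * C * L ≤ T₀ := by
    refine le_trans ?_ hKT
    exact mul_le_mul_of_nonneg_right (hK₀1.trans hKK) hL.le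
  obtain ⟨Bx, By, a₀, ζ, c, hdet, hN, hG, had, hζ, hc1, hc2, hh⟩ :=
    h1 τ Ξ T A A₁ Bx By X L (A₁ j₀) hX hL hdet hN hG (hA₁ j₀)
  have ha : ∀ i, |a₀ i| ≤ 5 / 4 := by
    intro i
    have h3 := had i
    have h4 := hA₁ j₀ i
    rw [abs_le] at *
    constructor <;> linarith [h3.1, h3.2, h4.1, h4.2]
  have hc : 0 < c := by
    have : 0 < c * L := lt_of_lt_of_le (by positivity) hc1
    exact pos_of_mul_pos_left this hL.le
  obtain ⟨Δ, LV, hLV, hLV1, hLV2, hLVr, hvdet, hΔ, hshear⟩ :=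
    h2 Ξ T Bx By X L S a₀ ζ c hX hL hXS hdet hN ha hζ hc1 hc2 hh
  obtain ⟨N, ε', hε', hNz, hθ1, hε'L, hhz2⟩ :=
    exists_rescaling (hv c T a₀ ζ Ξ x₀ y₀) hC hL hc1 hc2 hKT'
  set θ := ε' * c with hθ
  have hθ0 : 0 < θ := by positivity
  have hθ8 : |θ - 1| ≤ 1 / 8 := by
    refine hθ1.trans ?_
    rw [div_le_iff₀ hT0]; linarith
  have hθab := abs_le.1 hθ8
  have hθ98 : |θ| ≤ 9 / 8 := by rw [abs_of_pos hθ0]; linarith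
  obtain ⟨zx, hzx⟩ : ∃ zx, zx = x₀ + (-N) • Bx.mulVec (Pi.single (Sum.inr (Sum.inr ())) 1) :=
    ⟨_, rfl⟩
  obtain ⟨zy, hzy⟩ : ∃ zy, zy = y₀ + (-N) • By.mulVec (Pi.single (Sum.inr (Sum.inr ())) 1) :=
    ⟨_, rfl⟩
  have hhz : hv c T a₀ ζ Ξ zx zy = hv c T a₀ ζ Ξ x₀ y₀ - N := by
    rw [hzx, hzy, hv_add, hv_smul, hh]; simp; ring
  obtain ⟨A', hA'⟩ : ∃ A', A' = A + Matrix.vecMulVec t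
      (θ • (T + Matrix.vecMul a₀ Ξ + Sum.elim ζ fun _ => 0)) := ⟨_, rfl⟩
  obtain ⟨A₁', hA₁'⟩ : ∃ A₁', A₁' = A₁ - Matrix.vecMulVec t (θ • a₀) := ⟨_, rfl⟩
  have hw : ∀ x y, wv A' A₁' x y = wv A A₁ x y + (ε' * hv c T a₀ ζ Ξ x y) • t := by
    intro x y
    rw [hA', hA₁']; exact wv_kernel A A₁ t T a₀ ζ c ε' Ξ x y
  have hη : 0 < η := by linarith
  obtain ⟨hl1, hl2⟩ := kernel_lattice hG hh htj hu hε' hdich hNz hw hzx hzy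
  have hdet' := det_kernel_basis (Δ := Δ) hh (zy := zy) hhz hε hc hθ0 hS (by
    rw [hθ, mul_assoc, mul_left_comm, ← abs_of_pos hε', ← abs_mul, hNz, abs_neg, abs_of_pos hT0])
  rw [hvdet] at hdet'
  have hnice : ∀ X' l, X ≤ X' → X' ≤ S → 0 < l → X' ^ Fintype.card κ * l ^ Fintype.card ν =
      X ^ Fintype.card κ * LV ^ Fintype.card ν →
      Nice (rc (Bx.updateCol (Sum.inr (Sum.inr ())) zx)) (rem (Ξ + Δ.fromCols 0)
        (Bx.updateCol (Sum.inr (Sum.inr ())) zx)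
        (By.updateCol (Sum.inr (Sum.inr ())) zy)) ρ X' l := by
    intro X' l hX' hXS' hl hlev
    refine nice_kernel hρ hC hρQ hX hL hε hLε hS hT ha hζ hc (by linarith [mul_pos hC0 hL]) hLV
      hLV2 hh hΔ hhz hhz2 hX' hXS' (root_anti hrn hX hX' hLV rfl hlev) ?_
    intro a ha0
    refine ((hshear X' l hX' hXS' hl hlev).1 a ha0).imp (fun h => le_trans ?_ h)
      (fun h => le_trans ?_ h)
    · have : 0 < X' := by linarith
      gcongr; exact min_le_left _ _
    · gcongr; exact min_le_left _ _
  obtain ⟨lS, hlS, hlSlev⟩ := exists_root (c := Fintype.card κ) hS0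
    (show 0 < X ^ Fintype.card κ * LV ^ Fintype.card ν by positivity) hrn
  obtain ⟨L', hL', hL'det⟩ := exists_root (c := Fintype.card κ + 1) hS0
    (show 0 < S / θ * (X ^ Fintype.card κ * LV ^ Fintype.card ν) by positivity) hrn
  have hL'r : L' ^ Fintype.card ν = (1 / θ) * lS ^ Fintype.card ν := by
    rw [← hlSlev, pow_succ] at hL'det
    have : 0 < S ^ Fintype.card κ * S := by positivity
    refine mul_left_cancel₀ this.ne' ?_
    rw [hL'det]; ring
  obtain ⟨hL'1, hL'2⟩ := root_compare (C := 2) hrn hL' hlS (by norm_num) hL'r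
    (by rw [div_le_div_iff₀ (by norm_num) hθ0]; linarith) (by rw [div_le_iff₀ hθ0]; linarith)
  have hlSLV : lS ≤ LV := root_anti hrn hX hXS hLV rfl hlSlev
  have hLVpow : ∀ X' l lV : ℝ, 0 < X' → 0 < l → 0 < lV →
      X' ^ Fintype.card κ * l ^ Fintype.card ν = X ^ Fintype.card κ * L ^ Fintype.card ν →
      X' ^ Fintype.card κ * lV ^ Fintype.card ν = X ^ Fintype.card κ * LV ^ Fintype.card ν →
      l / C ≤ lV ∧ lV ≤ C * l := by
    intro X' l lV hX' hl hlV e1 e2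
    refine root_compare (g := c * L) hrn hlV hl hC ?_ hc1 hc2
    have : 0 < X' ^ Fintype.card κ := by positivity
    refine mul_left_cancel₀ this.ne' ?_
    rw [e2, hLVr]
    linear_combination -(c * L) * e1
  have hA₁'j : ∀ j, |A₁' j₀ j| ≤ 1 := by
    intro j
    have e1 : A₁' j₀ j = -(a₀ j - A₁ j₀ j) - (θ - 1) * a₀ j := by
      rw [hA₁']; simp [Matrix.vecMulVec_apply, htj]; ring
    rw [e1]
    refine (abs_sub _ _).trans ?_
    rw [abs_neg, abs_mul]
    exact (add_le_add (had j) (mul_le_mul hθ8 (ha j) (abs_nonneg _) (by norm_num))).trans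
      (by norm_num)
  have hA₁'i : ∀ i j, |A₁' i j| ≤ |A₁ i j| + 4 * |t i| := by
    intro i j
    have e1 : A₁' i j = A₁ i j - t i * (θ * a₀ j) := by
      rw [hA₁']; rfl
    rw [e1]
    refine (abs_sub _ _).trans ?_
    rw [abs_mul, abs_mul, mul_comm 4]
    gcongr
    exact (mul_le_mul hθ98 (ha j) (abs_nonneg _) (by norm_num)).trans (by norm_num)
  have hA₁'1 : ∀ i j, |A₁' i j| ≤ 1 := by
    intro i j
    by_cases h : i = j₀
    · rw [h]; exact hA₁'j j
    · exact (hA₁'i i j).trans (hA₁t i h j)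
  have hLX : 0 < L / X := by positivity
  have hmul : ∀ z, z ≤ K₀ → z * (L / X) ≤ K₀ * (1 + r) * (L / X) := by
    intro z hz
    gcongr
    linarith
  refine ⟨Ξ + Δ.fromCols 0, A', A₁', _, _, L', ?_, ?_, hA₁'j, hA₁'i, hL', hL'det.trans hdet'.symm,
    ?_, ⟨hl1, ?_⟩, ?_, ?_, ?_⟩
  · intro i j
    have e1 : |(Ξ + Δ.fromCols 0 - Ξ : Matrix ν (κ ⊕ Unit) ℝ) i j| ≤ 2 * C * (L / X) := by
      rw [add_sub_cancel_left]
      rcases j with j | j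
      · refine (hΔ i j).trans ?_
        rw [mul_assoc, ← mul_div_assoc C]; gcongr
      · simp; positivity
    exact e1.trans (hmul _ (by linarith))
  · intro i j
    rw [hA', hA₁']
    exact (kernel_close hX hL hXS hε hS hT hζ hC hθ1 hθ98 ht (hA₁' ▸ hA₁'1) hLV2 hΔ i j).trans
      (hmul _ (by linarith))
  · exact (hnice S lS hXS le_rfl hlS hlSlev).mono (by gcongr; linarith)
      ((mul_le_mul hρ₃2 hL'2 hL'.le (by positivity)).trans (by apply le_of_eq; ring))
  · intro x y i h
    have h0 : ‖wv A' A₁' x y - iv i‖ = 0 := by rw [h, sub_self, norm_zero]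
    rcases hl2 x y i with h' | h' | h'
    · exact h'.1
    · linarith
    · linarith
  · intro x y i h
    have hb : L' ≤ 2 * C * L := by linarith
    rcases hl2 x y i with h' | h' | h'
    · exact absurd h'.2 h
    · refine le_trans ?_ (hε'L.trans h')
      calc ρ₃ * L' ≤ 1 / (4 * C ^ 2) * (2 * C * L) := by gcongr
        _ = L / (2 * C) := by field_simp; norm_num
    · refine le_trans ?_ (hLη.trans h')
      calc ρ₃ * L' ≤ 1 / (4 * C ^ 2) * (2 * C * L) := by gcongr
        _ = L / (2 * C) := by field_simp; norm_num
        _ ≤ L := div_le_self hL.le (by linarith)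
  · intro X' l hX' hXS' hl hlev
    have hX'0 : 0 < X' := by linarith
    obtain ⟨lV, hlV, hlVlev⟩ := exists_root (c := Fintype.card κ) hX'0
      (show 0 < X ^ Fintype.card κ * LV ^ Fintype.card ν by positivity) hrn
    obtain ⟨hl3, hl4⟩ := hLVpow X' l lV hX'0 hl hlV hlev hlVlev
    have hlL : l ≤ L := root_anti hrn hX hX' hL rfl hlev
    have hlVLV : lV ≤ LV := root_anti hrn hX hX' hLV rfl hlVlev
    refine est_of_split (by linarith) hl (by linarith) hA₁'1 ?_ ?_
    · intro x hx y i c1 c2 c3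
      have hlη : l / K₀ ≤ η := (div_le_self hl.le hK₀1').trans (hlL.trans hLη)
      have hlε : l / K₀ ≤ ε' := by
        refine le_trans ?_ hε'L
        gcongr; linarith
      rcases hl2 x y i with h' | h' | h'
      · obtain ⟨⟨a, hxa, hya⟩, -⟩ := h'
        have ha0 : a ≠ 0 := by
          rintro rfl
          exact hx (by rw [hxa, Matrix.mulVec_zero])
        have h5 := hnice X' lV hX' hXS' hlV hlVlev a ha0
        rw [rem_mulVec, ← iv_mulVec, ← hxa, ← hya] at h5
        have hK1 : 1 ≤ K₀ * ρ := by
          rw [← div_le_iff₀ hρ]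
          have : 1 / ρ ≤ C / ρ := by gcongr
          linarith
        have hK2 : C ≤ K₀ * ρ := by
          rw [← div_le_iff₀ hρ]
          linarith
        rcases h5 with h5 | h5
        · have : X' / K₀ ≤ ρ * X' := by
            rw [div_le_iff₀ hK₀pos, mul_right_comm, mul_comm ρ]
            exact le_mul_of_one_le_left hX'0.le hK1
          linarith
        · have : l / K₀ ≤ ρ * lV := by
            rw [div_le_iff₀ hK₀pos]
            rw [div_le_iff₀ hC0] at hl3
            rw [mul_right_comm, mul_comm ρ, mul_comm _ lV]
            exact hl3.trans (mul_le_mul_of_nonneg_left hK2 hlV.le)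
          linarith
      · linarith
      · linarith
    · obtain ⟨-, a, ha0, h5, h6⟩ := hshear X' lV hX' hXS' hlV hlVlev
      have hBx := updateCol_mulVec_last Bx zx a 0
      have hBy := updateCol_mulVec_last By zy a 0
      simp only [zero_smul, add_zero] at hBx hBy
      have h0 : hv c T a₀ ζ Ξ (Bx.mulVec (ext0 a)) (By.mulVec (ext0 a)) = 0 := by
        rw [hh]; simp [ext0]
      obtain ⟨i, hi⟩ := hl1 (ext0 a)
      rw [hBx, hBy] at hi
      have h7 := norm_kernel_short_le hC hX hε hLε hT ha hζ hc hLV hLV2 hΔ hX' hlVLV h0 h5 h6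
      refine ⟨_, _, i, ?_, h7.trans ?_, h6.trans ?_, ?_⟩
      · intro hx0 hy0
        have h8 := (hshear X' lV hX' hXS' hlV hlVlev).1 a ha0
        rw [hx0, hy0] at h8
        have e1 : fstv (0 : κ ⊕ Unit → ℤ) = 0 := by ext; simp [fstv, iv]
        have e2 : lv (Ξ + Δ.fromCols 0) 0 (0 : ν → ℤ) = 0 := by
          ext; simp [lv, iv, Matrix.mulVec, dotProduct]
        rw [e1, e2, norm_zero, norm_zero] at h8
        rcases h8 with h8 | h8 <;> linarith [mul_pos hρ₂ hX'0, mul_pos hρ₂ hlV]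
      · gcongr; linarith
      · calc 2 * lV ≤ 2 * (C * l) := by gcongr
          _ = 2 * C * l := by ring
          _ ≤ _ := by gcongr; linarith
      · rw [hi, sub_self, norm_zero]; positivity
  · intro l hl hlev
    obtain ⟨hl3, hl4⟩ := hLVpow S l lS hS0 hl hlS hlev hlSlev
    have h8 : 2 * C ≤ K₀ * (1 + r) := by linarith
    constructor
    · rw [div_le_iff₀ hC0] at hl3
      rw [div_le_iff₀ (by linarith)]
      calc l ≤ lS * C := hl3
        _ ≤ (2 * L') * C := by gcongr; linarith
        _ = L' * (2 * C) := by ring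
        _ ≤ _ := by gcongr
    · calc L' ≤ 2 * lS := hL'2
        _ ≤ 2 * (C * l) := by gcongr
        _ = 2 * C * l := by ring
        _ ≤ _ := by gcongr

lemma exists_denominator {α ν τ σ : Type*} [Fintype α] [DecidableEq α] [Fintype ν] [DecidableEq ν]
    [Fintype σ] [DecidableEq σ] {e : α ⊕ ν ≃ σ} {Ξ : Matrix ν α ℝ} {A : Matrix τ α ℝ}
    {A₁ : Matrix τ ν ℝ}
    {Bx : Matrix α σ ℤ} {By : Matrix ν σ ℤ} (hG : IsGen A A₁ Bx By)
    (hdet : (((rc Bx).fromRows (rem Ξ Bx By)).submatrix id e).det ≠ 0) :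
    ∃ D : ℕ, 1 ≤ D ∧ ∀ x y, ∃ i : τ → ℤ, (D : ℝ) • wv A A₁ x y = iv i := by
  set M : Matrix (α ⊕ ν) (α ⊕ ν) ℤ := (Bx.fromRows By).submatrix id e with hM
  have hMe : ∀ v : α ⊕ ν → ℤ, M.mulVec v =
      Sum.elim (Bx.mulVec (v ∘ e.symm)) (By.mulVec (v ∘ e.symm)) := by
    intro v
    have h := Matrix.submatrix_mulVec_equiv (Bx.fromRows By) v (id : α ⊕ ν → α ⊕ ν) e
    rw [hM, h, Matrix.fromRows_mulVec]; rfl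
  have hM0 : M.det ≠ 0 := by
    intro h0
    obtain ⟨v, hv0, hv⟩ := Matrix.exists_mulVec_eq_zero_iff.2 h0
    rw [hMe] at hv
    have h1 : Bx.mulVec (v ∘ e.symm) = 0 := by
      ext i; exact congrFun hv (Sum.inl i)
    have h2 : By.mulVec (v ∘ e.symm) = 0 := by
      ext i; exact congrFun hv (Sum.inr i)
    refine hdet (Matrix.exists_mulVec_eq_zero_iff.1 ⟨iv v, iv_ne_zero hv0, ?_⟩)
    have h := Matrix.submatrix_mulVec_equiv ((rc Bx).fromRows (rem Ξ Bx By)) (iv v)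
      (id : α ⊕ ν → α ⊕ ν) e
    rw [h, Matrix.fromRows_mulVec]
    have h3 : iv v ∘ e.symm = iv (v ∘ e.symm) := rfl
    rw [h3, rem_mulVec, rc, ← iv_mulVec, h1, h2]
    ext (i | i) <;> simp [lv, iv, Matrix.mulVec, dotProduct]
  refine ⟨M.det.natAbs, Nat.one_le_iff_ne_zero.2 (Int.natAbs_ne_zero.2 hM0), fun x y => ?_⟩
  have h1 : M.mulVec (M.adjugate.mulVec (Sum.elim x y)) = M.det • Sum.elim x y := by
    rw [Matrix.mulVec_mulVec, Matrix.mul_adjugate, Matrix.smul_mulVec, Matrix.one_mulVec]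
  rw [hMe] at h1
  obtain ⟨i, hi⟩ := hG.1 (M.adjugate.mulVec (Sum.elim x y) ∘ e.symm)
  have hx : Bx.mulVec (M.adjugate.mulVec (Sum.elim x y) ∘ e.symm) = M.det • x := by
    ext i; exact congrFun h1 (Sum.inl i)
  have hy : By.mulVec (M.adjugate.mulVec (Sum.elim x y) ∘ e.symm) = M.det • y := by
    ext i; exact congrFun h1 (Sum.inr i)
  rw [hx, hy, wv_smul] at hi
  rcases Int.natAbs_eq M.det with h | h
  · refine ⟨i, ?_⟩
    rw [← hi]
    congr 1
    have h2 : ((M.det.natAbs : ℤ) : ℝ) = (M.det : ℤ) := congrArg Int.cast h.symm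
    rwa [Int.cast_natCast] at h2
  · refine ⟨(-1 : ℤ) • i, ?_⟩
    rw [iv_smul, ← hi, smul_smul]
    congr 1
    have h2 : ((M.det.natAbs : ℤ) : ℝ) = ((-1 * M.det : ℤ) : ℝ) := congrArg Int.cast (by omega)
    rw [Int.cast_natCast] at h2
    rw [h2]; push_cast; ring

lemma gap_of_denominator {α ν τ : Type*} [Fintype α] [Fintype ν] [Fintype τ]
    {A : Matrix τ α ℝ} {A₁ : Matrix τ ν ℝ} {D : ℕ} (hD : 1 ≤ D)
    (h : ∀ x y, ∃ i : τ → ℤ, (D : ℝ) • wv A A₁ x y = iv i) (x : α → ℤ) (y : ν → ℤ) (i : τ → ℤ)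
    (hne : wv A A₁ x y ≠ iv i) : 1 / (D : ℝ) ≤ ‖wv A A₁ x y - iv i‖ := by
  have hD0 : (0 : ℝ) < D := by exact_mod_cast hD
  obtain ⟨j, hj⟩ := h x y
  have h1 : (D : ℝ) • (wv A A₁ x y - iv i) = iv (j - (D : ℤ) • i) := by
    rw [smul_sub, hj, iv_sub, iv_smul]; simp
  have h2 : j - (D : ℤ) • i ≠ 0 := by
    intro h0
    rw [h0] at h1
    have h3 : iv (0 : τ → ℤ) = 0 := by ext; simp [iv]
    rw [h3] at h1
    exact hne (sub_eq_zero.1 ((smul_eq_zero.1 h1).resolve_left hD0.ne'))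
  have h3 := one_le_norm_iv h2
  rw [← h1, norm_smul, Real.norm_eq_abs, abs_of_pos hD0] at h3
  rwa [div_le_iff₀' hD0]

lemma exists_direction {α ν τ : Type*} [Fintype α] [Fintype ν] [Fintype τ] [DecidableEq τ]
    {A : Matrix τ α ℝ} {A₁ : Matrix τ ν ℝ} {D T : ℕ} (hD : 1 ≤ D) (hT : 1 ≤ T)
    (h : ∀ x y, ∃ i : τ → ℤ, (D : ℝ) • wv A A₁ x y = iv i) {j₀ j₁ : τ}
    (hj : ∀ j, j = j₀ ∨ j = j₁) (hjT : j₀ = j₁ → T = 1) :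
    ∃ (t : τ → ℝ) (T₀ : ℝ) (x₀ : α → ℤ) (y₀ : ν → ℤ) (i₀ : τ → ℤ),
      t j₀ = 1 ∧ (∀ i, i ≠ j₀ → t i = 1 / T) ∧ (T : ℝ) / D ≤ T₀ ∧ T₀ ≤ T ∧
      wv A A₁ x₀ y₀ - iv i₀ = T₀ • t ∧
      ∀ x y i, (∃ j : ℤ, wv A A₁ x y - iv i = ((j : ℝ) * T₀) • t) ∨
        (j₀ ≠ j₁ ∧ ∀ c : ℝ, 1 / ((D : ℝ) * (1 + T)) ≤ ‖wv A A₁ x y - iv i + c • t‖) := by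
  have hD0 : (0 : ℝ) < D := by exact_mod_cast hD
  have hT0 : (0 : ℝ) < T := by exact_mod_cast hT
  set t : τ → ℝ := fun j => if j = j₀ then 1 else 1 / T with ht
  have htj₁ : t j₁ = 1 / T := by
    by_cases hjj : j₁ = j₀
    · simp [ht, hjj, hjT hjj.symm]
    · simp [ht, hjj]
  let G : AddSubgroup ℤ :=
    { carrier := {z | ∃ x y i, wv A A₁ x y - iv i = ((z : ℝ) * (T / D)) • t}
      zero_mem' := ⟨0, 0, 0, by ext; simp [wv, iv, Matrix.mulVec, dotProduct]⟩
      add_mem' := by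
        rintro a b ⟨x, y, i, hi⟩ ⟨x', y', i', hi'⟩
        refine ⟨x + x', y + y', i + i', ?_⟩
        rw [wv_add, iv_add, add_sub_add_comm, hi, hi', ← add_smul]
        push_cast; ring_nf
      neg_mem' := by
        rintro a ⟨x, y, i, hi⟩
        refine ⟨(-1 : ℤ) • x, (-1 : ℤ) • y, (-1 : ℤ) • i, ?_⟩
        rw [wv_smul, iv_smul, ← smul_sub, hi, smul_smul]
        push_cast; ring_nf }
  obtain ⟨g, hg⟩ := Int.subgroup_cyclic G
  have hmem : ∀ z : ℤ, z ∈ G ↔ ∃ j : ℤ, z = j * |g| := by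
    intro z
    rw [hg, AddSubgroup.mem_closure_singleton]
    constructor
    · rintro ⟨n, hn⟩
      rcases abs_choice g with h' | h'
      · exact ⟨n, by rw [h', ← hn]; simp⟩
      · exact ⟨-n, by rw [h', ← hn]; simp⟩
    · rintro ⟨j, hj⟩
      rcases abs_choice g with h' | h'
      · exact ⟨j, by rw [hj, h']; simp⟩
      · exact ⟨-j, by rw [hj, h']; simp⟩
  have hDG : (D : ℤ) ∈ G := by
    refine ⟨0, 0, fun j => if j = j₀ then -T else -1, ?_⟩
    ext j
    by_cases hjj : j = j₀
    · simp [wv, iv, Matrix.mulVec, dotProduct, ht, hjj]; field_simp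
    · simp [wv, iv, Matrix.mulVec, dotProduct, ht, hjj]; field_simp
  obtain ⟨q, hq⟩ := (hmem _).1 hDG
  have hg1 : 1 ≤ |g| := by
    rcases (abs_nonneg g).lt_or_eq with h' | h'
    · omega
    · rw [← h', mul_zero] at hq; omega
  have hgD : |g| ≤ D := by
    have : 0 < q := by
      by_contra hq0
      have : q * |g| ≤ 0 := mul_nonpos_of_nonpos_of_nonneg (by omega) (abs_nonneg g)
      omega
    nlinarith
  obtain ⟨x₀, y₀, i₀, h0⟩ := (hmem |g|).2 ⟨1, by ring⟩
  have hg1' : (1 : ℝ) ≤ (|g| : ℤ) := by exact_mod_cast hg1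
  have hgD' : ((|g| : ℤ) : ℝ) ≤ D := by exact_mod_cast hgD
  refine ⟨t, ((|g| : ℤ) : ℝ) * (T / D), x₀, y₀, i₀, by simp [ht], fun i hi => by simp [ht, hi],
    ?_, ?_, h0, ?_⟩
  · exact le_mul_of_one_le_left (by positivity) hg1'
  · rw [mul_div_assoc', div_le_iff₀ hD0, mul_comm]; gcongr
  intro x y i
  obtain ⟨d, hd⟩ := h x y
  have hd' : ∀ j, wv A A₁ x y j - iv i j = ((d j - D * i j : ℤ) : ℝ) / D := by
    intro j
    have := congrFun hd j
    simp only [Pi.smul_apply, smul_eq_mul, iv] at this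
    rw [eq_div_iff hD0.ne']
    push_cast
    rw [← this]
    simp only [iv]; ring
  set z : τ → ℤ := fun j => d j - D * i j with hz
  by_cases hp : z j₀ = T * z j₁
  · left
    have hzG : z j₁ ∈ G := by
      refine ⟨x, y, i, ?_⟩
      ext j
      rw [Pi.sub_apply, hd' j, Pi.smul_apply, smul_eq_mul]
      rcases hj j with rfl | rfl
      · have : ((z j : ℤ) : ℝ) = T * (z j₁ : ℤ) := by exact_mod_cast hp
        rw [show d j - (D:ℤ) * i j = z j from rfl, this]
        simp [ht]; ring
      · rw [htj₁]; field_simp; rfl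
    obtain ⟨j, hj'⟩ := (hmem _).1 hzG
    obtain ⟨x', y', i', h'⟩ := hzG
    refine ⟨j, ?_⟩
    ext l
    rw [Pi.sub_apply, hd' l, Pi.smul_apply, smul_eq_mul]
    have hcast : ((z j₁ : ℤ) : ℝ) = j * (|g| : ℤ) := by exact_mod_cast hj'
    rw [← mul_assoc, ← hcast]
    rcases hj l with rfl | rfl
    · have : ((z l : ℤ) : ℝ) = T * (z j₁ : ℤ) := by exact_mod_cast hp
      rw [show d l - (D:ℤ) * i l = z l from rfl, this]
      simp [ht]; ring
    · rw [htj₁]; field_simp; rfl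
  · right
    refine ⟨?_, fun c => ?_⟩
    · rintro rfl
      exact hp (by rw [hjT rfl]; simp)
    · have h1 : (1 : ℝ) ≤ |((z j₀ - T * z j₁ : ℤ) : ℝ)| := by
        exact_mod_cast Int.one_le_abs (sub_ne_zero.2 hp)
      set w := wv A A₁ x y - iv i + c • t with hw
      have h2 : ((z j₀ - T * z j₁ : ℤ) : ℝ) = D * (w j₀ - T * w j₁) := by
        have e0 := hd' j₀
        have e1 := hd' j₁
        rw [eq_div_iff hD0.ne'] at e0 e1
        have t0 : t j₀ = 1 := by simp [ht]
        simp only [hw, Pi.add_apply, Pi.sub_apply, Pi.smul_apply, smul_eq_mul, htj₁, t0]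
        have : ((z j₀ - T * z j₁ : ℤ) : ℝ) = (z j₀ : ℤ) - T * (z j₁ : ℤ) := by push_cast; ring
        rw [this]
        simp only [hz]
        rw [← e0, ← e1]
        field_simp
        ring
      rw [h2, abs_mul, abs_of_pos hD0] at h1
      have h3 := norm_le_pi_norm w j₀
      have h4 := norm_le_pi_norm w j₁
      rw [Real.norm_eq_abs] at h3 h4
      have h5 : |w j₀ - T * w j₁| ≤ (1 + T) * ‖w‖ := by
        refine (abs_sub _ _).trans ?_
        rw [abs_mul, abs_of_pos hT0]
        nlinarith
      rw [div_le_iff₀ (by positivity)]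
      nlinarith

/-- Entrywise distance at most `c`. -/
def Within {ι ι' : Type*} (M M' : Matrix ι ι' ℝ) (c : ℝ) : Prop := ∀ i j, |(M' - M) i j| ≤ c

lemma Within.mono {ι ι' : Type*} {M M' : Matrix ι ι' ℝ} {c c' : ℝ} (h : Within M M' c)
    (hc : c ≤ c') : Within M M' c' := fun i j => (h i j).trans hc

lemma Within.trans {ι ι' : Type*} {M M' N : Matrix ι ι' ℝ} {c c' : ℝ} (h : Within M M' c)
    (h' : Within M' N c') : Within M N (c + c') := fun i j => by
  have : (N - M) i j = (M' - M) i j + (N - M') i j := by simp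
  rw [this]
  exact (abs_add_le _ _).trans (add_le_add (h i j) (h' i j))

/-- The estimates along one cycle of the construction. -/
def CycleEst {κ ν τ : Type*} [Fintype κ] [Fintype ν] [Fintype τ] (Ξ : Matrix ν (κ ⊕ Unit) ℝ)
    (Γ : Matrix τ (κ ⊕ Unit) ℝ) (P L XA LA XB LB S K : ℝ) : Prop :=
  (∀ X l, P ≤ X → X ≤ XA → 0 < l → X ^ (Fintype.card κ + 1) * l ^ Fintype.card ν =
    P ^ (Fintype.card κ + 1) * L ^ Fintype.card ν → Est Ξ Γ X l K) ∧
  (∀ X l, XA ≤ X → X ≤ XB → 0 < l → X ^ Fintype.card κ * l ^ (Fintype.card ν + 1) =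
    XA ^ Fintype.card κ * LA ^ (Fintype.card ν + 1) → Est Ξ Γ X l K) ∧
  ∀ X l, XB ≤ X → X ≤ S → 0 < l → X ^ Fintype.card κ * l ^ Fintype.card ν =
    XB ^ Fintype.card κ * LB ^ Fintype.card ν → Est Ξ Γ X l K

/-- A stage of the construction: the irrational rows `Ξ`, the remaining rows `A + A₁ Ξ`, a basis
of the lattice where `A x + A₁ y` is integral, and the current scale. -/
structure Stage (κ ν τ : Type) where
  Ξ : Matrix ν (κ ⊕ Unit) ℝ
  A : Matrix τ (κ ⊕ Unit) ℝ
  A₁ : Matrix τ ν ℝ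
  Bx : Matrix (κ ⊕ Unit) (κ ⊕ (ν ⊕ Unit)) ℤ
  By : Matrix ν (κ ⊕ (ν ⊕ Unit)) ℤ
  P : ℝ
  L : ℝ

/-- The remaining rows of a stage. -/
def Stage.Γ {κ ν τ : Type} [Fintype ν] (s : Stage κ ν τ) : Matrix τ (κ ⊕ Unit) ℝ :=
  s.A + s.A₁ * s.Ξ

/-- The conditions a stage satisfies at the beginning of a cycle. -/
structure Stage.Good {κ ν τ : Type} [Fintype κ] [DecidableEq κ] [Fintype ν] [DecidableEq ν]
    [Fintype τ] (s : Stage κ ν τ) (ρ δ : ℝ) (j₀ : τ) : Prop where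
  one_le : 1 ≤ s.P
  pos : 0 < s.L
  det : s.P ^ (Fintype.card κ + 1) * s.L ^ Fintype.card ν =
    |(((rc s.Bx).fromRows (rem s.Ξ s.Bx s.By)).submatrix id (eW κ ν)).det|
  nice : Nice (rc s.Bx) (rem s.Ξ s.Bx s.By) ρ s.P s.L
  gen : IsGen s.A s.A₁ s.Bx s.By
  gap : ∀ x y i, wv s.A s.A₁ x y ≠ iv i → ρ * s.L ≤ ‖wv s.A s.A₁ x y - iv i‖
  row : ∀ j, |s.A₁ j₀ j| ≤ 1
  rows : ∀ i, i ≠ j₀ → ∀ j, |s.A₁ i j| ≤ 1 - δ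

lemma Est.perturb_within {α ν τ : Type*} [Fintype α] [Fintype ν] [Fintype τ] {Ξ Ξ' : Matrix ν α ℝ}
    {Γ Γ' : Matrix τ α ℝ} {X l X' l' K C : ℝ} (h : Est Ξ Γ X l K) (hX : 0 < X) (hl : 0 < l)
    (hX' : X ≤ X') (hl' : l' ≤ l)
    (hK : 0 < K) (hC : 0 ≤ C) (hΞ : Within Ξ Ξ' (C * (l' / X')))
    (hΓ : Within Γ Γ' (C * (l' / X'))) : Est Ξ' Γ' X l (K * (1 + Fintype.card α * C)) := by
  have : C * (l' / X') ≤ C * (l / X) := by gcongr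
  exact h.perturb hX hl hK hC (hΞ.mono this) (hΓ.mono this)

lemma CycleEst.perturb {κ ν τ : Type*} [Fintype κ] [Fintype ν] [Nonempty ν] [Fintype τ]
    {Ξ Ξ' : Matrix ν (κ ⊕ Unit) ℝ} {Γ Γ' : Matrix τ (κ ⊕ Unit) ℝ}
    {P L XA LA XB LB S LS K C : ℝ} (h : CycleEst Ξ Γ P L XA LA XB LB S K) (hP : 0 < P)
    (hPA : P ≤ XA) (hLA : 0 < LA) (hAB : XA ≤ XB) (hLB : 0 < LB) (hBS : XB ≤ S)
    (eA : XA ^ (Fintype.card κ + 1) * LA ^ Fintype.card ν =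
      P ^ (Fintype.card κ + 1) * L ^ Fintype.card ν)
    (eB : XB ^ Fintype.card κ * LB ^ (Fintype.card ν + 1) =
      XA ^ Fintype.card κ * LA ^ (Fintype.card ν + 1))
    (eS : S ^ Fintype.card κ * LS ^ Fintype.card ν = XB ^ Fintype.card κ * LB ^ Fintype.card ν)
    (hK : 0 < K) (hC : 0 ≤ C) (hΞ : Within Ξ Ξ' (C * (LS / S)))
    (hΓ : Within Γ Γ' (C * (LS / S))) :
    CycleEst Ξ' Γ' P L XA LA XB LB S (K * (1 + Fintype.card (κ ⊕ Unit) * C)) := by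
  have hrn : Fintype.card ν ≠ 0 := Fintype.card_ne_zero
  have hSB : LS ≤ LB := root_anti hrn (by linarith) hBS hLB rfl eS
  have hBA : LB ≤ LA := root_anti (Nat.succ_ne_zero _) (by linarith) hAB hLA rfl eB
  refine ⟨fun X l h1 h2 hl e => ?_, fun X l h1 h2 hl e => ?_, fun X l h1 h2 hl e => ?_⟩
  · refine (h.1 X l h1 h2 hl e).perturb_within (by linarith) hl (by linarith) ?_ hK hC hΞ hΓ
    exact hSB.trans (hBA.trans (root_anti hrn (by linarith) h2 hl e eA))
  · refine (h.2.1 X l h1 h2 hl e).perturb_within (by linarith) hl (by linarith) ?_ hK hC hΞ hΓ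
    exact hSB.trans (root_anti (Nat.succ_ne_zero _) (by linarith) h2 hl e eB)
  · refine (h.2.2 X l h1 h2 hl e).perturb_within (by linarith) hl (by linarith) ?_ hK hC hΞ hΓ
    exact root_anti hrn (by linarith) h2 hl e eS

set_option maxHeartbeats 2000000 in
theorem exists_cycle (κ ν : Type) [Fintype κ] [DecidableEq κ] [Nonempty κ]
    [Fintype ν] [DecidableEq ν] [Nonempty ν] :
    ∃ ρ R₀ K : ℝ, 0 < ρ ∧ ρ ≤ 1 ∧ 2 ≤ R₀ ∧ 1 ≤ K ∧ ∀ (τ : Type) [Fintype τ] [DecidableEq τ]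
      (j₀ j₁ : τ) (δ : ℝ) (s : Stage κ ν τ), (∀ j, j = j₀ ∨ j = j₁) → 0 < δ → s.Good ρ δ j₀ →
      ∃ D : ℕ, 1 ≤ D ∧ ∀ (T : ℕ) (XA LA XB LB : ℝ), 1 ≤ T → (j₀ = j₁ → T = 1) →
        (j₀ ≠ j₁ → 8 ≤ T * δ) → R₀ * s.P ≤ XA → 0 < LA →
        XA ^ (Fintype.card κ + 1) * LA ^ Fintype.card ν =
          s.P ^ (Fintype.card κ + 1) * s.L ^ Fintype.card ν →
        K * (D * LA) ≤ 1 → XA ≤ XB → D * LA * XB ≤ T * XA → 0 < LB →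
        XB ^ Fintype.card κ * LB ^ (Fintype.card ν + 1) =
          XA ^ Fintype.card κ * LA ^ (Fintype.card ν + 1) →
        (j₀ ≠ j₁ → D * (1 + T) * LB ≤ 1 ∧
          (D * LA) ^ Fintype.card κ * (D * (1 + T) * LA) ^ (Fintype.card ν + 1) ≤ 1) →
        ∃ s' : Stage κ ν τ, s'.Good ρ (δ / 2) j₀ ∧ XB ≤ s'.P ∧ T * XA ≤ D * LA * s'.P ∧
          LA * s'.P ≤ T * XA ∧ Within s.Ξ s'.Ξ (K * (s.L / s.P)) ∧
          Within s.Γ s'.Γ (K * (s.L / s.P)) ∧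
          CycleEst s'.Ξ s'.Γ s.P s.L XA LA XB LB s'.P K ∧
          ∀ l, 0 < l → s'.P ^ Fintype.card κ * l ^ Fintype.card ν =
            XB ^ Fintype.card κ * LB ^ Fintype.card ν → l / K ≤ s'.L ∧ s'.L ≤ K * l := by
  obtain ⟨ρs, hρs, hρs1, hW⟩ := exists_full_phase (κ ⊕ Unit) ν
  obtain ⟨ρ₁, hρ₁, hρ₁1, KE, hKE, hE⟩ := exists_extra_phase κ ν hρs
  obtain ⟨ρ, KV, hρ, hρ1, hKV, hV⟩ := exists_kernel_phase κ ν hρ₁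
  obtain ⟨R₀, hR₀, KW, hKW, hW⟩ := hW ρ hρ
  have hcard : Fintype.card (κ ⊕ Unit) = Fintype.card κ + 1 := by simp
  rw [hcard] at hW
  have hrn : Fintype.card ν ≠ 0 := Fintype.card_ne_zero
  set r : ℝ := ((Fintype.card ν : ℕ) : ℝ) with hr
  have hr0 : 0 ≤ r := by positivity
  set m : ℝ := ((Fintype.card (κ ⊕ Unit) : ℕ) : ℝ) with hm
  have hm0 : 0 ≤ m := by positivity
  set C := KV + 2 * r + 4 with hC
  have hC0 : 0 < C := by linarith
  have hmC : 0 ≤ m * C := by positivity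
  set K := (KW + KE + KV) * (1 + m * C) + C with hK
  have hK1 : (KW + KE + KV) * (1 + m * C) ≤ K := by linarith
  have hKWK : KW * (1 + m * C) ≤ K := le_trans (by gcongr; linarith) hK1
  have hKEK : KE * (1 + m * C) ≤ K := le_trans (by gcongr; linarith) hK1
  have hKVK' : KV * (1 + m * C) ≤ K := le_trans (by gcongr; linarith) hK1
  have hKVK : KV ≤ K := le_trans (le_mul_of_one_le_right (by linarith) (by linarith)) hKVK'
  have hCK : C + 2 ≤ K := by
    have : 2 ≤ (KW + KE + KV) * (1 + m * C) := by nlinarith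
    linarith
  refine ⟨ρ, R₀, K, hρ, hρ1, hR₀, by linarith, ?_⟩
  intro τ _ _ j₀ j₁ δ s hj hδ hs
  have hdet0 : (((rc s.Bx).fromRows (rem s.Ξ s.Bx s.By)).submatrix id (eW κ ν)).det ≠ 0 := by
    have h1 := hs.one_le
    have h2 := hs.pos
    have : 0 < s.P ^ (Fintype.card κ + 1) * s.L ^ Fintype.card ν := by positivity
    rw [hs.det] at this
    exact abs_pos.1 this
  obtain ⟨D, hD, hDen⟩ := exists_denominator hs.gen hdet0
  refine ⟨D, hD, ?_⟩
  intro T XA LA XB LB hT hjT hTδ hXA hLA eA hKD hAB hABS hLB eB hη2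
  have hP1 := hs.one_le
  have hL0 := hs.pos
  have hD1 : (1 : ℝ) ≤ D := by exact_mod_cast hD
  have hT1 : (1 : ℝ) ≤ T := by exact_mod_cast hT
  have hPA : s.P ≤ XA := by nlinarith
  have hXA1 : 1 ≤ XA := by linarith
  have hXA0 : 0 < XA := by linarith
  have hA₁ : ∀ i j, |s.A₁ i j| ≤ 1 := by
    intro i j
    by_cases h : i = j₀
    · rw [h]; exact hs.row j
    · exact (hs.rows i h j).trans (by linarith)
  obtain ⟨t, T₀, x₀, y₀, i₀, htj, hti, hT₀1, hT₀2, hu, hdich⟩ :=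
    exists_direction hD hT hDen hj hjT
  have ht1 : ∀ i, |t i| ≤ 1 := by
    intro i
    by_cases h : i = j₀
    · rw [h, htj, abs_one]
    · rw [hti i h, abs_of_pos (by positivity), div_le_one (by linarith)]; exact hT1
  have ht2 : ∀ i, i ≠ j₀ → 4 * |t i| ≤ δ / 2 := by
    intro i h
    have hne : j₀ ≠ j₁ := by
      rintro rfl
      exact h ((hj i).elim id id)
    rw [hti i h, abs_of_pos (by positivity), mul_one_div, div_le_iff₀ (by linarith)]
    linarith [hTδ hne]
  have hBA : LB ≤ LA := root_anti (Nat.succ_ne_zero _) hXA0 hAB hLA rfl eB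
  have hDLA0 : 0 < D * LA := by positivity
  have hDLA : D * LA ≤ 1 := by nlinarith
  have hLAD : LA ≤ D * LA := le_mul_of_one_le_left hLA.le hD1
  have hLA1 : LA ≤ 1 := by linarith
  have hT₀D : 1 / (D : ℝ) ≤ T₀ := le_trans (by gcongr) hT₀1
  have hKLA : K * LA ≤ T₀ := by
    refine le_trans ?_ hT₀D
    rw [le_div_iff₀ (by linarith)]; linarith
  have hLAT : LA ≤ T₀ := le_trans (le_mul_of_one_le_left hLA.le (by linarith)) hKLA
  have hT₀0 : 0 < T₀ := by linarith
  have hABT : LA / XA * XB ≤ T₀ := by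
    refine le_trans ?_ hT₀1
    rw [div_mul_eq_mul_div, div_le_div_iff₀ hXA0 (by linarith)]
    linarith
  obtain ⟨η, hη⟩ : ∃ η : ℝ, η = if j₀ = j₁ then 1 else 1 / ((D : ℝ) * (1 + T)) := ⟨_, rfl⟩
  have hdich' : ∀ x y i, (∃ j : ℤ, wv s.A s.A₁ x y - iv i = ((j : ℝ) * T₀) • t) ∨
      ∀ c : ℝ, η ≤ ‖wv s.A s.A₁ x y - iv i + c • t‖ := by
    intro x y i
    refine (hdich x y i).imp_right fun h => ?_
    rw [hη, if_neg h.1]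
    exact h.2
  have hLBη : LB ≤ η := by
    rw [hη]
    split_ifs with h
    · linarith
    · rw [le_div_iff₀ (by positivity)]
      linarith [(hη2 h).1]
  have hlη : ∀ X l : ℝ, XA ≤ X → X ≤ XB → 0 < l →
      X ^ Fintype.card κ * l ^ (Fintype.card ν + 1) =
        XA ^ Fintype.card κ * LA ^ (Fintype.card ν + 1) → 1 ≤ D * (LA / XA) * X → l ≤ η := by
    intro X l hX hXB hl e h1
    rw [hη]
    split_ifs with h
    · exact (root_anti (Nat.succ_ne_zero _) hXA0 hX hLA rfl e).trans hLA1
    · rw [le_div_iff₀ (by positivity)]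
      have h2 : XA ≤ D * LA * X := by
        have : D * (LA / XA) * X = D * LA * X / XA := by ring
        rwa [this, one_le_div hXA0] at h1
      have h3 := (hη2 h).2
      refine le_of_pow_le_pow_left₀ (n := Fintype.card ν + 1) (Nat.succ_ne_zero _) zero_le_one ?_
      rw [one_pow]
      refine le_trans ?_ h3
      have hX0 : 0 < X ^ Fintype.card κ := by have : 0 < X := by linarith
                                              positivity
      refine le_of_mul_le_mul_left ?_ hX0
      calc X ^ Fintype.card κ * (l * (D * (1 + T))) ^ (Fintype.card ν + 1)
          = (X ^ Fintype.card κ * l ^ (Fintype.card ν + 1)) *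
            (D * (1 + T)) ^ (Fintype.card ν + 1) := by rw [mul_pow]; ring
        _ = XA ^ Fintype.card κ * (LA ^ (Fintype.card ν + 1) *
            (D * (1 + T)) ^ (Fintype.card ν + 1)) := by rw [e]; ring
        _ ≤ (D * LA * X) ^ Fintype.card κ * (LA ^ (Fintype.card ν + 1) *
            (D * (1 + T)) ^ (Fintype.card ν + 1)) := by gcongr
        _ = _ := by rw [mul_pow (D * LA : ℝ) X, mul_pow ((D : ℝ) * (1 + T)) LA]; ring
  obtain ⟨Ξ₁, hΞ₁, hdet₁, hEst₁, hNice₁⟩ := hW τ _ (eW κ ν) s.Ξ s.A s.A₁ s.Bx s.By s.P s.L XA hP1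
    hL0 hXA hs.det hs.nice hs.gen hs.gap hA₁
  obtain ⟨Ξ₂, F, hΞ₂, hF, hF2, hdet₂, hE₂⟩ := hE τ Ξ₁ s.A s.A₁ s.Bx s.By XA LA XB D T₀ η t j₀
    hXA1 hLA hAB (by linarith) (by rw [hdet₁, eA]) (hNice₁ LA hLA eA) hs.gen hA₁ ht1 htj hABT hLAT
    hDLA (fun x y i h => gap_of_denominator hD hDen x y i h) hdich' hlη
  have hF0 : 0 < F (Sum.inr ()) := by rw [hF]; positivity
  obtain ⟨S, hS⟩ : ∃ S, S = T₀ * XA / LA := ⟨_, rfl⟩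
  have hSF : F (Sum.inr ()) * S = T₀ := by
    rw [hF, hS]; field_simp
  have hBS : XB ≤ S := by
    rw [hS, le_div_iff₀ hLA]
    rw [div_mul_eq_mul_div, div_le_iff₀ hXA0] at hABT
    linarith
  have hXB0 : 0 < XB := by linarith
  have hε : LB ≤ F (Sum.inr ()) * XB := by
    rw [hF, div_mul_eq_mul_div, le_div_iff₀ hXA0]
    gcongr
  obtain ⟨Ξ₃, A', A₁', Bx', By', L', hΞ₃, hΓ₃, hrow, hrows, hL', hdet₃, hNice₃, hG₃, hgap₃, hEst₃,
    hLS⟩ := hV τ Ξ₂ s.A s.A₁ s.Bx s.By F XB LB S T₀ η t j₀ x₀ y₀ i₀ (by linarith) hLB hBS hF0 hε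
      hSF (by rw [hF]; exact hF2) (by rw [eMat, hdet₂, eB]) (hE₂ XB LB hAB le_rfl hLB eB).1 hs.gen
      hA₁ (fun i h j => by linarith [hs.rows i h j, ht2 i h]) ht1 htj
      (le_trans (by gcongr) hKLA) hLBη hu hdich'
  have hLX : 0 < LA / XA := by positivity
  have hLXB : LB / XB ≤ LA / XA := by gcongr
  have hLXB0 : 0 < LB / XB := by positivity
  have hLXP : LA / XA ≤ s.L / s.P := by
    have : LA ≤ s.L := root_anti hrn (by linarith) hPA hL0 rfl eA
    gcongr
  have hLXP0 : 0 < s.L / s.P := hLX.trans_le hLXP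
  have hΞ₂' : Within Ξ₁ Ξ₂ (2 * (LA / XA)) := hΞ₂
  have hΞ₃' : Within Ξ₂ Ξ₃ (KV * (LB / XB)) := hΞ₃
  have hΓ₃' : Within (s.A + Matrix.vecMulVec t F + s.A₁ * Ξ₂) (A' + A₁' * Ξ₃)
      (KV * (LB / XB)) := hΓ₃
  have hmulA : ∀ M M' : Matrix ν (κ ⊕ Unit) ℝ, ∀ c, Within M M' c →
      Within (s.A + s.A₁ * M) (s.A + s.A₁ * M') (r * c) := by
    intro M M' c h i j
    have h1 := abs_mul_entry_le zero_le_one hA₁ h i j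
    have h2 : (s.A + s.A₁ * M' - (s.A + s.A₁ * M)) = s.A₁ * (M' - M) := by
      rw [Matrix.mul_sub]; abel
    rw [h2]
    exact h1.trans (by rw [one_mul])
  have hFW : Within (s.A + s.A₁ * Ξ₂) (s.A + Matrix.vecMulVec t F + s.A₁ * Ξ₂)
      (2 * (LA / XA)) := by
    intro i j
    have h2 : (s.A + Matrix.vecMulVec t F + s.A₁ * Ξ₂ - (s.A + s.A₁ * Ξ₂)) =
        Matrix.vecMulVec t F := by abel
    rw [h2, Matrix.vecMulVec_apply, abs_mul]
    exact (mul_le_mul (ht1 i) (hF2 j) (abs_nonneg _) zero_le_one).trans (by rw [one_mul])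
  have hΓ₁₃ := ((hmulA _ _ _ hΞ₂').trans hFW).trans hΓ₃'
  have hΞ₁₃ := hΞ₂'.trans hΞ₃'
  have hKVB : KV * (LB / XB) ≤ KV * (LA / XA) := by gcongr
  have b1 : 2 * (LA / XA) + KV * (LB / XB) ≤ C * (LA / XA) := by
    have : 0 ≤ r * (LA / XA) := by positivity
    rw [hC]; linarith
  have b2 : r * (2 * (LA / XA)) + 2 * (LA / XA) + KV * (LB / XB) ≤ C * (LA / XA) := by
    rw [hC]; linarith
  refine ⟨⟨Ξ₃, A', A₁', Bx', By', S, L'⟩, ⟨by simp only; linarith, hL', hdet₃, hNice₃, hG₃, hgap₃, hrow,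
    fun i h j => ?_⟩, hBS, ?_, ?_, ?_, ?_, ⟨?_, ?_, ?_⟩, ?_⟩
  · simp only
    linarith [hrows i j, hs.rows i h j, ht2 i h]
  · simp only
    rw [hS]
    have : D * LA * (T₀ * XA / LA) = D * T₀ * XA := by field_simp
    rw [this]
    gcongr
    rw [div_le_iff₀ (by linarith)] at hT₀1
    linarith
  · simp only
    rw [hS, mul_div_cancel₀ _ hLA.ne']
    gcongr
  · have hΞ₁' : Within s.Ξ Ξ₁ (2 * (s.L / s.P)) := hΞ₁
    refine (hΞ₁'.trans hΞ₁₃).mono ?_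
    calc _ ≤ 2 * (s.L / s.P) + C * (s.L / s.P) := by
          refine add_le_add_right (b1.trans ?_) _
          gcongr
      _ = (C + 2) * (s.L / s.P) := by ring
      _ ≤ _ := by gcongr
  · have hΞ₁' : Within s.Ξ Ξ₁ (2 * (s.L / s.P)) := hΞ₁
    refine ((hmulA _ _ _ hΞ₁').trans hΓ₁₃).mono ?_
    calc _ ≤ r * (2 * (s.L / s.P)) + C * (s.L / s.P) := by
          refine add_le_add_right (b2.trans ?_) _
          gcongr
      _ = (2 * r + C) * (s.L / s.P) := by ring
      _ ≤ _ := by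
        gcongr
        have : 1 * (C : ℝ) ≤ m * C := by
          gcongr
          rw [hm, hcard]; push_cast; linarith [(Nat.cast_nonneg (Fintype.card κ) : (0:ℝ) ≤ _)]
        have h3 : 2 * (1 + m * C) ≤ (KW + KE + KV) * (1 + m * C) := by gcongr; linarith
        linarith
  · intro X l hX hXA' hl e
    have hX0 : 0 < X := by linarith
    have := (hEst₁ X l hX hXA' hl e).perturb_within hX0 hl hXA'
      (root_anti hrn hX0 hXA' hl e eA) (by linarith) hC0.le (hΞ₁₃.mono b1) (hΓ₁₃.mono b2)
    exact this.mono_const hX0.le hl.le (by positivity) hKWK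
  · intro X l hX hXB' hl e
    have hX0 : 0 < X := by linarith
    have b3 : KV * (LB / XB) ≤ C * (LB / XB) := by gcongr; linarith
    have := (hE₂ X l hX hXB' hl e).2.perturb_within hX0 hl hXB'
      (root_anti (Nat.succ_ne_zero _) hX0 hXB' hl e eB) (by linarith) hC0.le (hΞ₃'.mono b3)
      (hΓ₃'.mono b3)
    exact this.mono_const hX0.le hl.le (by positivity) hKEK
  · intro X l hX hXS hl e
    exact (hEst₃ X l hX hXS hl e).mono_const (by linarith) hl.le (by linarith) hKVK
  · intro l hl e
    obtain ⟨h1, h2⟩ := hLS l hl e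
    simp only
    constructor
    · refine le_trans ?_ h1
      gcongr
    · exact h2.trans (by gcongr)

/-- The height of an integer vector. -/
def ht {m : ℕ} (u : Fin m → ℤ) : ℕ := Finset.univ.sup fun j => (u j).natAbs

lemma norm_eq_ht {m : ℕ} (u : Fin m → ℤ) : ‖(fun j => (u j : ℝ))‖ = ht u := by
  apply le_antisymm
  · rw [pi_norm_le_iff_of_nonneg (by positivity)]
    intro j
    have : (u j).natAbs ≤ ht u := Finset.le_sup (f := fun j => (u j).natAbs) (Finset.mem_univ j)
    rw [Real.norm_eq_abs, ← Int.cast_abs, Int.abs_eq_natAbs]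
    exact_mod_cast this
  · rcases m.eq_zero_or_pos with rfl | hm
    · simp [ht]
    · have : Nonempty (Fin m) := ⟨⟨0, hm⟩⟩
      obtain ⟨j, -, hj⟩ := Finset.exists_mem_eq_sup Finset.univ Finset.univ_nonempty
        (fun j => (u j).natAbs)
      have h := norm_le_pi_norm (fun j => (u j : ℝ)) j
      rw [Real.norm_eq_abs, ← Int.cast_abs, Int.abs_eq_natAbs] at h
      rw [ht, hj]
      rw [Int.cast_natCast] at h
      exact h

/-- The nearest integer vector. -/
noncomputable def nearest {m n : ℕ} (ξ : Matrix (Fin n) (Fin m) ℝ) (u : Fin m → ℤ) : Fin n → ℤ :=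
  fun k => round (ξ.mulVec (fun j => (u j : ℝ)) k)

/-- The distance of `ξ u` to the nearest integer vector. -/
noncomputable def err {m n : ℕ} (ξ : Matrix (Fin n) (Fin m) ℝ) (u : Fin m → ℤ) : ℝ :=
  ‖ξ.mulVec (fun j => (u j : ℝ)) - (fun k => (nearest ξ u k : ℝ))‖

lemma err_le {m n : ℕ} (ξ : Matrix (Fin n) (Fin m) ℝ) (u : Fin m → ℤ) (v : Fin n → ℤ) :
    err ξ u ≤ ‖ξ.mulVec (fun j => (u j : ℝ)) - (fun k => (v k : ℝ))‖ := by
  rw [err, pi_norm_le_iff_of_nonneg (norm_nonneg _)]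
  intro k
  refine le_trans ?_ (norm_le_pi_norm _ k)
  simp only [Pi.sub_apply, Real.norm_eq_abs, nearest]
  exact round_le _ _

lemma err_le_half {m n : ℕ} (ξ : Matrix (Fin n) (Fin m) ℝ) (u : Fin m → ℤ) :
    err ξ u ≤ 1 / 2 := by
  rw [err, pi_norm_le_iff_of_nonneg (by norm_num)]
  intro k
  simpa [nearest] using abs_sub_round (ξ.mulVec (fun j => (u j : ℝ)) k)

lemma finite_ht_le {m : ℕ} (N : ℕ) : {u : Fin m → ℤ | ht u ≤ N}.Finite := by
  refine (Set.finite_Icc (fun _ => -(N : ℤ)) (fun _ => (N : ℤ))).subset fun u hu => ?_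
  have h : ∀ j, (u j).natAbs ≤ N := fun j =>
    (Finset.le_sup (f := fun j => (u j).natAbs) (Finset.mem_univ j)).trans hu
  constructor <;> intro j <;> have := h j <;> simp only <;> omega

lemma exists_next {m n : ℕ} (ξ : Matrix (Fin n) (Fin m) ℝ) {t : ℝ}
    (ht0 : ∃ u : Fin m → ℤ, u ≠ 0 ∧ err ξ u < t) :
    ∃ u : Fin m → ℤ, u ≠ 0 ∧ err ξ u < t ∧ (∀ w : Fin m → ℤ, w ≠ 0 → ht w < ht u → t ≤ err ξ w) ∧
      ∀ w : Fin m → ℤ, w ≠ 0 → ht w ≤ ht u → err ξ u ≤ err ξ w := by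
  obtain ⟨u₀, ⟨hu₀, he₀⟩, hmin⟩ := (measure (ht (m := m))).wf.has_min
    {u : Fin m → ℤ | u ≠ 0 ∧ err ξ u < t} ht0
  obtain ⟨u, ⟨hu, hu1⟩, hu2⟩ := Set.exists_min_image {u : Fin m → ℤ | u ≠ 0 ∧ ht u ≤ ht u₀} (err ξ)
    ((finite_ht_le (ht u₀)).subset fun u hu => hu.2) ⟨u₀, hu₀, le_rfl⟩
  have hut : err ξ u < t := (hu2 u₀ ⟨hu₀, le_rfl⟩).trans_lt he₀
  refine ⟨u, hu, hut, fun w hw h => ?_, fun w hw h => hu2 w ⟨hw, h.trans hu1⟩⟩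
  by_contra hc
  exact hmin w ⟨hw, not_le.1 hc⟩ (h.trans_le hu1)

theorem exists_bestApproxSeq {m n : ℕ} (hm : 0 < m) (ξ : Matrix (Fin n) (Fin m) ℝ)
    (hpos : ∀ u : Fin m → ℤ, u ≠ 0 → 0 < err ξ u)
    (hsmall : ∀ t : ℝ, 0 < t → ∃ u : Fin m → ℤ, u ≠ 0 ∧ err ξ u < t) :
    ∃ (x : ℕ → Fin m → ℤ) (y : ℕ → Fin n → ℤ), IsBestApproxSeq ξ x y ∧
      ∀ i, Lval ξ x y i = err ξ (x i) := by
  choose! f hf0 hf1 hf2 hf3 using fun (t : ℝ) (ht : 0 < t) => exists_next ξ (hsmall t ht)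
  let S : ℕ → {u : Fin m → ℤ // u ≠ 0} := fun i => Nat.rec ⟨f 1, hf0 1 one_pos⟩
    (fun _ u => ⟨f (err ξ u.1), hf0 _ (hpos _ u.2)⟩) i
  have hS : ∀ i, (S (i + 1)).1 = f (err ξ (S i).1) := fun i => rfl
  have hmin : ∀ i, ∀ w : Fin m → ℤ, w ≠ 0 → ht w ≤ ht (S i).1 → err ξ (S i).1 ≤ err ξ w := by
    intro i
    cases i with
    | zero => exact hf3 1 one_pos
    | succ i => exact hf3 _ (hpos _ (S i).2)
  have hlt : ∀ i, err ξ (S (i + 1)).1 < err ξ (S i).1 := fun i => by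
    rw [hS]; exact hf1 _ (hpos _ (S i).2)
  have hht : ∀ i, ht (S i).1 < ht (S (i + 1)).1 := fun i => by
    by_contra hc
    exact absurd (hmin i _ (S (i + 1)).2 (not_lt.1 hc)) (not_le.2 (hlt i))
  have hX : ∀ i, Xval (fun i => (S i).1) i = ht (S i).1 := fun i => norm_eq_ht _
  refine ⟨fun i => (S i).1, fun i => nearest ξ (S i).1,
    ⟨fun i => (S i).2, ?_, ?_, ?_, ?_⟩, fun i => rfl⟩
  · rw [hX]
    let e : Fin m → ℤ := fun _ => 1
    have he : e ≠ 0 := fun h => one_ne_zero (congrFun h ⟨0, hm⟩)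
    have h1 : ht e ≤ 1 := Finset.sup_le fun j _ => by simp [e]
    have h2 : ht (S 0).1 ≤ 1 := by
      by_contra hc
      have := hf2 1 one_pos e he (h1.trans_lt (not_le.1 hc))
      have := err_le_half ξ e
      linarith
    have h3 : ht (S 0).1 ≠ 0 := fun h => (S 0).2 <| by
      ext j
      have : ((S 0).1 j).natAbs ≤ ht (S 0).1 :=
        Finset.le_sup (f := fun j => ((S 0).1 j).natAbs) (Finset.mem_univ j)
      rw [h] at this
      simpa using this
    have : ht (S 0).1 = 1 := by omega
    rw [this]; simp
  · refine strictMono_nat_of_lt_succ fun i => ?_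
    rw [hX, hX]
    exact_mod_cast hht i
  · exact strictAnti_nat_of_succ_lt hlt
  · intro i u v hu h
    rw [hX, norm_eq_ht] at h
    have h : ht u < ht (S (i + 1)).1 := by exact_mod_cast h
    exact (hf2 _ (hpos _ (S i).2) u hu h).trans (err_le ξ u v)

/-- At height `exp x` the minimal distance is comparable to `exp (-F x)`, for all `x ≥ 0`. -/
def ScaledBy {m n : ℕ} (ξ : Matrix (Fin n) (Fin m) ℝ) (F : ℝ → ℝ) (c : ℝ) : Prop :=
  ∀ x : ℝ, 0 ≤ x →
    (∀ u : Fin m → ℤ, u ≠ 0 → ∀ v : Fin n → ℤ, ‖(fun j => (u j : ℝ))‖ < Real.exp (x - c) →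
      Real.exp (-F x - c) ≤ ‖ξ.mulVec (fun j => (u j : ℝ)) - (fun k => (v k : ℝ))‖) ∧
    ∃ u : Fin m → ℤ, u ≠ 0 ∧ ∃ v : Fin n → ℤ, ‖(fun j => (u j : ℝ))‖ ≤ Real.exp (x + c) ∧
      ‖ξ.mulVec (fun j => (u j : ℝ)) - (fun k => (v k : ℝ))‖ ≤ Real.exp (-F x + c)

lemma one_le_ht {m : ℕ} {u : Fin m → ℤ} (hu : u ≠ 0) : 1 ≤ ht u := by
  obtain ⟨j, hj⟩ := Function.ne_iff.mp hu
  have : (u j).natAbs ≤ ht u := Finset.le_sup (f := fun j => (u j).natAbs) (Finset.mem_univ j)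
  have : (u j).natAbs ≠ 0 := Int.natAbs_ne_zero.2 hj
  omega

lemma ScaledBy.pos {m n : ℕ} {ξ : Matrix (Fin n) (Fin m) ℝ} {F : ℝ → ℝ} {c : ℝ}
    (h : ScaledBy ξ F c) {u : Fin m → ℤ} (hu : u ≠ 0) (v : Fin n → ℤ) :
    0 < ‖ξ.mulVec (fun j => (u j : ℝ)) - (fun k => (v k : ℝ))‖ := by
  have h1 : (1 : ℝ) ≤ ht u := by exact_mod_cast one_le_ht hu
  refine lt_of_lt_of_le (Real.exp_pos _)
    ((h (max 0 (Real.log (ht u) + 1 + c)) (le_max_left _ _)).1 u hu v ?_)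
  rw [norm_eq_ht]
  calc (ht u : ℝ) = Real.exp (Real.log (ht u)) := (Real.exp_log (by linarith)).symm
    _ < _ := Real.exp_lt_exp.2 (by linarith [le_max_right 0 (Real.log (ht u) + 1 + c)])

theorem ScaledBy.exists_seq {m n : ℕ} (hm : 0 < m) {ξ : Matrix (Fin n) (Fin m) ℝ} {F : ℝ → ℝ}
    {c ω : ℝ} (h : ScaledBy ξ F c) (hc : 0 ≤ c) (hω : 0 < ω)
    (hgrow : ∃ A, 0 ≤ A ∧ ∀ x, 0 ≤ x → F (x + (c + 1)) + 2 * c < F (x + A))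
    (hdouble : ∃ B, ∀ x, 0 ≤ x → F (x + 2 * (c + 1)) ≤ F x + B)
    (hlow : ∀ ε, 0 < ε → ∀ᶠ x in atTop, (ω - ε) * x ≤ F x)
    (hupp : ∀ ε, 0 < ε → ∃ᶠ x in atTop, F x ≤ (ω + ε) * x)
    (hbad : ∀ C : ℝ, ∃ x, 0 ≤ x ∧ m * x - n * F x < C) :
    ∃ (x : ℕ → Fin m → ℤ) (y : ℕ → Fin n → ℤ),
      TotallyIrrational ξ ∧ IsBestApproxSeq ξ x y ∧ PropB x ∧ PropC ξ x y ∧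
      ¬ PropA ξ ∧ unifExp ξ x y = (ω : EReal) := by
  have hFtop : Tendsto F atTop atTop := by
    refine tendsto_atTop_mono' atTop (hlow (ω / 2) (by linarith)) ?_
    exact tendsto_id.const_mul_atTop (by linarith)
  have herr0 : ∀ u : Fin m → ℤ, u ≠ 0 → 0 < err ξ u := fun u hu => h.pos hu _
  have hsmall : ∀ t : ℝ, 0 < t → ∃ u : Fin m → ℤ, u ≠ 0 ∧ err ξ u < t := by
    intro t ht
    obtain ⟨x, hx, hx0⟩ := ((hFtop.eventually_gt_atTop (c - Real.log t)).and
      (eventually_ge_atTop 0)).exists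
    obtain ⟨u, hu, v, -, hv⟩ := (h x hx0).2
    refine ⟨u, hu, (err_le ξ u v).trans_lt (hv.trans_lt ?_)⟩
    rw [← Real.lt_log_iff_exp_lt ht]
    linarith
  obtain ⟨x, y, hbest, hL⟩ := exists_bestApproxSeq hm ξ herr0 hsmall
  obtain ⟨p, hp⟩ : ∃ p : ℕ → ℝ, ∀ i, p i = Real.log (Xval x i) := ⟨_, fun _ => rfl⟩
  obtain ⟨e, he⟩ : ∃ e : ℕ → ℝ, ∀ i, e i = -Real.log (Lval ξ x y i) := ⟨_, fun _ => rfl⟩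
  have hX1 : ∀ i, 1 ≤ Xval x i := fun i => by
    rw [Xval, norm_eq_ht]; exact_mod_cast one_le_ht (hbest.nonzero i)
  have hXp : ∀ i, Xval x i = Real.exp (p i) := fun i => by
    rw [hp, Real.exp_log (by linarith [hX1 i])]
  have hL0 : ∀ i, 0 < Lval ξ x y i := fun i => by rw [hL]; exact herr0 _ (hbest.nonzero i)
  have hLe : ∀ i, Lval ξ x y i = Real.exp (-e i) := fun i => by
    rw [he, neg_neg, Real.exp_log (hL0 i)]
  have hp0 : ∀ i, 0 ≤ p i := fun i => by rw [hp]; exact Real.log_nonneg (hX1 i)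
  have he0 : ∀ i, 0 ≤ e i := fun i => by
    rw [he, neg_nonneg]
    refine Real.log_nonpos (hL0 i).le ?_
    rw [hL]; linarith [err_le_half ξ (x i)]
  have hupper : ∀ i z, 0 ≤ z → p i < z - c → e i ≤ F z + c := by
    intro i z hz hi
    have := (h z hz).1 (x i) (hbest.nonzero i) (y i) (by
      change Xval x i < _
      rw [hXp]; exact Real.exp_lt_exp.2 hi)
    change _ ≤ Lval ξ x y i at this
    rw [hLe, Real.exp_le_exp] at this
    linarith
  have hlower : ∀ i z, 0 ≤ z → z + c < p (i + 1) → F z - c ≤ e i := by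
    intro i z hz hi
    obtain ⟨u, hu, v, hu1, hv⟩ := (h z hz).2
    have := (hbest.best i u v hu (hu1.trans_lt (by rw [hXp]; exact Real.exp_lt_exp.2 hi))).trans hv
    rw [hLe, Real.exp_le_exp] at this
    linarith
  have hpmono : StrictMono p := fun i j hij => by
    have := hbest.xStrictMono hij
    rw [hXp, hXp, Real.exp_lt_exp] at this
    exact this
  have hptop : Tendsto p atTop atTop := by
    have hmono : StrictMono fun i => ht (x i) := fun i j hij => by
      have := hbest.xStrictMono hij
      rw [Xval, Xval, norm_eq_ht, norm_eq_ht] at this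
      exact_mod_cast this
    have : p = fun i => Real.log (ht (x i)) := by
      funext i; rw [hp, Xval, norm_eq_ht]
    rw [this]
    exact Real.tendsto_log_atTop.comp (tendsto_natCast_atTop_atTop.comp hmono.tendsto_atTop)
  refine ⟨x, y, ?_, hbest, ?_, ?_, ?_, ?_⟩
  · intro u v huv
    by_cases hu : u = 0
    · subst hu
      have hv : v ≠ 0 := fun hv => huv (by rw [hv]; rfl)
      rw [norm_pos_iff]
      intro h0
      obtain ⟨k, hk⟩ := Function.ne_iff.mp hv
      have h1 : (fun j => (((0 : Fin m → ℤ) j : ℤ) : ℝ)) = 0 := by ext; simp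
      rw [h1, Matrix.mulVec_zero] at h0
      have := congrFun h0 k
      simp only [Pi.sub_apply, Pi.zero_apply, zero_sub, neg_eq_zero, Int.cast_eq_zero] at this
      exact hk this
    · exact h.pos hu v
  · obtain ⟨A, hA0, hA⟩ := hgrow
    refine ⟨Real.exp (A + c), fun i => ?_⟩
    rw [hXp, hXp, ← Real.exp_sub, Real.exp_le_exp]
    by_contra! hcon
    have h1 := hlower i (p i + A) (by linarith [hp0 i]) (by linarith)
    have h2 := hupper i (p i + (c + 1)) (by linarith [hp0 i]) (by linarith)
    linarith [hA (p i) (hp0 i)]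
  · obtain ⟨B, hB⟩ := hdouble
    refine ⟨Real.exp (max (B + 2 * c) (F 0 + B + c)), fun i => ?_⟩
    rw [hLe, hLe, ← Real.exp_sub, Real.exp_le_exp]
    rcases le_or_gt (c + 1) (p (i + 1)) with h1 | h1
    · have h2 := hlower i (p (i + 1) - (c + 1)) (by linarith) (by linarith)
      have h3 := hupper (i + 1) (p (i + 1) - (c + 1) + 2 * (c + 1)) (by linarith) (by linarith)
      refine le_trans ?_ (le_max_left _ _)
      linarith [hB (p (i + 1) - (c + 1)) (by linarith)]
    · have h3 := hupper (i + 1) (0 + 2 * (c + 1)) (by linarith) (by linarith)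
      refine le_trans ?_ (le_max_right _ _)
      linarith [hB 0 le_rfl, he0 i]
  · rintro ⟨a, ha, hA⟩
    obtain ⟨z, hz, hz'⟩ := hbad (Real.log a - (m + n) * c)
    obtain ⟨u, hu, v, hu1, hv⟩ := (h z hz).2
    have h1 := (hA u v hu).trans (mul_le_mul (pow_le_pow_left₀ (norm_nonneg _) hu1 m)
      (pow_le_pow_left₀ (norm_nonneg _) hv n) (by positivity) (by positivity))
    rw [← Real.exp_nat_mul, ← Real.exp_nat_mul, ← Real.exp_add, ← Real.log_le_iff_le_exp ha] at h1
    linarith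
  · have hrat : ∀ i, -Real.log (Lval ξ x y i) / Real.log (Xval x (i + 1)) = e i / p (i + 1) :=
      fun i => by rw [he, hp]
    have hp' : Tendsto (fun i => p (i + 1)) atTop atTop := hptop.comp (tendsto_add_atTop_nat 1)
    simp only [unifExp, hrat]
    apply le_antisymm
    · refine le_of_forall_gt_imp_ge_of_dense fun b hb => ?_
      obtain ⟨q, hq1, hq2⟩ := EReal.lt_iff_exists_real_btwn.1 hb
      have hq1 : ω < q := by exact_mod_cast hq1
      refine le_trans (liminf_le_of_frequently_le ?_) hq2.le
      rw [frequently_atTop]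
      intro N
      obtain ⟨ε, hε⟩ : ∃ ε, ε = (q - ω) / 2 := ⟨_, rfl⟩
      have hε0 : 0 < ε := by linarith
      obtain ⟨z, hz, hz1, hz2⟩ := ((hupp ε hε0).and_eventually ((eventually_gt_atTop (p N + c)).and
        (eventually_ge_atTop (c + ((ω + ε) * c + c) / ε)))).exists
      have hex : ∃ j, z - c ≤ p j := (hptop.eventually_ge_atTop (z - c)).exists
      classical
      have hj := Nat.find_spec hex
      have hjm := fun i => Nat.find_min hex (m := i)
      generalize Nat.find hex = j at hj hjm
      have hNj : N < j := by
        by_contra hcon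
        have := hpmono.monotone (not_lt.1 hcon)
        linarith
      obtain ⟨i, rfl⟩ : ∃ i, j = i + 1 := ⟨j - 1, by omega⟩
      refine ⟨i, by omega, ?_⟩
      have h1 : p i < z - c := not_le.1 (hjm i (by omega))
      have h2 := hupper i z (by linarith [hp0 N]) h1
      have h3 : ((ω + ε) * c + c) / ε ≤ z - c := by linarith
      rw [div_le_iff₀ hε0] at h3
      have h4 : 0 < p (i + 1) := lt_of_le_of_lt (hp0 i) (hpmono (Nat.lt_succ_self i))
      rw [EReal.coe_le_coe_iff, div_le_iff₀ h4]
      have h5 : (ω + ε) * z ≤ (ω + ε) * (p (i + 1) + c) := by gcongr; linarith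
      have h6 : (z - c) * ε ≤ p (i + 1) * ε := by gcongr
      have : q = ω + 2 * ε := by linarith
      rw [this]
      linarith
    · refine le_of_forall_lt_imp_le_of_dense fun b hb => ?_
      obtain ⟨q, hq1, hq2⟩ := EReal.lt_iff_exists_real_btwn.1 hb
      have hq2 : q < ω := by exact_mod_cast hq2
      refine hq1.le.trans ?_
      obtain ⟨ε, hε⟩ : ∃ ε, ε = (ω - q) / 2 := ⟨_, rfl⟩
      have hε0 : 0 < ε := by linarith
      refine le_liminf_of_le (by isBoundedDefault) ?_
      have ht : Tendsto (fun i => p (i + 1) - (c + 1)) atTop atTop :=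
        tendsto_atTop_add_const_right _ _ hp'
      filter_upwards [ht.eventually (hlow ε hε0), ht.eventually_ge_atTop 0,
        hp'.eventually_ge_atTop ((ω * (c + 1) + c) / ε)] with i h1 h2 h3
      have h4 := hlower i _ h2 (by linarith)
      rw [div_le_iff₀ hε0] at h3
      have h5 : 0 < p (i + 1) := by linarith
      rw [EReal.coe_le_coe_iff, le_div_iff₀ h5]
      have h6 : 0 ≤ ε * (c + 1) := by positivity
      have : q = ω - 2 * ε := by linarith
      rw [this]
      linarith

open Topology

/-- A piecewise linear function with value `Y` at `p`, and slopes `σ₁` up to `a`, then `σ₂` up to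
`b`, then `σ₃`. -/
def piece (σ₁ σ₂ σ₃ p a b Y x : ℝ) : ℝ :=
  Y + σ₁ * (min x a - p) + σ₂ * (min (max x a) b - a) + σ₃ * (max x b - b)

lemma piece_slope {σ₁ σ₂ σ₃ p a b Y x x' : ℝ} (h2 : σ₂ ≤ σ₃) (h1 : σ₃ ≤ σ₁) (hab : a ≤ b)
    (hx : x ≤ x') :
    σ₂ * (x' - x) ≤ piece σ₁ σ₂ σ₃ p a b Y x' - piece σ₁ σ₂ σ₃ p a b Y x ∧
    piece σ₁ σ₂ σ₃ p a b Y x' - piece σ₁ σ₂ σ₃ p a b Y x ≤ σ₁ * (x' - x) := by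
  have key : ∀ z, min z a + min (max z a) b + max z b = z + a + b := by
    intro z
    rcases le_total z a with h | h
    · rw [min_eq_left h, max_eq_right h, min_eq_left hab, max_eq_right (h.trans hab)]
    · rw [min_eq_right h, max_eq_left h]
      rcases le_total z b with h' | h'
      · rw [min_eq_left h', max_eq_right h']; ring
      · rw [min_eq_right h', max_eq_left h']; ring
  have d1 : min x a ≤ min x' a := min_le_min_right _ hx
  have d2 : min (max x a) b ≤ min (max x' a) b := min_le_min_right _ (max_le_max_right _ hx)
  have d3 : max x b ≤ max x' b := max_le_max_right _ hx
  have k1 := key x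
  have k2 := key x'
  obtain ⟨u, hu⟩ : ∃ u, u = min x' a - min x a := ⟨_, rfl⟩
  obtain ⟨v, hv⟩ : ∃ v, v = max x' b - max x b := ⟨_, rfl⟩
  obtain ⟨w, hw⟩ : ∃ w, w = min (max x' a) b - min (max x a) b := ⟨_, rfl⟩
  have e : piece σ₁ σ₂ σ₃ p a b Y x' - piece σ₁ σ₂ σ₃ p a b Y x = σ₁ * u + σ₂ * w + σ₃ * v := by
    rw [piece, piece, hu, hv, hw]; ring
  have e' : x' - x = u + w + v := by linarith
  have hu0 : 0 ≤ u := by linarith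
  have hv0 : 0 ≤ v := by linarith
  have hw0 : 0 ≤ w := by linarith
  have i1 : σ₂ * u ≤ σ₁ * u := by gcongr; linarith
  have i2 : σ₂ * v ≤ σ₃ * v := by gcongr
  have i3 : σ₃ * v ≤ σ₁ * v := by gcongr
  have i4 : σ₂ * w ≤ σ₁ * w := by gcongr; linarith
  rw [e, e', mul_add, mul_add, mul_add, mul_add]
  constructor <;> linarith

lemma piece_first {σ₁ σ₂ σ₃ p a b Y x : ℝ} (hx : x ≤ a) (hab : a ≤ b) :
    piece σ₁ σ₂ σ₃ p a b Y x = Y + σ₁ * (x - p) := by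
  rw [piece, min_eq_left hx, max_eq_right hx, min_eq_left hab, max_eq_right (hx.trans hab)]; ring

lemma piece_second {σ₁ σ₂ σ₃ p a b Y x : ℝ} (hx : a ≤ x) (hxb : x ≤ b) :
    piece σ₁ σ₂ σ₃ p a b Y x = Y + σ₁ * (a - p) + σ₂ * (x - a) := by
  rw [piece, min_eq_right hx, max_eq_left hx, min_eq_left hxb, max_eq_right hxb]; ring

lemma piece_third {σ₁ σ₂ σ₃ p a b Y x : ℝ} (hab : a ≤ b) (hx : b ≤ x) :
    piece σ₁ σ₂ σ₃ p a b Y x = Y + σ₁ * (a - p) + σ₂ * (b - a) + σ₃ * (x - b) := by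
  rw [piece, min_eq_right (hab.trans hx), max_eq_left (hab.trans hx), min_eq_right hx,
    max_eq_left hx]

/-- The logarithmic data of an infinite sequence of cycles with limiting proportions `β`, `γ`. -/
structure Profile (σ₁ σ₂ σ₃ β γ c W : ℝ) (p a b Y : ℕ → ℝ) : Prop where
  p_zero : p 0 = 0
  p_a : ∀ j, p j + W ≤ a j
  a_b : ∀ j, a j ≤ b j
  b_p : ∀ j, b j ≤ p (j + 1)
  jump : ∀ j, |Y (j + 1) - piece σ₁ σ₂ σ₃ (p j) (a j) (b j) (Y j) (p (j + 1))| ≤ c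
  tendsto_p : Tendsto (fun j => p j / a j) atTop (𝓝 0)
  tendsto_Y : Tendsto (fun j => Y j / a j) atTop (𝓝 0)
  tendsto_b : Tendsto (fun j => b j / a j) atTop (𝓝 β)
  tendsto_p_succ : Tendsto (fun j => p (j + 1) / a j) atTop (𝓝 γ)

namespace Profile

variable {σ₁ σ₂ σ₃ β γ c W : ℝ} {p a b Y : ℕ → ℝ}

lemma step (h : Profile σ₁ σ₂ σ₃ β γ c W p a b Y) (j : ℕ) : p j + W ≤ p (j + 1) :=
  (h.p_a j).trans ((h.a_b j).trans (h.b_p j))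

lemma nat_mul_le (h : Profile σ₁ σ₂ σ₃ β γ c W p a b Y) (j : ℕ) : j * W ≤ p j := by
  induction j with
  | zero => simp [h.p_zero]
  | succ j ih => push_cast; linarith [h.step j]

lemma tendsto_p_atTop (h : Profile σ₁ σ₂ σ₃ β γ c W p a b Y) (hW : 0 < W) :
    Tendsto p atTop atTop :=
  tendsto_atTop_mono h.nat_mul_le (tendsto_natCast_atTop_atTop.atTop_mul_const hW)

lemma tendsto_a_atTop (h : Profile σ₁ σ₂ σ₃ β γ c W p a b Y) (hW : 0 < W) :
    Tendsto a atTop atTop :=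
  tendsto_atTop_mono (fun j => by linarith [h.p_a j]) (h.tendsto_p_atTop hW)

lemma p_mono (h : Profile σ₁ σ₂ σ₃ β γ c W p a b Y) (hW : 0 < W) : Monotone p :=
  monotone_nat_of_le_succ fun j => by linarith [h.step j]

lemma exists_index (h : Profile σ₁ σ₂ σ₃ β γ c W p a b Y) (hW : 0 < W) {x : ℝ} (hx : 0 ≤ x) :
    ∃ j, p j ≤ x ∧ x < p (j + 1) := by
  have hex : ∃ j, x < p j := ((h.tendsto_p_atTop hW).eventually_gt_atTop x).exists
  classical
  have hj := Nat.find_spec hex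
  have hjm := fun i => Nat.find_min hex (m := i)
  generalize Nat.find hex = j at hj hjm
  have : j ≠ 0 := fun h0 => by rw [h0, h.p_zero] at hj; linarith
  obtain ⟨i, rfl⟩ := Nat.exists_eq_succ_of_ne_zero this
  exact ⟨i, not_lt.1 (hjm i (Nat.lt_succ_self i)), hj⟩

open Classical in
/-- The index of the cycle containing `x`. -/
noncomputable def index (p : ℕ → ℝ) (x : ℝ) : ℕ :=
  if h : ∃ j, p j ≤ x ∧ x < p (j + 1) then h.choose else 0

lemma index_spec (h : Profile σ₁ σ₂ σ₃ β γ c W p a b Y) (hW : 0 < W) {x : ℝ} (hx : 0 ≤ x) :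
    p (index p x) ≤ x ∧ x < p (index p x + 1) := by
  have hex := h.exists_index hW hx
  rw [index, dif_pos hex]
  exact hex.choose_spec

lemma index_eq (h : Profile σ₁ σ₂ σ₃ β γ c W p a b Y) (hW : 0 < W) {x : ℝ} (hx : 0 ≤ x) {j : ℕ}
    (h1 : p j ≤ x) (h2 : x < p (j + 1)) : index p x = j := by
  obtain ⟨h3, h4⟩ := h.index_spec hW hx
  have hm := h.p_mono hW
  have l1 : j < index p x + 1 := by
    by_contra hc
    linarith [hm (not_lt.1 hc)]
  have l2 : index p x < j + 1 := by
    by_contra hc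
    linarith [hm (not_lt.1 hc)]
  omega

/-- The function described by a profile. -/
noncomputable def fn (σ₁ σ₂ σ₃ : ℝ) (p a b Y : ℕ → ℝ) (x : ℝ) : ℝ :=
  piece σ₁ σ₂ σ₃ (p (index p x)) (a (index p x)) (b (index p x)) (Y (index p x)) x

lemma piece_left (h : Profile σ₁ σ₂ σ₃ β γ c W p a b Y) (hW : 0 < W) (j : ℕ) :
    piece σ₁ σ₂ σ₃ (p j) (a j) (b j) (Y j) (p j) = Y j := by
  rw [piece_first (by linarith [h.p_a j]) (h.a_b j)]; ring

lemma fn_close (h : Profile σ₁ σ₂ σ₃ β γ c W p a b Y) (hW : 0 < W) (hc : 0 ≤ c) {x : ℝ} {j : ℕ}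
    (h1 : p j ≤ x) (h2 : x ≤ p (j + 1)) :
    |fn σ₁ σ₂ σ₃ p a b Y x - piece σ₁ σ₂ σ₃ (p j) (a j) (b j) (Y j) x| ≤ c := by
  have hp0 : ∀ j, 0 ≤ p j := fun j => by rw [← h.p_zero]; exact h.p_mono hW (Nat.zero_le j)
  have hx : 0 ≤ x := (hp0 j).trans h1
  rcases h2.lt_or_eq with h2 | h2
  · rw [fn, h.index_eq hW hx h1 h2]; simpa using hc
  · rw [fn, h.index_eq hW hx h2.ge (by rw [h2]; linarith [h.step (j + 1)]), h2, h.piece_left hW]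
    exact h.jump j

lemma fn_slope (h : Profile σ₁ σ₂ σ₃ β γ c W p a b Y) (hW : 0 < W) (hc : 0 ≤ c) (h2 : σ₂ ≤ σ₃)
    (h1 : σ₃ ≤ σ₁) {x x' : ℝ} (hx : 0 ≤ x) (hxx : x ≤ x') (hxW : x' ≤ x + W) :
    σ₂ * (x' - x) - c ≤ fn σ₁ σ₂ σ₃ p a b Y x' - fn σ₁ σ₂ σ₃ p a b Y x ∧
    fn σ₁ σ₂ σ₃ p a b Y x' - fn σ₁ σ₂ σ₃ p a b Y x ≤ σ₁ * (x' - x) + c := by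
  obtain ⟨i1, i2⟩ := h.index_spec hW hx
  obtain ⟨k1, k2⟩ := h.index_spec hW (hx.trans hxx)
  have hm := h.p_mono hW
  have l1 : index p x < index p x' + 1 := by
    by_contra hcon
    linarith [hm (not_lt.1 hcon)]
  have l2 : index p x' < index p x + 2 := by
    by_contra hcon
    linarith [hm (not_lt.1 hcon), h.step (index p x + 1)]
  rw [fn, fn]
  generalize index p x = i at *
  rcases (by omega : index p x' = i ∨ index p x' = i + 1) with e | e <;> rw [e] at k1 k2 ⊢
  · have := piece_slope (p := p i) (Y := Y i) h2 h1 (h.a_b i) hxx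
    constructor <;> linarith
  · have s1 := piece_slope (p := p i) (Y := Y i) h2 h1 (h.a_b i) i2.le
    have s2 := piece_slope (p := p (i + 1)) (Y := Y (i + 1)) h2 h1 (h.a_b (i + 1)) k1
    rw [h.piece_left hW] at s2
    have s3 := abs_le.1 (h.jump i)
    constructor <;> linarith

lemma tendsto_ratio_b (h : Profile σ₁ σ₂ σ₃ β γ c W p a b Y) (hW : 0 < W) (hβ : 0 < β) :
    Tendsto (fun j => piece σ₁ σ₂ σ₃ (p j) (a j) (b j) (Y j) (b j) / b j) atTop
      (𝓝 ((σ₁ + σ₂ * (β - 1)) / β)) := by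
  have hlim : Tendsto (fun j => (Y j / a j + σ₁ * (1 - p j / a j) + σ₂ * (b j / a j - 1)) /
      (b j / a j)) atTop (𝓝 ((0 + σ₁ * (1 - 0) + σ₂ * (β - 1)) / β)) :=
    ((h.tendsto_Y.add ((tendsto_const_nhds.sub h.tendsto_p).const_mul _)).add
      ((h.tendsto_b.sub tendsto_const_nhds).const_mul _)).div h.tendsto_b hβ.ne'
  rw [show (0 + σ₁ * (1 - 0) + σ₂ * (β - 1)) / β = (σ₁ + σ₂ * (β - 1)) / β by ring] at hlim
  refine hlim.congr' ?_
  filter_upwards [(h.tendsto_a_atTop hW).eventually_gt_atTop 0] with j hj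
  have hb : 0 < b j := by linarith [h.a_b j]
  rw [piece_second (h.a_b j) le_rfl]
  field_simp

lemma tendsto_ratio_p (h : Profile σ₁ σ₂ σ₃ β γ c W p a b Y) (hW : 0 < W) (hγ : 0 < γ) :
    Tendsto (fun j => piece σ₁ σ₂ σ₃ (p j) (a j) (b j) (Y j) (p (j + 1)) / p (j + 1)) atTop
      (𝓝 ((σ₁ + σ₂ * (β - 1) + σ₃ * (γ - β)) / γ)) := by
  have hlim : Tendsto (fun j => (Y j / a j + σ₁ * (1 - p j / a j) + σ₂ * (b j / a j - 1) +
      σ₃ * (p (j + 1) / a j - b j / a j)) / (p (j + 1) / a j)) atTop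
      (𝓝 ((0 + σ₁ * (1 - 0) + σ₂ * (β - 1) + σ₃ * (γ - β)) / γ)) :=
    (((h.tendsto_Y.add ((tendsto_const_nhds.sub h.tendsto_p).const_mul _)).add
      ((h.tendsto_b.sub tendsto_const_nhds).const_mul _)).add
      ((h.tendsto_p_succ.sub h.tendsto_b).const_mul _)).div h.tendsto_p_succ hγ.ne'
  rw [show (0 + σ₁ * (1 - 0) + σ₂ * (β - 1) + σ₃ * (γ - β)) / γ =
    (σ₁ + σ₂ * (β - 1) + σ₃ * (γ - β)) / γ by ring] at hlim
  refine hlim.congr' ?_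
  filter_upwards [(h.tendsto_a_atTop hW).eventually_gt_atTop 0] with j hj
  have hb : 0 < b j := by linarith [h.a_b j]
  have hp : 0 < p (j + 1) := by linarith [h.b_p j]
  rw [piece_third (h.a_b j) (h.b_p j)]
  field_simp

lemma tendsto_ratio_Y (h : Profile σ₁ σ₂ σ₃ β γ c W p a b Y) (hW : 0 < W) (hγ : 0 < γ) :
    Tendsto (fun j => Y (j + 1) / p (j + 1)) atTop
      (𝓝 ((σ₁ + σ₂ * (β - 1) + σ₃ * (γ - β)) / γ)) := by
  have hp : Tendsto (fun j => p (j + 1)) atTop atTop :=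
    (h.tendsto_p_atTop hW).comp (tendsto_add_atTop_nat 1)
  have h0 : Tendsto (fun j => (Y (j + 1) - piece σ₁ σ₂ σ₃ (p j) (a j) (b j) (Y j) (p (j + 1))) /
      p (j + 1)) atTop (𝓝 0) := by
    refine squeeze_zero_norm' ?_ (tendsto_const_nhds (x := c) |>.div_atTop hp)
    filter_upwards [hp.eventually_gt_atTop 0] with j hj
    rw [norm_div, Real.norm_eq_abs, Real.norm_eq_abs, abs_of_pos hj]
    gcongr
    exact h.jump j
  have := h0.add (h.tendsto_ratio_p hW hγ)
  rw [zero_add] at this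
  refine this.congr fun j => ?_
  rw [← add_div]; congr 1; ring

lemma tendsto_ratio_a (h : Profile σ₁ σ₂ σ₃ β γ c W p a b Y) (hW : 0 < W) :
    Tendsto (fun j => piece σ₁ σ₂ σ₃ (p j) (a j) (b j) (Y j) (a j) / a j) atTop (𝓝 σ₁) := by
  have hlim : Tendsto (fun j => Y j / a j + σ₁ * (1 - p j / a j)) atTop
      (𝓝 (0 + σ₁ * (1 - 0))) :=
    h.tendsto_Y.add ((tendsto_const_nhds.sub h.tendsto_p).const_mul _)
  rw [zero_add, sub_zero, mul_one] at hlim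
  refine hlim.congr' ?_
  filter_upwards [(h.tendsto_a_atTop hW).eventually_gt_atTop 0] with j hj
  rw [piece_first le_rfl (h.a_b j)]
  field_simp

lemma linear_le {A s u v x : ℝ} (hu : 0 ≤ A + s * u) (hv : 0 ≤ A + s * v) (hux : u ≤ x)
    (hxv : x ≤ v) : 0 ≤ A + s * x := by
  rcases le_total 0 s with hs | hs
  · linarith [mul_le_mul_of_nonneg_left hux hs]
  · linarith [mul_le_mul_of_nonpos_left hxv hs]

lemma eventually_ge (h : Profile σ₁ σ₂ σ₃ β γ c W p a b Y) (hW : 0 < W)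
    (hβ : 0 < β) (hγ : 0 < γ) {ω : ℝ} (hω1 : ω ≤ σ₁) (hω2 : ω ≤ (σ₁ + σ₂ * (β - 1)) / β)
    (hω3 : ω ≤ (σ₁ + σ₂ * (β - 1) + σ₃ * (γ - β)) / γ) {ε : ℝ} (hε : 0 < ε) :
    ∀ᶠ x in atTop, (ω - ε) * x ≤ fn σ₁ σ₂ σ₃ p a b Y x := by
  have ha := h.tendsto_a_atTop hW
  have e1 := ((h.tendsto_ratio_Y hW hγ).eventually_const_le (show ω - ε < _ by linarith))
  have e2 := ((h.tendsto_ratio_b hW hβ).eventually_const_le (show ω - ε < _ by linarith))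
  have e3 := ((h.tendsto_ratio_p hW hγ).eventually_const_le (show ω - ε < _ by linarith))
  have e4 := ((h.tendsto_ratio_a hW).eventually_const_le (show ω - ε < _ by linarith))
  have e := (((e1.and e2).and (e3.and e4)).and (ha.eventually_gt_atTop 0))
  obtain ⟨N, hN⟩ := eventually_atTop.1 e
  filter_upwards [eventually_ge_atTop (p (N + 2)), eventually_ge_atTop 0] with x hx hx0
  obtain ⟨i1, i2⟩ := h.index_spec hW hx0
  rw [fn]
  have hi : N + 2 ≤ index p x := by
    by_contra hcon
    linarith [h.p_mono hW (show index p x + 1 ≤ N + 2 by omega)]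
  generalize index p x = i at *
  obtain ⟨j, rfl⟩ : ∃ j, i = j + 1 := ⟨i - 1, by omega⟩
  obtain ⟨⟨⟨f1, -⟩, -, -⟩, f5⟩ := hN j (by omega)
  obtain ⟨⟨⟨-, g2⟩, g3, g4⟩, g5⟩ := hN (j + 1) (by omega)
  have hp1 : 0 < p (j + 1) := by linarith [h.a_b j, h.b_p j]
  have hb : 0 < b (j + 1) := by linarith [h.a_b (j + 1)]
  have hp2 : 0 < p (j + 1 + 1) := by linarith [h.b_p (j + 1)]
  rw [le_div_iff₀ hp1] at f1
  rw [le_div_iff₀ hb, piece_second (h.a_b _) le_rfl] at g2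
  rw [le_div_iff₀ hp2, piece_third (h.a_b _) (h.b_p _)] at g3
  rw [le_div_iff₀ g5, piece_first le_rfl (h.a_b _)] at g4
  generalize j + 1 = j at *
  rcases le_total x (a j) with hxa | hxa
  · rw [piece_first hxa (h.a_b j)]
    have := linear_le (A := Y j - σ₁ * p j) (s := σ₁ - (ω - ε)) (u := p j) (v := a j) (x := x)
      (by linarith) (by linarith) i1 hxa
    linarith
  rcases le_total x (b j) with hxb | hxb
  · rw [piece_second hxa hxb]
    have := linear_le (A := Y j + σ₁ * (a j - p j) - σ₂ * a j) (s := σ₂ - (ω - ε)) (u := a j)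
      (v := b j) (x := x) (by linarith) (by linarith) hxa hxb
    linarith
  · rw [piece_third (h.a_b j) hxb]
    have := linear_le (A := Y j + σ₁ * (a j - p j) + σ₂ * (b j - a j) - σ₃ * b j)
      (s := σ₃ - (ω - ε)) (u := b j) (v := p (j + 1)) (x := x) (by linarith) (by linarith) hxb i2.le
    linarith

lemma frequently_le (h : Profile σ₁ σ₂ σ₃ β γ c W p a b Y) (hW : 0 < W) (hc : 0 ≤ c)
    (hβ : 0 < β) (hγ : 0 < γ) {ω : ℝ} (hω : ω = (σ₁ + σ₂ * (β - 1)) / β ∨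
      ω = (σ₁ + σ₂ * (β - 1) + σ₃ * (γ - β)) / γ) {ε : ℝ} (hε : 0 < ε) :
    ∃ᶠ x in atTop, fn σ₁ σ₂ σ₃ p a b Y x ≤ (ω + ε) * x := by
  have ha := h.tendsto_a_atTop hW
  rw [frequently_atTop]
  intro z
  have hbig : ∀ᶠ j in atTop, z ≤ b j ∧ 0 < b j ∧ c ≤ ε / 2 * b j := by
    filter_upwards [ha.eventually_ge_atTop z, ha.eventually_gt_atTop 0,
      ha.eventually_ge_atTop (c / (ε / 2))] with j h1 h2 h3
    have h4 := h.a_b j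
    rw [div_le_iff₀ (by linarith)] at h3
    refine ⟨by linarith, by linarith, h3.trans ?_⟩
    rw [mul_comm]
    gcongr
  rcases hω with hω | hω
  · obtain ⟨j, hj, h1, h2, h3⟩ := (((h.tendsto_ratio_b hW hβ).eventually_le_const
      (show _ < ω + ε / 2 by linarith)).and hbig).exists
    refine ⟨b j, h1, ?_⟩
    rw [div_le_iff₀ h2] at hj
    have := (abs_le.1 (h.fn_close hW hc (show p j ≤ b j by linarith [h.p_a j, h.a_b j])
      (h.b_p j))).2
    linarith
  · obtain ⟨j, hj, h1, h2, h3⟩ := (((h.tendsto_ratio_p hW hγ).eventually_le_const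
      (show _ < ω + ε / 2 by linarith)).and hbig).exists
    have h4 := h.b_p j
    refine ⟨p (j + 1), h1.trans h4, ?_⟩
    rw [div_le_iff₀ (h2.trans_le h4)] at hj
    have := (abs_le.1 (h.fn_close hW hc (show p j ≤ p (j + 1) by linarith [h.step j])
      le_rfl)).2
    have h5 : ε / 2 * b j ≤ ε / 2 * p (j + 1) := by gcongr
    linarith

lemma exists_bad (h : Profile σ₁ σ₂ σ₃ β γ c W p a b Y) (hW : 0 < W) (hc : 0 ≤ c) {m n : ℕ}
    (hmn : m < n * σ₁) (C : ℝ) : ∃ x, 0 ≤ x ∧ m * x - n * fn σ₁ σ₂ σ₃ p a b Y x < C := by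
  have ha := h.tendsto_a_atTop hW
  have hlim : Tendsto (fun j => (m : ℝ) -
      n * (piece σ₁ σ₂ σ₃ (p j) (a j) (b j) (Y j) (a j) / a j)) atTop (𝓝 (m - n * σ₁)) :=
    tendsto_const_nhds.sub ((h.tendsto_ratio_a hW).const_mul _)
  have hlim2 := ha.atTop_mul_neg (show (m : ℝ) - n * σ₁ < 0 by linarith) hlim
  obtain ⟨j, hj, hj0⟩ := ((hlim2.eventually_lt_atBot (C - n * c)).and
    (ha.eventually_gt_atTop 0)).exists
  refine ⟨a j, hj0.le, ?_⟩
  have := (abs_le.1 (h.fn_close hW hc (show p j ≤ a j by linarith [h.p_a j])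
      (by linarith [h.a_b j, h.b_p j]))).1
  have e : a j * (m - n * (piece σ₁ σ₂ σ₃ (p j) (a j) (b j) (Y j) (a j) / a j)) =
      m * a j - n * piece σ₁ σ₂ σ₃ (p j) (a j) (b j) (Y j) (a j) := by field_simp
  rw [e] at hj
  have : (n : ℝ) * (piece σ₁ σ₂ σ₃ (p j) (a j) (b j) (Y j) (a j) - c) ≤
    n * fn σ₁ σ₂ σ₃ p a b Y (a j) := by gcongr; linarith
  linarith

end Profile

lemma eventually_le_mul {s : ℝ} (hs : 0 < s) (C : ℝ) : ∀ᶠ a : ℝ in atTop, C ≤ s * a :=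
  (tendsto_id.const_mul_atTop hs).eventually_ge_atTop C

set_option maxHeartbeats 1000000 in
theorem exists_parameters (k r : ℕ) (hr : 0 < r) {σ₁ σ₂ β θ : ℝ} (hσ₁ : σ₁ = (k + 1) / r)
    (hσ₂ : σ₂ = k / (r + 1)) (hβ : 1 ≤ β) (hβγ : β ≤ 1 + σ₁ + θ) (hθ : 0 ≤ θ) (two : Prop)
    (hone : ¬ two → θ = 0)
    (htwo : two → 0 < θ ∧ θ < σ₁ * (k + 1 + r) / (r + 1) ∧ β = 1 + σ₁ + θ)
    (K R₀ W δ ε p Y : ℝ) (hδ : 0 < δ) (hε : 0 < ε) (D : ℕ) (hD : 1 ≤ D) :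
    ∃ (T : ℕ) (a b : ℝ), 1 ≤ T ∧ (¬ two → T = 1) ∧ (two → 8 ≤ T * δ) ∧ p + W ≤ a ∧
      R₀ * Real.exp p ≤ Real.exp a ∧ K * (D * Real.exp (-(Y + σ₁ * (a - p)))) ≤ 1 ∧ a ≤ b ∧
      D * Real.exp (-(Y + σ₁ * (a - p))) * Real.exp b ≤ T * Real.exp a ∧
      (two → D * (1 + T) * Real.exp (-(Y + σ₁ * (a - p) + σ₂ * (b - a))) ≤ 1 ∧
        (D * Real.exp (-(Y + σ₁ * (a - p)))) ^ k *
          (D * (1 + T) * Real.exp (-(Y + σ₁ * (a - p)))) ^ (r + 1) ≤ 1) ∧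
      0 < a ∧ |p| ≤ ε * a ∧ |Y| ≤ ε * a ∧ |b - β * a| ≤ ε * a ∧
      ∀ p', T * Real.exp a ≤ D * Real.exp (-(Y + σ₁ * (a - p))) * Real.exp p' →
        Real.exp (-(Y + σ₁ * (a - p))) * Real.exp p' ≤ T * Real.exp a →
        |p' - (1 + σ₁ + θ) * a| ≤ ε * a := by
  have hr0 : (0 : ℝ) < r := by exact_mod_cast hr
  have hσ₁0 : 0 < σ₁ := by rw [hσ₁]; positivity
  have hσ₂0 : 0 ≤ σ₂ := by rw [hσ₂]; positivity
  have hD0 : (0 : ℝ) < D := by exact_mod_cast hD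
  obtain ⟨d, hd⟩ : ∃ d, d = Real.log D := ⟨_, rfl⟩
  have hDd : (D : ℝ) = Real.exp d := by rw [hd, Real.exp_log hD0]
  obtain ⟨q, hq⟩ : ∃ q, q = σ₁ * p - Y := ⟨_, rfl⟩
  have e1 := (eventually_le_mul one_pos (p + W)).and ((eventually_le_mul one_pos (R₀ + p)).and
    ((eventually_le_mul hσ₁0 (K + d + q)).and (eventually_le_mul hσ₁0 (d + q))))
  have e2 := (eventually_le_mul hε |p|).and ((eventually_le_mul hε |Y|).and
    ((eventually_le_mul hε |q + d|).and (eventually_le_mul hε (|q| + 1))))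
  have e3 : ∀ᶠ a in atTop, two → 8 / δ ≤ θ * a ∧
      d + 2 + q + σ₂ * |q + d| ≤ (σ₁ + σ₂ * (σ₁ + θ) - θ) * a ∧
      (k + r + 1) * (d + q) + 2 * (r + 1) ≤ ((k + r + 1) * σ₁ - (r + 1) * θ) * a := by
    by_cases h2 : two
    · obtain ⟨h3, h4, -⟩ := htwo h2
      rw [lt_div_iff₀ (by positivity)] at h4
      have h5 : 0 < (k + r + 1) * σ₁ - (r + 1) * θ := by linarith
      have h6 : 0 < σ₁ + σ₂ * (σ₁ + θ) - θ := by
        have h7 : σ₁ + σ₂ * σ₁ - θ = ((k + r + 1) * σ₁ - (r + 1) * θ) / (r + 1) := by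
          rw [hσ₂]; field_simp; ring
        have h8 : 0 < σ₁ + σ₂ * σ₁ - θ := by rw [h7]; positivity
        have : 0 ≤ σ₂ * θ := by positivity
        linarith
      filter_upwards [eventually_le_mul h3 (8 / δ), eventually_le_mul h6 _,
        eventually_le_mul h5 _] with a h7 h8 h9 _
      exact ⟨h7, h8, h9⟩
    · exact Eventually.of_forall fun a h => absurd h h2
  obtain ⟨a, ⟨⟨a1, a2, a3, a4⟩, b1, b2, b3, b4⟩, c1, ha⟩ :=
    ((e1.and e2).and (e3.and (eventually_gt_atTop 0))).exists
  obtain ⟨T, hT⟩ : ∃ T, T = ⌈Real.exp (θ * a)⌉₊ := ⟨_, rfl⟩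
  have hθa : 0 ≤ θ * a := by positivity
  have hE1 : 1 ≤ Real.exp (θ * a) := Real.one_le_exp hθa
  have hT1 : Real.exp (θ * a) ≤ T := by rw [hT]; exact Nat.le_ceil _
  have hT2 : (T : ℝ) < Real.exp (θ * a) + 1 := by rw [hT]; exact Nat.ceil_lt_add_one (by linarith)
  have hT0 : (0 : ℝ) < T := by linarith
  obtain ⟨t, ht⟩ : ∃ t, t = Real.log T := ⟨_, rfl⟩
  have hTt : (T : ℝ) = Real.exp t := by rw [ht, Real.exp_log hT0]
  have ht1 : θ * a ≤ t := by rw [hTt, Real.exp_le_exp] at hT1; exact hT1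
  have ht2 : t ≤ θ * a + 1 := by
    rw [← Real.exp_le_exp, ← hTt, Real.exp_add]
    have : 2 ≤ Real.exp 1 := by linarith [Real.add_one_le_exp (1 : ℝ)]
    have : Real.exp (θ * a) * 2 ≤ Real.exp (θ * a) * Real.exp 1 := by gcongr
    linarith
  have ht3 : (1 + T : ℝ) ≤ Real.exp (θ * a + 2) := by
    rw [Real.exp_add]
    have : 3 ≤ Real.exp 2 := by linarith [Real.add_one_le_exp (2 : ℝ)]
    have : Real.exp (θ * a) * 3 ≤ Real.exp (θ * a) * Real.exp 2 := by gcongr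
    linarith
  have hy : Y + σ₁ * (a - p) = σ₁ * a - q := by rw [hq]; ring
  obtain ⟨b, hb⟩ : ∃ b, b = min (β * a) (a + (σ₁ * a - q) - d + t) := ⟨_, rfl⟩
  have hb1 : b ≤ β * a := by rw [hb]; exact min_le_left _ _
  have hb2 : b ≤ a + (σ₁ * a - q) - d + t := by rw [hb]; exact min_le_right _ _
  have hb3 : β * a - |q + d| ≤ b := by
    rw [hb]
    have h1 : β * a ≤ (1 + σ₁ + θ) * a := by gcongr
    exact le_min (by linarith [abs_nonneg (q + d)]) (by linarith [le_abs_self (q + d)])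
  have hab : a ≤ b := by
    rw [hb]
    exact le_min (le_mul_of_one_le_left ha.le hβ) (by linarith)
  refine ⟨T, a, b, ?_, ?_, ?_, by linarith, ?_, ?_, hab, ?_, ?_, ha, b1, b2, ?_, ?_⟩ <;>
    (try simp only [hy])
  · have : (0 : ℝ) < T := hT0
    exact_mod_cast this
  · intro h
    rw [hT, hone h]; simp
  · intro h
    have h1 := (c1 h).1
    rw [div_le_iff₀ hδ] at h1
    refine h1.trans ?_
    gcongr
    linarith [Real.add_one_le_exp (θ * a)]
  · calc R₀ * Real.exp p ≤ Real.exp R₀ * Real.exp p := by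
          gcongr; linarith [Real.add_one_le_exp R₀]
      _ = Real.exp (R₀ + p) := by rw [Real.exp_add]
      _ ≤ _ := Real.exp_le_exp.2 (by linarith)
  · calc K * (D * Real.exp (-(σ₁ * a - q)))
        ≤ Real.exp K * (D * Real.exp (-(σ₁ * a - q))) := by
          gcongr; linarith [Real.add_one_le_exp K]
      _ = Real.exp (K + (d + -(σ₁ * a - q))) := by rw [Real.exp_add, Real.exp_add, ← hDd]
      _ ≤ 1 := Real.exp_le_one_iff.2 (by linarith)
  · rw [hDd, hTt, ← Real.exp_add, ← Real.exp_add, ← Real.exp_add, Real.exp_le_exp]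
    linarith
  · intro h
    obtain ⟨-, h2, h3⟩ := c1 h
    have hβe := (htwo h).2.2
    constructor
    · calc D * (1 + T) * Real.exp (-(σ₁ * a - q + σ₂ * (b - a)))
          ≤ D * Real.exp (θ * a + 2) * Real.exp (-(σ₁ * a - q + σ₂ * (b - a))) := by gcongr
        _ = Real.exp (d + (θ * a + 2) + -(σ₁ * a - q + σ₂ * (b - a))) := by
          rw [Real.exp_add (d + (θ * a + 2)), Real.exp_add d, ← hDd]
        _ ≤ 1 := by
          rw [Real.exp_le_one_iff]
          have : σ₂ * (β * a - |q + d|) ≤ σ₂ * b := by gcongr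
          rw [hβe] at this
          linarith
    · calc (D * Real.exp (-(σ₁ * a - q))) ^ k * (D * (1 + T) * Real.exp (-(σ₁ * a - q))) ^ (r + 1)
          ≤ (D * Real.exp (-(σ₁ * a - q))) ^ k *
            (D * Real.exp (θ * a + 2) * Real.exp (-(σ₁ * a - q))) ^ (r + 1) := by gcongr
        _ = Real.exp (k * (d + -(σ₁ * a - q)) +
            (r + 1 : ℕ) * (d + (θ * a + 2) + -(σ₁ * a - q))) := by
          rw [Real.exp_add (k * (d + -(σ₁ * a - q))), Real.exp_nat_mul, Real.exp_nat_mul,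
            Real.exp_add (d + (θ * a + 2)), Real.exp_add d, Real.exp_add d, ← hDd]
        _ ≤ 1 := by
          rw [Real.exp_le_one_iff]
          push_cast
          linarith
  · rw [abs_le]
    constructor <;> linarith [abs_nonneg (q + d)]
  · intro p' h1 h2
    rw [hDd, hTt, ← Real.exp_add, ← Real.exp_add, ← Real.exp_add, Real.exp_le_exp] at h1
    rw [hTt, ← Real.exp_add, ← Real.exp_add, Real.exp_le_exp] at h2
    rw [abs_le]
    constructor <;> linarith [le_abs_self (q + d), neg_abs_le q]

lemma exp_pow_mul_exp_pow (m n : ℕ) (u v : ℝ) :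
    Real.exp u ^ m * Real.exp (-v) ^ n = Real.exp (m * u - n * v) := by
  rw [← Real.exp_nat_mul, ← Real.exp_nat_mul, ← Real.exp_add]; ring_nf

lemma CycleEst.est_piece {κ ν τ : Type*} [Fintype κ] [Fintype ν] [Nonempty ν] [Fintype τ]
    {Ξ : Matrix ν (κ ⊕ Unit) ℝ} {Γ : Matrix τ (κ ⊕ Unit) ℝ} {σ₁ σ₂ σ₃ p a b q Y K : ℝ}
    (hσ₁ : σ₁ = (Fintype.card κ + 1) / Fintype.card ν)
    (hσ₂ : σ₂ = Fintype.card κ / (Fintype.card ν + 1)) (hσ₃ : σ₃ = Fintype.card κ / Fintype.card ν)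
    (hab : a ≤ b) (h : CycleEst Ξ Γ (Real.exp p) (Real.exp (-Y)) (Real.exp a)
      (Real.exp (-(Y + σ₁ * (a - p)))) (Real.exp b)
      (Real.exp (-(Y + σ₁ * (a - p) + σ₂ * (b - a)))) (Real.exp q) K) {x : ℝ} (hp : p ≤ x)
    (hq : x ≤ q) : Est Ξ Γ (Real.exp x) (Real.exp (-piece σ₁ σ₂ σ₃ p a b Y x)) K := by
  have hr : (Fintype.card ν : ℝ) ≠ 0 := by exact_mod_cast Fintype.card_ne_zero
  have hr' : (Fintype.card ν : ℝ) + 1 ≠ 0 := by positivity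
  rcases le_total x a with hxa | hxa
  · refine h.1 _ _ (Real.exp_le_exp.2 hp) (Real.exp_le_exp.2 hxa) (Real.exp_pos _) ?_
    rw [piece_first hxa hab, exp_pow_mul_exp_pow, exp_pow_mul_exp_pow, hσ₁]
    congr 1; push_cast; field_simp; ring
  rcases le_total x b with hxb | hxb
  · refine h.2.1 _ _ (Real.exp_le_exp.2 hxa) (Real.exp_le_exp.2 hxb) (Real.exp_pos _) ?_
    rw [piece_second hxa hxb, exp_pow_mul_exp_pow, exp_pow_mul_exp_pow, hσ₂]
    congr 1; push_cast; field_simp; ring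
  · refine h.2.2 _ _ (Real.exp_le_exp.2 hxb) (Real.exp_le_exp.2 hq) (Real.exp_pos _) ?_
    rw [piece_third hab hxb, exp_pow_mul_exp_pow, exp_pow_mul_exp_pow, hσ₃]
    congr 1; field_simp; ring

/-- The relation between two consecutive stages, in logarithmic scale. -/
structure Stage.Next {κ ν τ : Type} [Fintype κ] [Fintype ν] [Fintype τ] (s s' : Stage κ ν τ)
    (σ₁ σ₂ σ₃ β γ W K ε a b : ℝ) : Prop where
  p_a : Real.log s.P + W ≤ a
  a_b : a ≤ b
  b_p : b ≤ Real.log s'.P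
  jump : |-Real.log s'.L - piece σ₁ σ₂ σ₃ (Real.log s.P) a b (-Real.log s.L) (Real.log s'.P)| ≤
    Real.log K
  a_pos : 0 < a
  small_p : |Real.log s.P| ≤ ε * a
  small_Y : |-Real.log s.L| ≤ ε * a
  close_b : |b - β * a| ≤ ε * a
  close_p : |Real.log s'.P - γ * a| ≤ ε * a
  within_Ξ : Within s.Ξ s'.Ξ (K * (s.L / s.P))
  within_Γ : Within s.Γ s'.Γ (K * (s.L / s.P))
  est : ∀ (Ξ : Matrix ν (κ ⊕ Unit) ℝ) (Γ : Matrix τ (κ ⊕ Unit) ℝ) (C : ℝ), 0 ≤ C →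
    Within s'.Ξ Ξ (C * (s'.L / s'.P)) → Within s'.Γ Γ (C * (s'.L / s'.P)) →
    ∀ x, Real.log s.P ≤ x → x ≤ Real.log s'.P → Est Ξ Γ (Real.exp x)
      (Real.exp (-piece σ₁ σ₂ σ₃ (Real.log s.P) a b (-Real.log s.L) x))
      (K * (1 + Fintype.card (κ ⊕ Unit) * (C * K)))

set_option maxHeartbeats 1000000 in
theorem exists_next_stage (κ ν : Type) [Fintype κ] [DecidableEq κ] [Nonempty κ]
    [Fintype ν] [DecidableEq ν] [Nonempty ν] {σ₁ σ₂ σ₃ : ℝ}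
    (hσ₁ : σ₁ = (Fintype.card κ + 1) / Fintype.card ν)
    (hσ₂ : σ₂ = Fintype.card κ / (Fintype.card ν + 1))
    (hσ₃ : σ₃ = Fintype.card κ / Fintype.card ν) :
    ∃ ρ K : ℝ, 0 < ρ ∧ ρ ≤ 1 ∧ 1 ≤ K ∧ ∀ (τ : Type) [Fintype τ] [DecidableEq τ] (j₀ j₁ : τ),
      (∀ j, j = j₀ ∨ j = j₁) → ∀ β θ : ℝ, 1 ≤ β → β ≤ 1 + σ₁ + θ → 0 ≤ θ →
      (j₀ = j₁ → θ = 0) → (j₀ ≠ j₁ → 0 < θ ∧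
        θ < σ₁ * (Fintype.card κ + 1 + Fintype.card ν) / (Fintype.card ν + 1) ∧
        β = 1 + σ₁ + θ) →
      ∀ (W δ ε : ℝ) (s : Stage κ ν τ), 0 < δ → 0 < ε → s.Good ρ δ j₀ →
        ∃ (a b : ℝ) (s' : Stage κ ν τ), s'.Good ρ (δ / 2) j₀ ∧
          s.Next s' σ₁ σ₂ σ₃ β (1 + σ₁ + θ) W K ε a b := by
  obtain ⟨ρ, R₀, K, hρ, hρ1, hR₀, hK, hcyc⟩ := exists_cycle κ ν
  refine ⟨ρ, K, hρ, hρ1, hK, ?_⟩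
  intro τ _ _ j₀ j₁ hj β θ hβ hβγ hθ hone htwo W δ ε s hδ hε hs
  obtain ⟨D, hD, hcyc⟩ := hcyc τ j₀ j₁ δ s hj hδ hs
  have hr : 0 < Fintype.card ν := Fintype.card_pos
  have hr0 : (Fintype.card ν : ℝ) ≠ 0 := by exact_mod_cast hr.ne'
  have hr' : (Fintype.card ν : ℝ) + 1 ≠ 0 := by positivity
  have hP0 : 0 < s.P := by linarith [hs.one_le]
  obtain ⟨p, hp⟩ : ∃ p, p = Real.log s.P := ⟨_, rfl⟩
  obtain ⟨Y, hY⟩ : ∃ Y, Y = -Real.log s.L := ⟨_, rfl⟩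
  have hPp : s.P = Real.exp p := by rw [hp, Real.exp_log hP0]
  have hLY : s.L = Real.exp (-Y) := by rw [hY, neg_neg, Real.exp_log hs.pos]
  obtain ⟨T, a, b, hT1, hTone, hTtwo, hpa, hRa, hKD, hab, hDb, hex, ha0, hsp, hsY, hsb, hsp'⟩ :=
    exists_parameters (Fintype.card κ) (Fintype.card ν) hr hσ₁ hσ₂ hβ hβγ hθ (j₀ ≠ j₁)
      (fun h => hone (not_not.1 h)) htwo K R₀ W δ ε p Y hδ hε D hD
  have eA : Real.exp a ^ (Fintype.card κ + 1) *
      Real.exp (-(Y + σ₁ * (a - p))) ^ Fintype.card ν =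
      s.P ^ (Fintype.card κ + 1) * s.L ^ Fintype.card ν := by
    rw [hPp, hLY, exp_pow_mul_exp_pow, exp_pow_mul_exp_pow, hσ₁]
    congr 1; push_cast; field_simp; ring
  have eB : Real.exp b ^ Fintype.card κ *
      Real.exp (-(Y + σ₁ * (a - p) + σ₂ * (b - a))) ^ (Fintype.card ν + 1) =
      Real.exp a ^ Fintype.card κ * Real.exp (-(Y + σ₁ * (a - p))) ^ (Fintype.card ν + 1) := by
    rw [exp_pow_mul_exp_pow, exp_pow_mul_exp_pow, hσ₂]
    congr 1; push_cast; field_simp; ring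
  have hpa' : p ≤ a := by
    have : Real.exp p ≤ Real.exp a := by
      refine le_trans ?_ hRa
      exact le_mul_of_one_le_left (Real.exp_pos _).le (by linarith)
    exact Real.exp_le_exp.1 this
  obtain ⟨s', hs', hBS, hTS1, hTS2, hwΞ, hwΓ, hest, hjump⟩ := hcyc T (Real.exp a)
    (Real.exp (-(Y + σ₁ * (a - p)))) (Real.exp b)
    (Real.exp (-(Y + σ₁ * (a - p) + σ₂ * (b - a)))) hT1 (fun h => hTone (not_not.2 h)) hTtwo
    (by rw [hPp]; exact hRa) (Real.exp_pos _) eA hKD (Real.exp_le_exp.2 hab) hDb (Real.exp_pos _)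
    eB hex
  have hP0' : 0 < s'.P := by linarith [hs'.one_le]
  obtain ⟨q, hq⟩ : ∃ q, q = Real.log s'.P := ⟨_, rfl⟩
  have hPq : s'.P = Real.exp q := by rw [hq, Real.exp_log hP0']
  have hbq : b ≤ q := by rw [hPq] at hBS; exact Real.exp_le_exp.1 hBS
  have eS : Real.exp q ^ Fintype.card κ *
      Real.exp (-piece σ₁ σ₂ σ₃ p a b Y q) ^ Fintype.card ν =
      Real.exp b ^ Fintype.card κ *
        Real.exp (-(Y + σ₁ * (a - p) + σ₂ * (b - a))) ^ Fintype.card ν := by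
    rw [piece_third hab hbq, exp_pow_mul_exp_pow, exp_pow_mul_exp_pow, hσ₃]
    congr 1; field_simp; ring
  obtain ⟨hj1, hj2⟩ := hjump _ (Real.exp_pos _) (by rw [hPq]; exact eS)
  have hK0 : 0 < K := by linarith
  have hlogK : K = Real.exp (Real.log K) := (Real.exp_log hK0).symm
  refine ⟨a, b, s', hs', ?_⟩
  constructor
  · rw [← hp]; exact hpa
  · exact hab
  · rw [← hq]; exact hbq
  · rw [← hp, ← hY, ← hq, abs_le]
    constructor
    · have := (Real.log_le_log_iff hs'.pos (by positivity)).2 hj2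
      rw [Real.log_mul hK0.ne' (Real.exp_ne_zero _), Real.log_exp] at this
      linarith
    · have := (Real.log_le_log_iff (by positivity) hs'.pos).2 hj1
      rw [Real.log_div (Real.exp_ne_zero _) hK0.ne', Real.log_exp] at this
      linarith
  · exact ha0
  · rw [← hp]; exact hsp
  · rw [← hY]; exact hsY
  · exact hsb
  · rw [← hq]
    rw [hPq] at hTS1 hTS2
    exact hsp' q hTS1 hTS2
  · exact hwΞ
  · exact hwΓ
  · intro Ξ Γ C hC hΞ hΓ x hx1 hx2
    rw [← hp] at hx1 ⊢
    rw [← hq] at hx2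
    rw [← hY]
    have hc : C * (s'.L / s'.P) ≤ C * K * (Real.exp (-piece σ₁ σ₂ σ₃ p a b Y q) / s'.P) := by
      rw [mul_assoc, ← mul_div_assoc K]
      gcongr
    have := hest.perturb hP0 (by rw [hPp]; exact Real.exp_le_exp.2 hpa') (Real.exp_pos _)
      (Real.exp_le_exp.2 hab) (Real.exp_pos _) hBS eA eB (by rw [hPq]; exact eS)
      hK0 (by positivity : 0 ≤ C * K) (hΞ.mono hc) (hΓ.mono hc)
    rw [hPp, hLY, hPq] at this
    exact this.est_piece hσ₁ hσ₂ hσ₃ hab hx1 hx2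

/-- The stage with zero matrices and the standard basis. -/
def Stage.trivial (κ ν τ : Type) [DecidableEq κ] [DecidableEq ν] : Stage κ ν τ where
  Ξ := 0
  A := 0
  A₁ := 0
  Bx := Matrix.of fun i c => if eW κ ν (Sum.inl i) = c then 1 else 0
  By := Matrix.of fun j c => if eW κ ν (Sum.inr j) = c then 1 else 0
  P := 1
  L := 1

lemma Stage.trivial_good (κ ν τ : Type) [Fintype κ] [DecidableEq κ] [Fintype ν] [DecidableEq ν]
    [Fintype τ] {ρ : ℝ} (hρ : ρ ≤ 1) (j₀ : τ) : (Stage.trivial κ ν τ).Good ρ 1 j₀ := by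
  have hBx : ∀ a, (Stage.trivial κ ν τ).Bx.mulVec a = fun i => a (eW κ ν (Sum.inl i)) := by
    intro a; ext i; simp [Stage.trivial, Matrix.mulVec, dotProduct]
  have hBy : ∀ a, (Stage.trivial κ ν τ).By.mulVec a = fun i => a (eW κ ν (Sum.inr i)) := by
    intro a; ext i; simp [Stage.trivial, Matrix.mulVec, dotProduct]
  have hw : ∀ x y, wv (Stage.trivial κ ν τ).A (Stage.trivial κ ν τ).A₁ x y = 0 := by
    intro x y; simp [Stage.trivial, wv]
  constructor
  · exact le_rfl
  · exact one_pos
  · have : ((rc (Stage.trivial κ ν τ).Bx).fromRows (rem (Stage.trivial κ ν τ).Ξ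
        (Stage.trivial κ ν τ).Bx (Stage.trivial κ ν τ).By)).submatrix id (eW κ ν) =
        Matrix.diagonal (Sum.elim (fun _ => (1 : ℝ)) (fun _ => (-1 : ℝ))) := by
      ext i j
      rcases i with i | i
      · by_cases h : Sum.inl i = j
        · subst h; simp [Stage.trivial]
        · simp [Stage.trivial, (eW κ ν).injective.eq_iff, h]
      · by_cases h : Sum.inr i = j
        · subst h; simp [Stage.trivial, rem]
        · simp [Stage.trivial, rem, h]
    rw [this, Matrix.det_diagonal]
    simp [Stage.trivial, Fintype.prod_sum_type]
  · intro a ha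
    rw [rem_mulVec, ← iv_mulVec, hBx, hBy]
    by_cases h : (fun i => a (eW κ ν (Sum.inl i))) = 0
    · right
      have h' : (fun i => a (eW κ ν (Sum.inr i))) ≠ 0 := by
        intro h'
        apply ha
        ext c
        obtain ⟨d, rfl⟩ := (eW κ ν).surjective c
        rcases d with d | d
        · exact congrFun h d
        · exact congrFun h' d
      have := one_le_norm_iv h'
      simp only [Stage.trivial, lv, Matrix.zero_mulVec, zero_sub, norm_neg, mul_one]
      exact hρ.trans this
    · left
      simp only [Stage.trivial, mul_one]
      exact hρ.trans (one_le_norm_iv h)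
  · refine ⟨fun a => ⟨0, by rw [hw]; ext; simp [iv]⟩, fun x y i _ => ?_⟩
    refine ⟨(Sum.elim x y) ∘ (eW κ ν).symm, ?_, ?_⟩
    · rw [hBx]; ext; simp
    · rw [hBy]; ext; simp
  · intro x y i h
    rw [hw] at h ⊢
    have hi : i ≠ 0 := by rintro rfl; apply h; ext; simp [iv]
    simp only [Stage.trivial, zero_sub, norm_neg, mul_one]
    exact hρ.trans (one_le_norm_iv hi)
  · intro j; simp [Stage.trivial]
  · intro i _ j; simp [Stage.trivial]

lemma exists_limit_within {ι ι' : Type*} [Fintype ι] [Fintype ι'] {M : ℕ → Matrix ι ι' ℝ}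
    {q : ℕ → ℝ} {K : ℝ} (hK : 0 ≤ K) (hq : ∀ j, q (j + 1) ≤ q j / 2)
    (h : ∀ j, Within (M j) (M (j + 1)) (K * q j)) :
    ∃ N, ∀ j, Within (M j) N (2 * K * q j) := by
  have hgeo : ∀ j l, q (j + l) ≤ q j / 2 ^ l := by
    intro j l
    induction l with
    | zero => simp
    | succ l ih =>
      calc q (j + (l + 1)) ≤ q (j + l) / 2 := hq _
        _ ≤ q j / 2 ^ l / 2 := by gcongr
        _ = q j / 2 ^ (l + 1) := by rw [pow_succ, div_div]
  have hd : ∀ i i' j l, dist (M (j + l) i i') (M (j + (l + 1)) i i') ≤ 2 * K * q j / 2 / 2 ^ l := by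
    intro i i' j l
    rw [dist_comm, Real.dist_eq]
    calc |M (j + (l + 1)) i i' - M (j + l) i i'| ≤ K * q (j + l) := h (j + l) i i'
      _ ≤ K * (q j / 2 ^ l) := by gcongr; exact hgeo j l
      _ = 2 * K * q j / 2 / 2 ^ l := by ring
  have hlim : ∀ i i', ∃ v, Tendsto (fun l => M l i i') atTop (𝓝 v) := by
    intro i i'
    have : CauchySeq (fun l => M (0 + l) i i') := cauchySeq_of_le_geometric_two (hd i i' 0)
    simp only [zero_add] at this
    exact cauchySeq_tendsto_of_complete this
  choose N hN using hlim
  refine ⟨Matrix.of N, fun j i i' => ?_⟩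
  have h1 : Tendsto (fun l => M (j + l) i i') atTop (𝓝 (N i i')) := by
    have := (tendsto_add_atTop_iff_nat j).2 (hN i i')
    simpa only [add_comm] using this
  have := dist_le_of_le_geometric_two_of_tendsto₀ (f := fun l => M (j + l) i i') (hd i i' j) h1
  rw [dist_comm, Real.dist_eq] at this
  exact this

lemma tendsto_div_of_abs_sub_le {u a : ℕ → ℝ} {l : ℝ} (ha : ∀ j, 0 < a j)
    (h : ∀ j : ℕ, |u j - l * a j| ≤ 1 / ((j : ℝ) + 1) * a j) :
    Tendsto (fun j => u j / a j) atTop (𝓝 l) := by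
  rw [tendsto_iff_dist_tendsto_zero]
  refine squeeze_zero (fun _ => dist_nonneg) (fun j => ?_) tendsto_one_div_add_atTop_nhds_zero_nat
  rw [Real.dist_eq, ← mul_le_mul_iff_left₀ (ha j)]
  refine le_trans (le_of_eq ?_) (h j)
  rw [← abs_of_pos (ha j), ← abs_mul, abs_of_pos (ha j), sub_mul, div_mul_cancel₀ _ (ha j).ne']

lemma Stage.Next.decay {κ ν τ : Type} [Fintype κ] [Fintype ν] [Fintype τ] {s s' : Stage κ ν τ}
    {σ₁ σ₂ σ₃ β γ W K ε a b : ℝ} (h : s.Next s' σ₁ σ₂ σ₃ β γ W K ε a b) (hσ₂ : 0 ≤ σ₂)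
    (h23 : σ₂ ≤ σ₃) (h31 : σ₃ ≤ σ₁) (hW : Real.log 2 ≤ W) (hKW : Real.log K ≤ σ₂ * W)
    (hP : 0 < s.P) (hL : 0 < s.L) (hP' : 0 < s'.P) (hL' : 0 < s'.L) :
    s'.L / s'.P ≤ s.L / s.P / 2 := by
  have h2 : 0 < Real.log 2 := Real.log_pos one_lt_two
  have hp : Real.log s.P + W ≤ Real.log s'.P := h.p_a.trans (h.a_b.trans h.b_p)
  have h1 := (piece_slope (p := Real.log s.P) (Y := -Real.log s.L) h23 h31 h.a_b
    (by linarith : Real.log s.P ≤ Real.log s'.P)).1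
  rw [piece_first (x := Real.log s.P) (by linarith [h.p_a]) h.a_b] at h1
  have h3 := (abs_le.1 h.jump).1
  have h4 : σ₂ * W ≤ σ₂ * (Real.log s'.P - Real.log s.P) :=
    mul_le_mul_of_nonneg_left (by linarith) hσ₂
  rw [← Real.log_le_log_iff (by positivity) (by positivity), Real.log_div (by positivity) two_ne_zero,
    Real.log_div hL'.ne' hP'.ne', Real.log_div hL.ne' hP.ne']
  linarith

theorem exists_limit (κ ν : Type) [Fintype κ] [DecidableEq κ] [Nonempty κ]
    [Fintype ν] [DecidableEq ν] [Nonempty ν] {σ₁ σ₂ σ₃ : ℝ}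
    (hσ₁ : σ₁ = (Fintype.card κ + 1) / Fintype.card ν)
    (hσ₂ : σ₂ = Fintype.card κ / (Fintype.card ν + 1))
    (hσ₃ : σ₃ = Fintype.card κ / Fintype.card ν) (h23 : σ₂ ≤ σ₃) (h31 : σ₃ ≤ σ₁) :
    ∃ c c' : ℝ, 0 ≤ c ∧ 0 ≤ c' ∧ ∀ (τ : Type) [Fintype τ] [DecidableEq τ] (j₀ j₁ : τ),
      (∀ j, j = j₀ ∨ j = j₁) → ∀ β θ : ℝ, 1 ≤ β → β ≤ 1 + σ₁ + θ → 0 ≤ θ →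
      (j₀ = j₁ → θ = 0) → (j₀ ≠ j₁ → 0 < θ ∧
        θ < σ₁ * (Fintype.card κ + 1 + Fintype.card ν) / (Fintype.card ν + 1) ∧
        β = 1 + σ₁ + θ) →
      ∀ W : ℝ, Real.log 2 ≤ W → c ≤ σ₂ * W → ∃ (Ξ : Matrix ν (κ ⊕ Unit) ℝ)
        (Γ : Matrix τ (κ ⊕ Unit) ℝ) (p a b Y : ℕ → ℝ),
        Profile σ₁ σ₂ σ₃ β (1 + σ₁ + θ) c W p a b Y ∧
        ∀ j x, p j ≤ x → x ≤ p (j + 1) → Est Ξ Γ (Real.exp x)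
          (Real.exp (-piece σ₁ σ₂ σ₃ (p j) (a j) (b j) (Y j) x)) (Real.exp c') := by
  obtain ⟨ρ, K, hρ, hρ1, hK, hnext⟩ := exists_next_stage κ ν hσ₁ hσ₂ hσ₃
  have hK0 : 0 < K := by linarith
  refine ⟨Real.log K, Real.log (K * (1 + Fintype.card (κ ⊕ Unit) * (2 * K * K))),
    Real.log_nonneg hK, Real.log_nonneg ?_, ?_⟩
  · refine one_le_mul_of_one_le_of_one_le hK ?_
    have : 0 ≤ (Fintype.card (κ ⊕ Unit) : ℝ) * (2 * K * K) := by positivity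
    linarith
  intro τ _ _ j₀ j₁ hj β θ hβ hβγ hθ hone htwo W hW hKW
  have hδ : ∀ j : ℕ, 0 < (1 / 2 : ℝ) ^ j := fun j => by positivity
  have hε : ∀ j : ℕ, 0 < 1 / ((j : ℝ) + 1) := fun j => by positivity
  have step : ∀ (j : ℕ) (s : Stage κ ν τ), ∃ t : ℝ × ℝ × Stage κ ν τ,
      s.Good ρ ((1 / 2) ^ j) j₀ → t.2.2.Good ρ ((1 / 2) ^ (j + 1)) j₀ ∧
        s.Next t.2.2 σ₁ σ₂ σ₃ β (1 + σ₁ + θ) W K (1 / ((j : ℝ) + 1)) t.1 t.2.1 := by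
    intro j s
    by_cases hs : s.Good ρ ((1 / 2) ^ j) j₀
    · obtain ⟨a, b, s', h1, h2⟩ := hnext τ j₀ j₁ hj β θ hβ hβγ hθ hone htwo W _ _ s (hδ j) (hε j) hs
      refine ⟨(a, b, s'), fun _ => ⟨?_, h2⟩⟩
      rw [pow_succ, ← div_eq_mul_one_div]; exact h1
    · exact ⟨(0, 0, s), fun h => absurd h hs⟩
  choose t ht using step
  let S : ℕ → Stage κ ν τ := fun j => Nat.rec (Stage.trivial κ ν τ) (fun j s => (t j s).2.2) j
  have hS : ∀ j, (S j).Good ρ ((1 / 2) ^ j) j₀ := by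
    intro j
    induction j with
    | zero => rw [pow_zero]; exact Stage.trivial_good κ ν τ hρ1 j₀
    | succ j ih => exact (ht j (S j) ih).1
  have hN : ∀ j, (S j).Next (S (j + 1)) σ₁ σ₂ σ₃ β (1 + σ₁ + θ) W K (1 / ((j : ℝ) + 1))
      (t j (S j)).1 (t j (S j)).2.1 := fun j => (ht j (S j) (hS j)).2
  have hP : ∀ j, 0 < (S j).P := fun j => by linarith [(hS j).one_le]
  have hL : ∀ j, 0 < (S j).L := fun j => (hS j).pos
  have hσ₂0 : 0 ≤ σ₂ := by rw [hσ₂]; positivity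
  have hdecay : ∀ j, (S (j + 1)).L / (S (j + 1)).P ≤ (S j).L / (S j).P / 2 := fun j =>
    (hN j).decay hσ₂0 h23 h31 hW hKW (hP j) (hL j) (hP (j + 1)) (hL (j + 1))
  obtain ⟨Ξ, hΞ⟩ := exists_limit_within hK0.le hdecay fun j => (hN j).within_Ξ
  obtain ⟨Γ, hΓ⟩ := exists_limit_within hK0.le hdecay fun j => (hN j).within_Γ
  refine ⟨Ξ, Γ, fun j => Real.log (S j).P, fun j => (t j (S j)).1, fun j => (t j (S j)).2.1,
    fun j => -Real.log (S j).L, ?_, ?_⟩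
  · constructor
    · exact Real.log_one
    · exact fun j => (hN j).p_a
    · exact fun j => (hN j).a_b
    · exact fun j => (hN j).b_p
    · exact fun j => (hN j).jump
    · exact tendsto_div_of_abs_sub_le (fun j => (hN j).a_pos)
        fun j => by rw [zero_mul, sub_zero]; exact (hN j).small_p
    · exact tendsto_div_of_abs_sub_le (fun j => (hN j).a_pos)
        fun j => by rw [zero_mul, sub_zero]; exact (hN j).small_Y
    · exact tendsto_div_of_abs_sub_le (fun j => (hN j).a_pos) fun j => (hN j).close_b
    · exact tendsto_div_of_abs_sub_le (u := fun j => Real.log (S (j + 1)).P)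
        (fun j => (hN j).a_pos) fun j => (hN j).close_p
  · intro j x hx hx'
    rw [Real.exp_log (by positivity)]
    exact (hN j).est Ξ Γ (2 * K) (by positivity) (hΞ (j + 1)) (hΓ (j + 1)) x hx hx'

lemma norm_iv_comp {ι ι' : Type*} [Fintype ι] [Fintype ι'] (e : ι ≃ ι') (u : ι' → ℤ) :
    ‖iv (u ∘ e)‖ = ‖iv u‖ := by
  apply le_antisymm
  · exact (pi_norm_le_iff_of_nonneg (norm_nonneg _)).2 fun i => norm_le_pi_norm (iv u) (e i)
  · refine (pi_norm_le_iff_of_nonneg (norm_nonneg _)).2 fun i => ?_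
    have := norm_le_pi_norm (iv (u ∘ e)) (e.symm i)
    simpa [iv] using this

/-- The system of linear forms with rows `Ξ` and `Γ` and further zero rows. -/
def padded {α ν τ ζ : Type*} {m n : ℕ} (e : α ≃ Fin m) (f : (ν ⊕ τ) ⊕ ζ ≃ Fin n)
    (Ξ : Matrix ν α ℝ) (Γ : Matrix τ α ℝ) : Matrix (Fin n) (Fin m) ℝ :=
  Matrix.reindex f e ((Ξ.fromRows Γ).fromRows 0)

lemma padded_apply {α ν τ ζ : Type*} [Fintype α] {m n : ℕ} (e : α ≃ Fin m)
    (f : (ν ⊕ τ) ⊕ ζ ≃ Fin n) (Ξ : Matrix ν α ℝ) (Γ : Matrix τ α ℝ) (u : Fin m → ℤ)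
    (v : Fin n → ℤ) (s : (ν ⊕ τ) ⊕ ζ) :
    ((padded e f Ξ Γ).mulVec (fun j => (u j : ℝ)) - fun k => (v k : ℝ)) (f s) =
      Sum.elim (Sum.elim (lv Ξ (u ∘ e) fun i => v (f (Sum.inl (Sum.inl i))))
        (lv Γ (u ∘ e) fun i => v (f (Sum.inl (Sum.inr i)))))
        (fun z => -(v (f (Sum.inr z)) : ℝ)) s := by
  rw [padded, Matrix.reindex_apply, Pi.sub_apply, Matrix.submatrix_mulVec_equiv]
  rcases s with (s | s) | s <;> simp [Matrix.mulVec, dotProduct, lv, iv]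

lemma scaledBy_padded {α ν τ ζ : Type*} [Fintype α] [Fintype ν] [Fintype τ] {m n : ℕ}
    (e : α ≃ Fin m) (f : (ν ⊕ τ) ⊕ ζ ≃ Fin n) {Ξ : Matrix ν α ℝ} {Γ : Matrix τ α ℝ}
    {F : ℝ → ℝ} {c : ℝ}
    (h : ∀ x, 0 ≤ x → Est Ξ Γ (Real.exp x) (Real.exp (-F x)) (Real.exp c)) :
    ScaledBy (padded e f Ξ Γ) F c := by
  intro x hx
  obtain ⟨h1, x', hx', y, i, h2, h3, h4⟩ := h x hx
  refine ⟨fun u hu v huv => ?_, x' ∘ e.symm, ?_, (Sum.elim (Sum.elim y i) 0) ∘ f.symm, ?_, ?_⟩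
  · have hu' : u ∘ e ≠ 0 := by
      intro h0
      apply hu
      ext j
      simpa using congrFun h0 (e.symm j)
    rw [Real.exp_sub]
    rcases h1 (u ∘ e) hu' (fun i => v (f (Sum.inl (Sum.inl i))))
      (fun i => v (f (Sum.inl (Sum.inr i)))) (by
        rw [norm_iv_comp, ← Real.exp_sub]; exact huv) with h1 | h1
    · refine h1.trans ((pi_norm_le_iff_of_nonneg (norm_nonneg _)).2 fun s => ?_)
      have := norm_le_pi_norm ((padded e f Ξ Γ).mulVec (fun j => (u j : ℝ)) - fun k => (v k : ℝ))
        (f (Sum.inl (Sum.inl s)))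
      rwa [padded_apply] at this
    · refine h1.trans ((pi_norm_le_iff_of_nonneg (norm_nonneg _)).2 fun s => ?_)
      have := norm_le_pi_norm ((padded e f Ξ Γ).mulVec (fun j => (u j : ℝ)) - fun k => (v k : ℝ))
        (f (Sum.inl (Sum.inr s)))
      rwa [padded_apply] at this
  · intro h0
    apply hx'
    ext j
    simpa using congrFun h0 (e j)
  · have := norm_iv_comp e.symm x'
    rw [Real.exp_add, mul_comm]
    exact (le_of_eq this).trans h2
  · rw [Real.exp_add, mul_comm, pi_norm_le_iff_of_nonneg (by positivity)]
    intro s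
    obtain ⟨s, rfl⟩ := f.surjective s
    have e1 : (x' ∘ e.symm) ∘ e = x' := by ext; simp
    rw [padded_apply, e1]
    rcases s with (s | s) | s
    · refine le_trans (le_trans (le_of_eq ?_) (norm_le_pi_norm (lv Ξ x' y) s)) h3
      simp
    · refine le_trans (le_trans (le_of_eq ?_) (norm_le_pi_norm (lv Γ x' i) s)) h4
      simp
    · simp; positivity

theorem exists_of_parameters {k r n : ℕ} (hk : 1 ≤ k) (hr : 1 ≤ r) (hrn : r < n)
    {σ₁ σ₂ σ₃ : ℝ} (hσ₁ : σ₁ = ((k : ℝ) + 1) / r) (hσ₂ : σ₂ = (k : ℝ) / (r + 1))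
    (hσ₃ : σ₃ = (k : ℝ) / r) (τ : Type) [Fintype τ] [DecidableEq τ]
    (hτ : r + Fintype.card τ ≤ n) (j₀ j₁ : τ) (hj : ∀ j, j = j₀ ∨ j = j₁) {β θ ω : ℝ} (hβ : 1 ≤ β)
    (hβγ : β ≤ 1 + σ₁ + θ) (hθ : 0 ≤ θ) (hone : j₀ = j₁ → θ = 0)
    (htwo : j₀ ≠ j₁ → 0 < θ ∧ θ < σ₁ * (k + 1 + r) / (r + 1) ∧ β = 1 + σ₁ + θ)
    (hω : 0 < ω) (hω1 : ω ≤ σ₁) (hω2 : ω ≤ (σ₁ + σ₂ * (β - 1)) / β)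
    (hω3 : ω ≤ (σ₁ + σ₂ * (β - 1) + σ₃ * (1 + σ₁ + θ - β)) / (1 + σ₁ + θ))
    (hω4 : ω = (σ₁ + σ₂ * (β - 1)) / β ∨
      ω = (σ₁ + σ₂ * (β - 1) + σ₃ * (1 + σ₁ + θ - β)) / (1 + σ₁ + θ)) :
    ∃ (ξ : Matrix (Fin n) (Fin (k + 1)) ℝ) (x : ℕ → Fin (k + 1) → ℤ) (y : ℕ → Fin n → ℤ),
      TotallyIrrational ξ ∧ IsBestApproxSeq ξ x y ∧ PropB x ∧ PropC ξ x y ∧ ¬ PropA ξ ∧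
        unifExp ξ x y = (ω : EReal) := by
  have hk0 : (0 : ℝ) < k := by exact_mod_cast hk
  have hr0 : (0 : ℝ) < r := by exact_mod_cast hr
  have : Nonempty (Fin k) := ⟨⟨0, hk⟩⟩
  have : Nonempty (Fin r) := ⟨⟨0, hr⟩⟩
  have hσ₂0 : 0 < σ₂ := by rw [hσ₂]; positivity
  have h23 : σ₂ ≤ σ₃ := by rw [hσ₂, hσ₃]; gcongr; linarith
  have h31 : σ₃ ≤ σ₁ := by rw [hσ₁, hσ₃]; gcongr; linarith
  have hγ0 : 0 < 1 + σ₁ + θ := by linarith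
  obtain ⟨c, c', hc, hc', hlim⟩ := exists_limit (Fin k) (Fin r) (by simpa using hσ₁)
    (by simpa using hσ₂) (by simpa using hσ₃) h23 h31
  have h2 : 0 < Real.log 2 := Real.log_pos one_lt_two
  obtain ⟨W, hWdef⟩ : ∃ W, W = Real.log 2 + 2 * (c' + 1) + (c + 2 * c' + 1) / σ₂ := ⟨_, rfl⟩
  have hq : 0 < (c + 2 * c' + 1) / σ₂ := by positivity
  have hq' : σ₂ * ((c + 2 * c' + 1) / σ₂) = c + 2 * c' + 1 := mul_div_cancel₀ _ hσ₂0.ne'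
  have hW1 : σ₂ * ((c + 2 * c' + 1) / σ₂) ≤ σ₂ * (W - (c' + 1)) := by gcongr; linarith
  have hW2 : σ₂ * (W - (c' + 1)) ≤ σ₂ * W := by gcongr; linarith
  have hW0 : 0 < W := by linarith
  obtain ⟨Ξ, Γ, p, a, b, Y, hprof, hest⟩ := hlim τ j₀ j₁ hj β θ hβ hβγ hθ hone
    (by simpa using htwo) W (by linarith) (by linarith)
  obtain ⟨d, hd⟩ := Nat.exists_eq_add_of_le hτ
  let e : Fin k ⊕ Unit ≃ Fin (k + 1) := Fintype.equivFinOfCardEq (by simp)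
  let f : (Fin r ⊕ τ) ⊕ Fin d ≃ Fin n := Fintype.equivFinOfCardEq (by simp [hd])
  have hscaled : ScaledBy (padded e f Ξ Γ) (Profile.fn σ₁ σ₂ σ₃ p a b Y) c' := by
    refine scaledBy_padded e f fun x hx => ?_
    obtain ⟨h3, h4⟩ := hprof.index_spec hW0 hx
    exact hest _ x h3 h4.le
  refine ⟨padded e f Ξ Γ, hscaled.exists_seq k.succ_pos hc' hω ⟨W, hW0.le, fun x hx => ?_⟩
    ⟨σ₁ * (2 * (c' + 1)) + c, fun x hx => ?_⟩
    (fun ε hε => hprof.eventually_ge hW0 (by linarith) hγ0 hω1 hω2 hω3 hε)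
    (fun ε hε => hprof.frequently_le hW0 hc (by linarith) hγ0 hω4 hε)
    (fun C => hprof.exists_bad hW0 hc ?_ C)⟩
  · have := (hprof.fn_slope hW0 hc h23 h31 (x := x + (c' + 1)) (x' := x + W) (by linarith)
      (by linarith) (by linarith)).1
    have e1 : x + W - (x + (c' + 1)) = W - (c' + 1) := by ring
    rw [e1] at this
    linarith
  · have := (hprof.fn_slope hW0 hc h23 h31 (x := x) (x' := x + 2 * (c' + 1)) hx
      (by linarith) (by linarith)).2
    have e1 : x + 2 * (c' + 1) - x = 2 * (c' + 1) := by ring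
    rw [e1] at this
    linarith
  · have : (r : ℝ) < n := by exact_mod_cast hrn
    rw [hσ₁, ← mul_div_assoc, lt_div_iff₀ hr0]
    push_cast
    nlinarith

lemma exists_last_index {P : ℕ → Prop} (h : P 1) {n : ℕ} (hn : 2 ≤ n) :
    ∃ r, 1 ≤ r ∧ r < n ∧ P r ∧ (r + 1 = n ∨ ¬ P (r + 1)) := by
  induction n, hn using Nat.le_induction with
  | base => exact ⟨1, le_rfl, one_lt_two, h, Or.inl rfl⟩
  | succ n hn ih =>
    obtain ⟨r, h1, h2, h3, h4⟩ := ih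
    by_cases h5 : P (r + 1)
    · rcases h4 with rfl | h4
      · exact ⟨r + 1, by omega, by omega, h5, Or.inl rfl⟩
      · exact absurd h5 h4
    · exact ⟨r, h1, by omega, h3, Or.inr h5⟩

theorem exists_of_mem_upper {k r n : ℕ} (hk : 1 ≤ k) (hr : 1 ≤ r) (hrn : r < n) {ω : ℝ}
    (h1 : ((k : ℝ) + 1) / (r + 1) ≤ ω) (h2 : ω ≤ (k + 1) * (k + r) / (r * (k + 1 + r))) :
    ∃ (ξ : Matrix (Fin n) (Fin (k + 1)) ℝ) (x : ℕ → Fin (k + 1) → ℤ) (y : ℕ → Fin n → ℤ),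
      TotallyIrrational ξ ∧ IsBestApproxSeq ξ x y ∧ PropB x ∧ PropC ξ x y ∧ ¬ PropA ξ ∧
        unifExp ξ x y = (ω : EReal) := by
  have hk0 : (0 : ℝ) < k := by exact_mod_cast hk
  have hr0 : (0 : ℝ) < r := by exact_mod_cast hr
  obtain ⟨σ₁, hσ₁⟩ : ∃ σ₁ : ℝ, σ₁ = ((k : ℝ) + 1) / r := ⟨_, rfl⟩
  obtain ⟨σ₂, hσ₂⟩ : ∃ σ₂ : ℝ, σ₂ = (k : ℝ) / (r + 1) := ⟨_, rfl⟩
  obtain ⟨σ₃, hσ₃⟩ : ∃ σ₃ : ℝ, σ₃ = (k : ℝ) / r := ⟨_, rfl⟩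
  have hσ₁0 : 0 < σ₁ := by rw [hσ₁]; positivity
  have htop : (σ₁ + σ₂ * (1 - 1) + σ₃ * (1 + σ₁ + 0 - 1)) / (1 + σ₁ + 0) =
      (k + 1) * (k + r) / (r * (k + 1 + r)) := by
    rw [hσ₁, hσ₃]; field_simp; ring
  have htop' : (k + 1) * (k + r) / (r * (k + 1 + r)) ≤ σ₁ := by
    rw [hσ₁, div_le_div_iff₀ (by positivity) hr0]
    nlinarith [mul_pos hr0 (by positivity : (0 : ℝ) < k + 1)]
  have hbot : (σ₁ + σ₂ * (1 + σ₁ - 1)) / (1 + σ₁) = (k + 1) / (r + 1) := by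
    rw [hσ₁, hσ₂]; field_simp; ring
  have hcont : ContinuousOn (fun β => min ((σ₁ + σ₂ * (β - 1)) / β)
      ((σ₁ + σ₂ * (β - 1) + σ₃ * (1 + σ₁ + 0 - β)) / (1 + σ₁ + 0))) (Set.Icc 1 (1 + σ₁)) := by
    refine ContinuousOn.inf (ContinuousOn.div (by fun_prop) (by fun_prop) fun β hβ => ?_)
      (by fun_prop)
    have := hβ.1
    positivity
  obtain ⟨β, hβ, hβω⟩ := intermediate_value_Icc' (by linarith) hcont
    (show ω ∈ Set.Icc _ _ from ⟨by
      refine (min_le_left _ _).trans ?_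
      rw [hbot]; exact h1, by
      refine le_min ?_ ?_
      · rw [sub_self, mul_zero, add_zero, div_one]; exact h2.trans htop'
      · rw [htop]; exact h2⟩)
  have hω : 0 < ω := lt_of_lt_of_le (by positivity) h1
  refine exists_of_parameters hk hr hrn hσ₁ hσ₂ hσ₃ Unit (by simpa using hrn) () ()
    (fun _ => Or.inl rfl) (β := β) (θ := 0) hβ.1 (by linarith [hβ.2]) le_rfl (fun _ => rfl)
    (fun h => absurd rfl h) hω (h2.trans htop') ?_ ?_ ?_
  · rw [← hβω]; exact min_le_left _ _
  · rw [← hβω]; exact min_le_right _ _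
  · rw [← hβω]; exact min_choice _ _

theorem exists_of_mem_lower {k r n : ℕ} (hk : 1 ≤ k) (hr : 1 ≤ r) (hrn : r + 2 ≤ n) {ω : ℝ}
    (h1 : ((k : ℝ) + 1) * (k + 1 + r) / ((r + 1) * (k + 1 + (r + 1))) < ω)
    (h2 : ω < ((k : ℝ) + 1) / (r + 1)) :
    ∃ (ξ : Matrix (Fin n) (Fin (k + 1)) ℝ) (x : ℕ → Fin (k + 1) → ℤ) (y : ℕ → Fin n → ℤ),
      TotallyIrrational ξ ∧ IsBestApproxSeq ξ x y ∧ PropB x ∧ PropC ξ x y ∧ ¬ PropA ξ ∧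
        unifExp ξ x y = (ω : EReal) := by
  have hk0 : (0 : ℝ) < k := by exact_mod_cast hk
  have hr0 : (0 : ℝ) < r := by exact_mod_cast hr
  obtain ⟨σ₁, hσ₁⟩ : ∃ σ₁ : ℝ, σ₁ = ((k : ℝ) + 1) / r := ⟨_, rfl⟩
  obtain ⟨σ₂, hσ₂⟩ : ∃ σ₂ : ℝ, σ₂ = (k : ℝ) / (r + 1) := ⟨_, rfl⟩
  obtain ⟨σ₃, hσ₃⟩ : ∃ σ₃ : ℝ, σ₃ = (k : ℝ) / r := ⟨_, rfl⟩
  have hσ₁0 : 0 < σ₁ := by rw [hσ₁]; positivity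
  have hω : 0 < ω := lt_trans (by positivity) h1
  have hσω : σ₂ < ω := by
    refine lt_trans ?_ h1
    rw [hσ₂, div_lt_div_iff₀ (by positivity) (by positivity)]
    nlinarith [mul_pos hr0 hr0]
  obtain ⟨θ, hθ⟩ : ∃ θ, θ = (1 + σ₁) * (((k : ℝ) + 1) / (r + 1) - ω) / (ω - σ₂) := ⟨_, rfl⟩
  have hθ' : θ * (ω - σ₂) = (1 + σ₁) * (((k : ℝ) + 1) / (r + 1) - ω) := by
    rw [hθ, div_mul_cancel₀ _ (by linarith)]
  have hθ0 : 0 < θ := by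
    rw [hθ]
    have := sub_pos.2 h2
    have := sub_pos.2 hσω
    positivity
  have hbot : σ₁ + σ₂ * σ₁ = (1 + σ₁) * (((k : ℝ) + 1) / (r + 1)) := by
    rw [hσ₁, hσ₂]; field_simp; ring
  have hω2 : ω = (σ₁ + σ₂ * (1 + σ₁ + θ - 1)) / (1 + σ₁ + θ) := by
    rw [eq_div_iff (by positivity)]; linarith
  have hω3 : ω = (σ₁ + σ₂ * (1 + σ₁ + θ - 1) + σ₃ * (1 + σ₁ + θ - (1 + σ₁ + θ))) /
      (1 + σ₁ + θ) := by
    rw [sub_self, mul_zero, add_zero]; exact hω2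
  have hθmax : θ < σ₁ * (k + 1 + r) / (r + 1) := by
    rw [hθ, div_lt_iff₀ (by linarith)]
    have e : σ₁ * (k + 1 + r) / (r + 1) * (ω - σ₂) -
        (1 + σ₁) * (((k : ℝ) + 1) / (r + 1) - ω) = (k + 1 + r) * (k + 1 + (r + 1)) / (r * (r + 1)) *
        (ω - ((k : ℝ) + 1) * (k + 1 + r) / ((r + 1) * (k + 1 + (r + 1)))) := by
      rw [hσ₁, hσ₂]; field_simp; ring
    have := sub_pos.2 h1
    rw [← sub_pos, e]
    positivity
  refine exists_of_parameters hk hr (by omega) hσ₁ hσ₂ hσ₃ Bool (by simpa using hrn) false true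
    (by decide) (β := 1 + σ₁ + θ) (θ := θ) (by linarith) le_rfl hθ0.le (fun h => by simp at h)
    (fun _ => ⟨hθ0, hθmax, rfl⟩) hω ?_ hω2.le hω3.le (Or.inl hω2)
  refine h2.le.trans ?_
  rw [hσ₁]
  gcongr
  linarith

theorem exists_exponent {k n : ℕ} (hk : 1 ≤ k) (hn : 2 ≤ n) {ω : ℝ} (h1 : ((k : ℝ) + 1) / n ≤ ω)
    (h2 : ω ≤ ((k : ℝ) + 1) ^ 2 / (k + 1 + 1)) :
    ∃ (ξ : Matrix (Fin n) (Fin (k + 1)) ℝ) (x : ℕ → Fin (k + 1) → ℤ) (y : ℕ → Fin n → ℤ),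
      TotallyIrrational ξ ∧ IsBestApproxSeq ξ x y ∧ PropB x ∧ PropC ξ x y ∧ ¬ PropA ξ ∧
        unifExp ξ x y = (ω : EReal) := by
  obtain ⟨r, hr, hrn, h3, h4⟩ := exists_last_index
    (P := fun r : ℕ => ω ≤ (k + 1) * (k + r) / (r * (k + 1 + r)))
    (by push_cast; rw [one_mul, ← sq]; exact h2) hn
  rcases le_or_gt (((k : ℝ) + 1) / (r + 1)) ω with h5 | h5
  · exact exists_of_mem_upper hk hr hrn h5 h3
  · rcases h4 with rfl | h4
    · push_cast at h1; exact absurd h5 (not_lt.2 h1)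
    · have hrn' : r + 1 ≠ n := by
        rintro rfl
        push_cast at h1; exact absurd h5 (not_lt.2 h1)
      refine exists_of_mem_lower hk hr (by omega) ?_ h5
      push_cast at h4
      refine lt_of_eq_of_lt ?_ (not_le.1 h4)
      ring

/-- For `m, n ≥ 2` and any real `ω̂ ∈ [m/n, m²/(m+1)]`, there is a
totally irrational `ξ` satisfying (B) and (C), not (A), with uniform exponent `ω̂`. -/
theorem stmt_16 (m n : ℕ) (hm : 2 ≤ m) (hn : 2 ≤ n)
    (ωhat : ℝ) (hω₁ : (m : ℝ) / (n : ℝ) ≤ ωhat)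
    (hω₂ : ωhat ≤ (m : ℝ) ^ 2 / ((m : ℝ) + 1)) :
    ∃ (ξ : Matrix (Fin n) (Fin m) ℝ) (x : ℕ → Fin m → ℤ) (y : ℕ → Fin n → ℤ),
      TotallyIrrational ξ ∧ IsBestApproxSeq ξ x y ∧ PropB x ∧ PropC ξ x y ∧
      ¬ PropA ξ ∧ unifExp ξ x y = (ωhat : EReal) := by
  obtain ⟨k, rfl⟩ : ∃ k, m = k + 1 := ⟨m - 1, by omega⟩
  push_cast at hω₁ hω₂
  exact exists_exponent (by omega) hn hω₁ hω₂
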